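/- Let j be a natural number. If j is not of the form 2s+1 for some s ∈ {1,…,n}, then the local cohomology module H^j_I(S) of S with support in the ideal I of sub-maximal Pfaffians vanishes, i.e., (localCohomology I j).obj (ModuleCat.of S S) is subsingleton. -/

import Mathlib

open MvPolynomial

section Cech

variable {ι L : Type*}

/-- The alternating (Čech-type) differential on cochains indexed by lists, given by
`(d f) (k :: l) = f l - d (f (k :: ·)) l`. -/
def cechD [AddCommGroup L] : (List ι → L) → List ι → L
  | _, [] => 0
  | f, k :: l => f l - cechD (fun l' => f (k :: l')) l

section AddCommGroup

variable [AddCommGroup L]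

theorem cechD_nil (f : List ι → L) : cechD f [] = 0 := rfl

theorem cechD_cons (f : List ι → L) (k : ι) (l : List ι) :
    cechD f (k :: l) = f l - cechD (fun l' => f (k :: l')) l := rfl

theorem map_cechD {M : Type*} [AddCommGroup M] (φ : L →+ M) (f : List ι → L) (l : List ι) :
    cechD (fun l' => φ (f l')) l = φ (cechD f l) := by
  induction l generalizing f with
  | nil => simp [cechD_nil]
  | cons k l ih => rw [cechD_cons, cechD_cons, ih fun l' => f (k :: l'), map_sub]

theorem cechD_add (f g : List ι → L) (l : List ι) :
    cechD (f + g) l = cechD f l + cechD g l := by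
  induction l generalizing f g with
  | nil => simp [cechD_nil]
  | cons k l ih =>
    have := ih (fun l' => f (k :: l')) (fun l' => g (k :: l'))
    rw [cechD_cons, cechD_cons, cechD_cons, Pi.add_apply]
    rw [show (fun l' => (f + g) (k :: l')) = (fun l' => f (k :: l')) + fun l' => g (k :: l') from rfl,
      this]
    abel

/-- The Čech differential as an additive map. -/
def cechHom (ι L : Type*) [AddCommGroup L] : (List ι → L) →+ (List ι → L) :=
  AddMonoidHom.mk' cechD fun f g => funext fun l => cechD_add f g l

theorem cechHom_apply (f : List ι → L) : cechHom ι L f = cechD f := rfl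

theorem cechD_congr {f g : List ι → L} {l : List ι}
    (h : ∀ l', l' ⊆ l → l'.length + 1 = l.length → f l' = g l') : cechD f l = cechD g l := by
  induction l generalizing f g with
  | nil => rfl
  | cons k l ih =>
    rw [cechD_cons, cechD_cons, h l (List.subset_cons_self k l) rfl]
    congr 1
    refine ih fun l' hl' hlen => h _ (List.cons_subset_cons k hl') ?_
    simp [hlen]

theorem cechD_mem {G : Type*} [SetLike G L] [AddSubgroupClass G L] {S : G} {f : List ι → L}
    {l : List ι} (h : ∀ l', l' ⊆ l → l'.length + 1 = l.length → f l' ∈ S) : cechD f l ∈ S := by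
  induction l generalizing f with
  | nil => exact zero_mem S
  | cons k l ih =>
    rw [cechD_cons]
    refine sub_mem (h l (List.subset_cons_self k l) rfl) (ih fun l' hl' hlen => ?_)
    exact h _ (List.cons_subset_cons k hl') (by simp [hlen])

theorem cechD_cechD (f : List ι → L) (l : List ι) : cechD (cechD f) l = 0 := by
  induction l generalizing f with
  | nil => rfl
  | cons k l ih =>
    rw [cechD_cons]
    have : (fun l' => cechD f (k :: l')) = f + -(cechD fun l' => f (k :: l')) := by
      funext l'
      simp [cechD_cons, sub_eq_add_neg]
    rw [this, ← cechHom_apply (f + _), map_add, map_neg, Pi.add_apply, Pi.neg_apply,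
      cechHom_apply, cechHom_apply, ih]
    simp

theorem cechD_sub (f g : List ι → L) (l : List ι) :
    cechD (f - g) l = cechD f l - cechD g l := by
  rw [← cechHom_apply, map_sub]; rfl

theorem cechD_zero (l : List ι) : cechD (0 : List ι → L) l = 0 := by
  rw [← cechHom_apply, map_zero]; rfl

/-- Exactness in degree `j` of the Čech-type complex with vertices in `s` and coefficient groups
`F t`. -/
def CechExact [DecidableEq ι] (F : Finset ι → AddSubgroup L) (s : Finset ι) (j : ℕ) : Prop :=
  ∀ f : List ι → L,
    (∀ l, (∀ x ∈ l, x ∈ s) → l.length = j → f l ∈ F l.toFinset) →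
    (∀ l, (∀ x ∈ l, x ∈ s) → l.length = j + 1 → cechD f l = 0) →
    ∃ g : List ι → L, (∀ l, (∀ x ∈ l, x ∈ s) → l.length + 1 = j → g l ∈ F l.toFinset) ∧
      ∀ l, (∀ x ∈ l, x ∈ s) → l.length = j → cechD g l = f l

variable [DecidableEq ι] {F : Finset ι → AddSubgroup L}

theorem cechD_mem_of_mono (hF : Monotone F) {f : List ι → L} {l : List ι}
    (h : ∀ l', l' ⊆ l → l'.length + 1 = l.length → f l' ∈ F l'.toFinset) :
    cechD f l ∈ F l.toFinset :=
  cechD_mem fun l' hl' hlen => hF (fun x hx => by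
    rw [List.mem_toFinset] at hx ⊢; exact hl' hx) (h l' hl' hlen)

theorem CechExact.insert (hF : Monotone F) {s : Finset ι} {k : ι} (hk : k ∉ s) {j : ℕ}
    (h₁ : CechExact F s (j + 1)) (h₂ : CechExact (fun t => F (Insert.insert k t)) s j) :
    CechExact F (Insert.insert k s) (j + 1) := by
  classical
  intro f hf hfc
  obtain ⟨g, hg, hgf⟩ := h₁ f (fun l hl => hf l fun x hx => Finset.mem_insert_of_mem (hl x hx))
    (fun l hl => hfc l fun x hx => Finset.mem_insert_of_mem (hl x hx))
  let g' : List ι → L := fun l => if (∀ x ∈ l, x ∈ s) ∧ l.length = j then g l else 0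
  have hg' : ∀ l, g' l ∈ F l.toFinset := by
    intro l
    by_cases h : (∀ x ∈ l, x ∈ s) ∧ l.length = j
    · simp only [g', if_pos h]; exact hg l h.1 (by omega)
    · simp only [g', if_neg h]; exact zero_mem _
  have hdg' : ∀ l, (∀ x ∈ l, x ∈ s) → l.length = j + 1 → cechD g' l = f l := by
    intro l hl hlen
    rw [← hgf l hl hlen]
    refine cechD_congr fun l' hl' hlen' => if_pos ⟨fun x hx => hl x (hl' hx), by omega⟩
  set f₁ : List ι → L := f - cechD g' with hf₁
  have hf₁F : ∀ l, (∀ x ∈ l, x ∈ Insert.insert k s) → l.length = j + 1 → f₁ l ∈ F l.toFinset :=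
    fun l hl hlen => sub_mem (hf l hl hlen) (cechD_mem_of_mono hF fun l' _ _ => hg' l')
  have hf₁c : ∀ l, (∀ x ∈ l, x ∈ Insert.insert k s) → l.length = j + 1 + 1 → cechD f₁ l = 0 := by
    intro l hl hlen
    rw [hf₁, cechD_sub, hfc l hl hlen, cechD_cechD, sub_zero]
  have hf₁s : ∀ l, (∀ x ∈ l, x ∈ s) → l.length = j + 1 → f₁ l = 0 := by
    intro l hl hlen
    rw [hf₁, Pi.sub_apply, hdg' l hl hlen, sub_self]
  have hks : ∀ l : List ι, (∀ x ∈ l, x ∈ s) → ∀ x ∈ k :: l, x ∈ Insert.insert k s := by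
    intro l hl x hx
    rcases List.mem_cons.1 hx with rfl | hx
    · exact Finset.mem_insert_self _ _
    · exact Finset.mem_insert_of_mem (hl x hx)
  obtain ⟨u, hu, huf⟩ := h₂ (fun l => f₁ (k :: l))
    (fun l hl hlen => by
      have := hf₁F (k :: l) (hks l hl) (by simp [hlen])
      rwa [List.toFinset_cons] at this)
    (fun l hl hlen => by
      have := hf₁c (k :: l) (hks l hl) (by simp [hlen])
      rwa [cechD_cons, hf₁s l hl hlen, zero_sub, neg_eq_zero] at this)
  let U : List ι → L
    | [] => 0
    | h :: l => if h = k ∧ (∀ x ∈ l, x ∈ s) ∧ l.length + 1 = j then -u l else 0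
  have hU : ∀ l, U l ∈ F l.toFinset := by
    intro l
    cases l with
    | nil => exact zero_mem _
    | cons h l =>
      by_cases hh : h = k ∧ (∀ x ∈ l, x ∈ s) ∧ l.length + 1 = j
      · simp only [U, if_pos hh]
        rw [List.toFinset_cons, hh.1]
        exact neg_mem (hu l hh.2.1 hh.2.2)
      · simp only [U, if_neg hh]; exact zero_mem _
  have hUs : ∀ l, (∀ x ∈ l, x ∈ s) → U l = 0 := by
    intro l hl
    cases l with
    | nil => rfl
    | cons h l =>
      refine if_neg fun hh => hk ?_
      rw [← hh.1]; exact hl h (by simp)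
  have hdUs : ∀ l, (∀ x ∈ l, x ∈ s) → cechD U l = 0 := by
    intro l hl
    rw [← cechD_zero l]
    exact cechD_congr fun l' hl' _ => hUs l' fun x hx => hl x (hl' hx)
  have hdUk : ∀ l, (∀ x ∈ l, x ∈ s) → l.length = j → cechD U (k :: l) = f₁ (k :: l) := by
    intro l hl hlen
    rw [cechD_cons, hUs l hl, zero_sub, ← huf l hl hlen, ← cechHom_apply, ← cechHom_apply,
      ← Pi.neg_apply, ← map_neg]
    refine cechD_congr fun l' hl' hlen' => ?_
    have : U (k :: l') = -u l' := if_pos ⟨rfl, fun x hx => hl x (hl' hx), by omega⟩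
    simp [this]
  set f₂ : List ι → L := f₁ - cechD U with hf₂
  have hf₂F : ∀ l, (∀ x ∈ l, x ∈ Insert.insert k s) → l.length = j + 1 → f₂ l ∈ F l.toFinset :=
    fun l hl hlen => sub_mem (hf₁F l hl hlen) (cechD_mem_of_mono hF fun l' _ _ => hU l')
  have hf₂k : ∀ l, (∀ x ∈ l, x ∈ s) → l.length = j → f₂ (k :: l) = 0 := by
    intro l hl hlen
    rw [hf₂, Pi.sub_apply, hdUk l hl hlen, sub_self]
  refine ⟨g' + U + fun l => f₂ (k :: l), fun l hl hlen => ?_, fun l hl hlen => ?_⟩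
  · refine add_mem (add_mem (hg' l) (hU l)) ?_
    have hl1 : l.length = j := by omega
    by_cases hkl : k ∈ l
    · have := hf₂F (k :: l) (by
        intro x hx
        rcases List.mem_cons.1 hx with rfl | hx
        · exact Finset.mem_insert_self _ _
        · exact hl x hx) (by simp [hl1])
      rwa [List.toFinset_cons, Finset.insert_eq_self.2 (by simpa using hkl)] at this
    · have : f₂ (k :: l) = 0 := hf₂k l (fun x hx =>
        (Finset.mem_insert.1 (hl x hx)).resolve_left fun h => hkl (h ▸ hx)) hl1
      simp only [this]; exact zero_mem _
  · have h0 : cechD f₂ (k :: l) = 0 := by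
      rw [hf₂, cechD_sub, cechD_cechD, sub_zero]
      refine hf₁c _ (fun x hx => ?_) (by simp [hlen])
      rcases List.mem_cons.1 hx with rfl | hx
      · exact Finset.mem_insert_self _ _
      · exact hl x hx
    rw [cechD_cons, sub_eq_zero] at h0
    rw [cechD_add, cechD_add, ← h0, hf₂, hf₁]
    simp

theorem CechExact.of_card_lt (s : Finset ι) (F : Finset ι → AddSubgroup L) (hF : Monotone F)
    {j : ℕ} (hj : s.card < j) : CechExact F s j := by
  induction s using Finset.induction_on generalizing F j with
  | empty =>
    intro f _ _
    refine ⟨0, fun _ _ _ => zero_mem _, fun l hl hlen => ?_⟩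
    cases l with
    | nil => simp at hlen; simp at hj; omega
    | cons k l => exact absurd (hl k (by simp)) (by simp)
  | insert k s hk ih =>
    rw [Finset.card_insert_of_notMem hk] at hj
    obtain ⟨j, rfl⟩ : ∃ i, j = i + 1 := ⟨j - 1, by omega⟩
    exact CechExact.insert hF hk (ih F hF (by omega))
      (ih _ (fun a b hab => hF (Finset.insert_subset_insert k hab)) (by omega))

theorem CechExact.zero {s : Finset ι} (hs : s.Nonempty) : CechExact F s 0 := by
  intro f _ hfc
  refine ⟨0, fun _ _ _ => zero_mem _, fun l _ hlen => ?_⟩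
  obtain rfl := List.eq_nil_of_length_eq_zero hlen
  obtain ⟨k, hk⟩ := hs
  have := hfc [k] (by simpa using hk) rfl
  simpa [cechD_cons, cechD_nil] using this.symm

/-- Cochain cocycles of degree `j`. -/
def cechZ (F : Finset ι → AddSubgroup L) (j : ℕ) : AddSubgroup (List ι → L) where
  carrier := {f | (∀ l, l.length = j → f l ∈ F l.toFinset) ∧ ∀ l, l.length = j + 1 → cechD f l = 0}
  zero_mem' := ⟨fun _ _ => zero_mem _, fun _ _ => cechD_zero _⟩
  add_mem' := by
    rintro f g ⟨ha, ha'⟩ ⟨hb, hb'⟩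
    exact ⟨fun l hl => add_mem (ha l hl) (hb l hl), fun l hl => by
      rw [cechD_add, ha' l hl, hb' l hl, add_zero]⟩
  neg_mem' := by
    rintro f ⟨ha, ha'⟩
    exact ⟨fun l hl => neg_mem (ha l hl), fun l hl => by
      rw [← cechHom_apply, map_neg, Pi.neg_apply, cechHom_apply, ha' l hl, neg_zero]⟩

/-- Cochains of degree `j` which are coboundaries. -/
def cechB (F : Finset ι → AddSubgroup L) (j : ℕ) : AddSubgroup (List ι → L) where
  carrier := {f | ∃ g : List ι → L, (∀ l, l.length + 1 = j → g l ∈ F l.toFinset) ∧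
    ∀ l, l.length = j → cechD g l = f l}
  zero_mem' := ⟨0, fun _ _ => zero_mem _, fun _ _ => cechD_zero _⟩
  add_mem' := by
    rintro _ _ ⟨g, hg, hg'⟩ ⟨h, hh, hh'⟩
    exact ⟨g + h, fun l hl => add_mem (hg l hl) (hh l hl), fun l hl => by
      rw [cechD_add, hg' l hl, hh' l hl]; rfl⟩
  neg_mem' := by
    rintro _ ⟨g, hg, hg'⟩
    exact ⟨-g, fun l hl => neg_mem (hg l hl), fun l hl => by
      rw [← cechHom_apply, map_neg, Pi.neg_apply, cechHom_apply, hg' l hl]; rfl⟩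

theorem cechExact_univ_iff [Fintype ι] {j : ℕ} :
    CechExact F Finset.univ j ↔ cechZ F j ≤ cechB F j := by
  simp only [CechExact, Finset.mem_univ, implies_true, forall_const]
  constructor
  · intro h f hf
    exact h f hf.1 hf.2
  · intro h f hf hf'
    exact h ⟨hf, hf'⟩

theorem map_mem_cechZ {φ : L →+ L} (hφ : ∀ t, ∀ y ∈ F t, φ y ∈ F t) {j : ℕ} {f : List ι → L}
    (hf : f ∈ cechZ F j) : (fun l => φ (f l)) ∈ cechZ F j :=
  ⟨fun l hl => hφ _ _ (hf.1 l hl), fun l hl => by rw [map_cechD, hf.2 l hl, map_zero]⟩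

theorem map_mem_cechB {φ : L →+ L} (hφ : ∀ t, ∀ y ∈ F t, φ y ∈ F t) {j : ℕ} {f : List ι → L}
    (hf : f ∈ cechB F j) : (fun l => φ (f l)) ∈ cechB F j := by
  obtain ⟨g, hg, hg'⟩ := hf
  exact ⟨fun l => φ (g l), fun l hl => hφ _ _ (hg l hl), fun l hl => by rw [map_cechD, hg' l hl]⟩

end AddCommGroup

section Ring

variable [CommRing L]

theorem cechD_mul (a : L) (f : List ι → L) (l : List ι) :
    cechD (fun l' => a * f l') l = a * cechD f l :=
  map_cechD (AddMonoidHom.mulLeft a) f l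

/-- Exactness of the Čech complex from a partition of unity. -/
theorem CechExact.of_partition [DecidableEq ι] [Finite ι]
    {F : Finset ι → AddSubgroup L} {s : Finset ι} (q : ι → L)
    (hclear : ∀ c ∈ s, ∀ t, ∀ y ∈ F (Insert.insert c t), ∃ m₀, ∀ m, m₀ ≤ m → q c ^ m * y ∈ F t)
    (hunit : ∀ m : ℕ, ∃ β : ι → L, ∑ c ∈ s, β c * q c ^ m = 1 ∧ ∀ c ∈ s, ∀ t, ∀ y ∈ F t,
      β c * y ∈ F t) (j : ℕ) : CechExact F s j := by
  classical
  intro f hf hfc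
  have hd : ∀ c ∈ s, ∀ l, (∀ x ∈ l, x ∈ s) → l.length = j →
      cechD (fun l' => f (c :: l')) l = f l := by
    intro c hc l hl hlen
    have := hfc (c :: l) (by
      intro x hx
      rcases List.mem_cons.1 hx with rfl | hx
      exacts [hc, hl x hx]) (by simp [hlen])
    rw [cechD_cons, sub_eq_zero] at this
    exact this.symm
  have hfin : {l : List ι | l.length + 1 = j}.Finite := by
    refine (List.finite_length_eq ι (j - 1)).subset fun l hl => ?_
    have : l.length + 1 = j := hl
    simp only [Set.mem_ofPred_eq]; omega
  have key : ∃ m, ∀ p ∈ s ×ˢ hfin.toFinset, (∀ x ∈ p.2, x ∈ s) →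
      q p.1 ^ m * f (p.1 :: p.2) ∈ F p.2.toFinset := by
    have : ∀ p : ι × List ι, ∃ m₀, p ∈ s ×ˢ hfin.toFinset → (∀ x ∈ p.2, x ∈ s) → ∀ m, m₀ ≤ m →
        q p.1 ^ m * f (p.1 :: p.2) ∈ F p.2.toFinset := by
      intro p
      by_cases hp : p ∈ s ×ˢ hfin.toFinset ∧ (∀ x ∈ p.2, x ∈ s)
      · obtain ⟨h1, h2⟩ := hp
        rw [Finset.mem_product, Set.Finite.mem_toFinset] at h1
        obtain ⟨m₀, hm₀⟩ := hclear p.1 h1.1 p.2.toFinset (f (p.1 :: p.2)) (by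
          rw [← List.toFinset_cons]
          refine hf _ (fun x hx => ?_) (by simpa using h1.2)
          rcases List.mem_cons.1 hx with rfl | hx
          exacts [h1.1, h2 x hx])
        exact ⟨m₀, fun _ _ => hm₀⟩
      · exact ⟨0, fun h1 h2 => absurd ⟨h1, h2⟩ hp⟩
    choose m hm using this
    refine ⟨(s ×ˢ hfin.toFinset).sup m, fun p hp h2 => hm p hp h2 _ (Finset.le_sup hp)⟩
  obtain ⟨m, hm⟩ := key
  obtain ⟨β, hβ, hβF⟩ := hunit m
  refine ⟨fun l => ∑ c ∈ s, β c * (q c ^ m * f (c :: l)), fun l hl hlen => ?_, fun l hl hlen => ?_⟩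
  · refine sum_mem fun c hc => hβF c hc _ _ (hm (c, l) ?_ hl)
    simp [hc, hlen]
  · have : (fun l => ∑ c ∈ s, β c * (q c ^ m * f (c :: l))) =
        ∑ c ∈ s, fun l => (β c * q c ^ m) * f (c :: l) := by
      funext l; simp [mul_assoc]
    rw [this, ← cechHom_apply, map_sum, Finset.sum_apply]
    simp only [cechHom_apply, cechD_mul]
    rw [Finset.sum_congr rfl fun c hc => by rw [hd c hc l hl hlen], ← Finset.sum_mul, hβ, one_mul]

/-- If every cocycle is torsion with respect to each `x i`, then it suffices to check that the
cocycles annihilated by all the `x i` up to coboundaries are coboundaries. -/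
theorem le_of_torsion_of_socle {κ V : Type*} [Finite κ] [AddCommGroup V] [Module L V] (x : κ → L)
    (Z B : AddSubgroup V) (hZ : ∀ i, ∀ z ∈ Z, x i • z ∈ Z) (hB : ∀ i, ∀ z ∈ B, x i • z ∈ B)
    (htors : ∀ i, ∀ z ∈ Z, ∃ m, x i ^ m • z ∈ B)
    (hsoc : ∀ z ∈ Z, (∀ i, x i • z ∈ B) → z ∈ B) : Z ≤ B := by
  classical
  have := Fintype.ofFinite κ
  have key : ∀ (W : Finset κ), ∀ z ∈ Z, (∀ i ∉ W, x i • z ∈ B) → z ∈ B := by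
    intro W
    induction W using Finset.induction_on with
    | empty => exact fun z hz h => hsoc z hz fun i => h i (by simp)
    | insert w W hw ih =>
      have aux : ∀ m : ℕ, ∀ z ∈ Z, (∀ i ∉ insert w W, x i • z ∈ B) → x w ^ m • z ∈ B → z ∈ B := by
        intro m
        induction m with
        | zero => intro z _ _ h; simpa using h
        | succ m ihm =>
          intro z hz h hm
          refine ih z hz fun i hi => ?_
          by_cases hiw : i = w
          · subst hiw
            refine ihm _ (hZ i z hz) (fun k hk => ?_) ?_
            · rw [smul_comm]; exact hB i _ (h k hk)
            · rwa [smul_smul, ← pow_succ]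
          · exact h i (by simp [hiw, hi])
      intro z hz h
      obtain ⟨m, hm⟩ := htors w z hz
      exact aux m z hz h hm
  exact fun z hz => key Finset.univ z hz fun i hi => absurd (Finset.mem_univ i) hi

end Ring

end Cech

section Pfaffian

variable {R : Type*} [CommRing R] {n : ℕ}

theorem two_mul_lt_two_mul (i : Fin n) : 2 * (i : ℕ) < 2 * n := by omega

theorem two_mul_add_one_lt_two_mul (i : Fin n) : 2 * (i : ℕ) + 1 < 2 * n := by omega

/-- The unnormalised Pfaffian of a `2n × 2n` matrix. -/
def pfaffSum (Y : Matrix (Fin (2 * n)) (Fin (2 * n)) R) : R :=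
  ∑ σ : Equiv.Perm (Fin (2 * n)), (Equiv.Perm.sign σ : ℤ) •
    ∏ i : Fin n, Y (σ ⟨2 * (i : ℕ), two_mul_lt_two_mul i⟩)
      (σ ⟨2 * (i : ℕ) + 1, two_mul_add_one_lt_two_mul i⟩)

/-- The product of the entries of `X` at the pairs `(σ 1, σ 2), (σ 3, σ 4), …`. -/
def pairProd (X : Matrix (Fin (2 * n + 1)) (Fin (2 * n + 1)) R)
    (σ : Fin (2 * n + 1) → Fin (2 * n + 1)) : R :=
  ∏ i : Fin n, X (σ ⟨2 * (i : ℕ) + 1, by omega⟩) (σ ⟨2 * (i : ℕ) + 2, by omega⟩)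

/-- The signed, unnormalised sub-maximal Pfaffians of a `(2n+1) × (2n+1)` matrix. -/
def subPfaff (X : Matrix (Fin (2 * n + 1)) (Fin (2 * n + 1)) R) (c : Fin (2 * n + 1)) : R :=
  ∑ σ : Equiv.Perm (Fin (2 * n + 1)),
    if σ 0 = c then (Equiv.Perm.sign σ : ℤ) • pairProd X σ else 0

theorem subPfaff_eq (X : Matrix (Fin (2 * n + 1)) (Fin (2 * n + 1)) R) (k : Fin (2 * n + 1)) :
    subPfaff X k = (-1) ^ (k : ℕ) * pfaffSum (X.submatrix k.succAbove k.succAbove) := by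
  unfold subPfaff
  rw [← Equiv.sum_comp (Equiv.mulLeft (k.cycleRange⁻¹)), ← Equiv.Perm.decomposeFin.symm.sum_comp,
    Fintype.sum_prod_type, Finset.sum_eq_single 0, pfaffSum, Finset.mul_sum]
  · refine Finset.sum_congr rfl fun e _ => ?_
    have h0 : (Equiv.mulLeft (k.cycleRange⁻¹)) (Equiv.Perm.decomposeFin.symm (0, e)) 0 = k := by
      simp [Equiv.Perm.inv_def]
    have hs : ∀ x : Fin (2 * n), (Equiv.mulLeft (k.cycleRange⁻¹))
        (Equiv.Perm.decomposeFin.symm (0, e)) x.succ = k.succAbove (e x) := by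
      intro x; simp [Equiv.Perm.inv_def]
    rw [if_pos h0]
    have hsign : Equiv.Perm.sign ((Equiv.mulLeft (k.cycleRange⁻¹))
        (Equiv.Perm.decomposeFin.symm (0, e))) = (-1) ^ (k : ℕ) * Equiv.Perm.sign e := by
      simp [Equiv.Perm.sign_mul, Equiv.Perm.sign_inv, Fin.sign_cycleRange]
    rw [hsign, pairProd]
    have hprod : ∀ i : Fin n, X ((Equiv.mulLeft (k.cycleRange⁻¹))
          (Equiv.Perm.decomposeFin.symm (0, e)) ⟨2 * (i : ℕ) + 1, by omega⟩)
        ((Equiv.mulLeft (k.cycleRange⁻¹))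
          (Equiv.Perm.decomposeFin.symm (0, e)) ⟨2 * (i : ℕ) + 2, by omega⟩) =
        (X.submatrix k.succAbove k.succAbove) (e ⟨2 * (i : ℕ), two_mul_lt_two_mul i⟩)
          (e ⟨2 * (i : ℕ) + 1, two_mul_add_one_lt_two_mul i⟩) := by
      intro i
      have h1 := hs ⟨2 * (i : ℕ), two_mul_lt_two_mul i⟩
      have h2 := hs ⟨2 * (i : ℕ) + 1, two_mul_add_one_lt_two_mul i⟩
      rw [Fin.succ_mk] at h1 h2
      rw [h1, h2, Matrix.submatrix_apply]
    rw [Finset.prod_congr rfl fun i _ => hprod i]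
    simp [zsmul_eq_mul, mul_assoc]
  · intro p _ hp
    refine Finset.sum_eq_zero fun e _ => if_neg fun h => hp ?_
    have : k.cycleRange⁻¹ p = k := by simpa using h
    rw [Equiv.Perm.inv_eq_iff_eq] at this
    rw [this]; simp
  · simp

/-- The partner of a position in the pairing `(1, 2), (3, 4), …`, with `0` its own partner. -/
def pairPartner (p : Fin (2 * n + 1)) : Fin (2 * n + 1) :=
  if (p : ℕ) = 0 then 0 else if h : (p : ℕ) % 2 = 1 then ⟨p + 1, by omega⟩ else ⟨p - 1, by omega⟩

theorem sum_mul_subPfaff {X : Matrix (Fin (2 * n + 1)) (Fin (2 * n + 1)) R}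
    (hX : ∀ a b, X b a = -X a b) (hX0 : ∀ a, X a a = 0) (e : Fin (2 * n + 1)) :
    ∑ c, X e c * subPfaff X c = 0 := by
  have h1 : ∑ c, X e c * subPfaff X c = ∑ σ : Equiv.Perm (Fin (2 * n + 1)),
      (Equiv.Perm.sign σ : ℤ) • (X e (σ 0) * pairProd X σ) := by
    simp only [subPfaff, Finset.mul_sum]
    rw [Finset.sum_comm]
    refine Finset.sum_congr rfl fun σ _ => ?_
    simp [mul_left_comm]
  rw [h1]
  have hp : ∀ σ : Equiv.Perm (Fin (2 * n + 1)), σ⁻¹ e ≠ 0 →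
      X e (σ 0) * pairProd X σ = X e ((σ * Equiv.swap 0 (pairPartner (σ⁻¹ e))) 0) *
        pairProd X (σ * Equiv.swap 0 (pairPartner (σ⁻¹ e)) : Equiv.Perm _) := by
    intro σ hσ
    obtain ⟨p, hpe⟩ : ∃ p, p = σ⁻¹ e := ⟨_, rfl⟩
    rw [← hpe] at hσ ⊢
    have hσp : σ p = e := by rw [hpe]; simp
    have hp0 : (p : ℕ) ≠ 0 := fun h => hσ (Fin.ext h)
    have hpl := p.2
    obtain ⟨i₀, hi₀⟩ : ∃ i₀ : Fin n, (i₀ : ℕ) = (p - 1 : ℕ) / 2 := ⟨⟨(p - 1 : ℕ) / 2, by omega⟩, rfl⟩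
    have key : ∀ i ≠ i₀, ∀ r : Fin (2 * n + 1), ((r : ℕ) = 2 * i + 1 ∨ (r : ℕ) = 2 * i + 2) →
        (σ * Equiv.swap 0 (pairPartner p)) r = σ r := by
      intro i hi r hr
      rw [Equiv.Perm.mul_apply, Equiv.swap_apply_of_ne_of_ne]
      · intro h; rw [h] at hr; simp at hr
      · intro h
        apply hi
        apply Fin.ext
        have : (r : ℕ) = if (p : ℕ) % 2 = 1 then (p : ℕ) + 1 else (p : ℕ) - 1 := by
          rw [h, pairPartner, if_neg hp0]; split_ifs <;> rfl
        split_ifs at this <;> omega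
    unfold pairProd
    rw [← Finset.mul_prod_erase _ _ (Finset.mem_univ i₀),
      ← Finset.mul_prod_erase _ (fun i : Fin n => X ((σ * Equiv.swap 0 (pairPartner p))
        ⟨2 * (i : ℕ) + 1, _⟩) ((σ * Equiv.swap 0 (pairPartner p)) ⟨2 * (i : ℕ) + 2, _⟩))
        (Finset.mem_univ i₀), ← mul_assoc, ← mul_assoc]
    congr 1
    · rcases Nat.mod_two_eq_zero_or_one p with h | h
      · have e1 : (⟨2 * (i₀ : ℕ) + 2, by omega⟩ : Fin (2 * n + 1)) = p := Fin.ext (by simp; omega)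
        have e2 : (⟨2 * (i₀ : ℕ) + 1, by omega⟩ : Fin (2 * n + 1)) = pairPartner p := by
          apply Fin.ext
          rw [pairPartner, if_neg hp0, dif_neg (by omega)]; simp; omega
        have e3 : p ≠ pairPartner p := fun h' => by
          have := e1.trans (h'.trans e2.symm)
          simp [Fin.ext_iff] at this
        have e4 : pairPartner p ≠ 0 := by rw [← e2]; simp [Fin.ext_iff]
        rw [e1, e2]
        simp only [Equiv.Perm.mul_apply, Equiv.swap_apply_left, Equiv.swap_apply_right,
          Equiv.swap_apply_of_ne_of_ne hσ e3, hσp]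
        rw [hX e, hX e (σ 0)]; ring
      · have e1 : (⟨2 * (i₀ : ℕ) + 1, by omega⟩ : Fin (2 * n + 1)) = p := Fin.ext (by simp; omega)
        have e2 : (⟨2 * (i₀ : ℕ) + 2, by omega⟩ : Fin (2 * n + 1)) = pairPartner p := by
          apply Fin.ext
          rw [pairPartner, if_neg hp0, dif_pos h]; simp; omega
        have e3 : p ≠ pairPartner p := fun h' => by
          have := e1.trans (h'.trans e2.symm)
          simp [Fin.ext_iff] at this
        rw [e1, e2]
        simp only [Equiv.Perm.mul_apply, Equiv.swap_apply_left, Equiv.swap_apply_right,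
          Equiv.swap_apply_of_ne_of_ne hσ e3, hσp]
        ring
    · refine Finset.prod_congr rfl fun i hi => ?_
      have hi := Finset.ne_of_mem_erase hi
      rw [key i hi _ (Or.inl rfl), key i hi _ (Or.inr rfl)]
  have hne : ∀ p : Fin (2 * n + 1), p ≠ 0 → pairPartner p ≠ 0 ∧ p ≠ pairPartner p := by
    intro p h
    have hp0 : (p : ℕ) ≠ 0 := fun h' => h (Fin.ext h')
    constructor
    · intro h'
      have := congrArg Fin.val h'
      rw [pairPartner, if_neg hp0] at this
      split_ifs at this <;> simp at this; omega
    · intro h'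
      have := congrArg Fin.val h'
      rw [pairPartner, if_neg hp0] at this
      split_ifs at this <;> simp at this; omega
  have h00 : pairPartner (0 : Fin (2 * n + 1)) = 0 := by simp [pairPartner]
  refine Finset.sum_involution (fun σ _ => σ * Equiv.swap 0 (pairPartner (σ⁻¹ e))) ?_ ?_ ?_ ?_
  · intro σ _
    by_cases h : σ⁻¹ e = 0
    · have : σ 0 = e := by rw [← h]; simp
      simp [h, h00, this, hX0]
    · rw [hp σ h, Equiv.Perm.sign_mul, Equiv.Perm.sign_swap (hne _ h).1.symm]
      simp
  · intro σ _ hσ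
    by_cases h : σ⁻¹ e = 0
    · have : σ 0 = e := by rw [← h]; simp
      simp [this, hX0] at hσ
    · simp only [ne_eq, mul_eq_left, Equiv.swap_eq_one_iff]
      exact (hne _ h).1.symm
  · exact fun _ _ => Finset.mem_univ _
  · intro σ _
    have : (σ * Equiv.swap 0 (pairPartner (σ⁻¹ e)))⁻¹ e = σ⁻¹ e := by
      rw [mul_inv_rev, Equiv.swap_inv, Equiv.Perm.mul_apply]
      by_cases h : σ⁻¹ e = 0
      · simp [h, h00]
      · rw [Equiv.swap_apply_of_ne_of_ne h (hne _ h).2]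
    simp only [this, mul_assoc, Equiv.swap_mul_self, mul_one]

end Pfaffian

section PfaffianDerivation

variable {k R : Type*} [CommRing k] [CommRing R] [Algebra k R] {n : ℕ}

theorem Derivation.leibniz_finset_prod {ι : Type*} [DecidableEq ι] (D : Derivation k R R)
    (s : Finset ι) (f : ι → R) :
    D (∏ i ∈ s, f i) = ∑ i ∈ s, (∏ j ∈ s.erase i, f j) * D (f i) := by
  induction s using Finset.induction_on with
  | empty => simp
  | insert a s ha ih =>
    rw [Finset.prod_insert ha, D.leibniz, ih, Finset.sum_insert ha, Finset.erase_insert ha,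
      smul_eq_mul, smul_eq_mul, Finset.mul_sum, add_comm]
    congr 1
    refine Finset.sum_congr rfl fun i hi => ?_
    have hai : a ≠ i := fun h => ha (h ▸ hi)
    rw [Finset.erase_insert_of_ne hai, Finset.prod_insert fun h => ha (Finset.mem_of_mem_erase h),
      mul_assoc]

variable {D : Derivation k R R} {X : Matrix (Fin (2 * n + 1)) (Fin (2 * n + 1)) R}
  {a b : Fin (2 * n + 1)}

theorem derivation_pairProd
    (hD : ∀ c d, D (X c d) = (if c = a then X b d else 0) + if d = a then X c b else 0)
    (σ : Equiv.Perm (Fin (2 * n + 1))) :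
    D (pairProd X σ) = if σ 0 = a then 0 else pairProd X (Function.update σ (σ⁻¹ a) b) := by
  obtain ⟨p, hpe⟩ : ∃ p, p = σ⁻¹ a := ⟨_, rfl⟩
  have hσp : σ p = a := by rw [hpe]; simp
  have hσ : ∀ r, σ r = a ↔ r = p := fun r => by rw [← hσp, σ.injective.eq_iff]
  rw [← hpe, pairProd, Derivation.leibniz_finset_prod]
  simp only [hD, hσ]
  by_cases hp : p = 0
  · rw [if_pos hp.symm]
    refine Finset.sum_eq_zero fun i _ => ?_
    rw [if_neg, if_neg] <;> simp [hp, Fin.ext_iff]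
  · rw [if_neg (Ne.symm hp)]
    have hp0 : (p : ℕ) ≠ 0 := fun h => hp (Fin.ext h)
    have hpl := p.2
    obtain ⟨i₀, hi₀⟩ : ∃ i₀ : Fin n, (i₀ : ℕ) = (p - 1 : ℕ) / 2 := ⟨⟨(p - 1 : ℕ) / 2, by omega⟩, rfl⟩
    rw [Finset.sum_eq_single i₀, pairProd, ← Finset.mul_prod_erase _ _ (Finset.mem_univ i₀), mul_comm]
    · congr 1
      · rcases Nat.mod_two_eq_zero_or_one p with h | h
        · have e1 : (⟨2 * (i₀ : ℕ) + 2, by omega⟩ : Fin (2 * n + 1)) = p := Fin.ext (by simp; omega)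
          have e2 : (⟨2 * (i₀ : ℕ) + 1, by omega⟩ : Fin (2 * n + 1)) ≠ p := fun h' => by
            have := h'.trans e1.symm
            simp [Fin.ext_iff] at this
          rw [if_neg e2, if_pos e1, zero_add, e1, Function.update_self, Function.update_of_ne e2]
        · have e1 : (⟨2 * (i₀ : ℕ) + 1, by omega⟩ : Fin (2 * n + 1)) = p := Fin.ext (by simp; omega)
          have e2 : (⟨2 * (i₀ : ℕ) + 2, by omega⟩ : Fin (2 * n + 1)) ≠ p := fun h' => by
            have := h'.trans e1.symm
            simp [Fin.ext_iff] at this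
          rw [if_neg e2, if_pos e1, add_zero, e1, Function.update_self, Function.update_of_ne e2]
      · refine Finset.prod_congr rfl fun i hi => ?_
        have hi : (i : ℕ) ≠ i₀ := fun h => Finset.ne_of_mem_erase hi (Fin.ext h)
        rw [Function.update_of_ne, Function.update_of_ne] <;>
        · intro h
          have := congrArg Fin.val h
          simp only at this
          omega
    · intro i _ hi
      have hi : (i : ℕ) ≠ i₀ := fun h => hi (Fin.ext h)
      rw [if_neg, if_neg]
      · simp
      all_goals
        intro h
        have := congrArg Fin.val h
        simp only at this
        omega
    · simp

theorem derivation_subPfaff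
    (hD : ∀ c d, D (X c d) = (if c = a then X b d else 0) + if d = a then X c b else 0)
    (c : Fin (2 * n + 1)) :
    D (subPfaff X c) = (if a = b then subPfaff X c else 0) - if c = b then subPfaff X a else 0 := by
  have h1 : ∀ c, D (subPfaff X c) = ∑ σ : Equiv.Perm (Fin (2 * n + 1)), if σ 0 = c then
      (Equiv.Perm.sign σ : ℤ) • (if σ 0 = a then 0 else
        pairProd X (Function.update σ (σ⁻¹ a) b)) else 0 := by
    intro c
    rw [subPfaff, map_sum]
    refine Finset.sum_congr rfl fun σ _ => ?_
    split_ifs with h h'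
    · rw [map_zsmul, derivation_pairProd hD, if_pos h']
    · rw [map_zsmul, derivation_pairProd hD, if_neg h']
    · simp
  rw [h1]
  by_cases hca : c = a
  · subst hca
    rw [Finset.sum_eq_zero]
    · by_cases h : c = b
      · simp [h]
      · simp [h]
    · intro σ _; split_ifs <;> simp
  by_cases hab : a = b
  · subst hab
    rw [if_pos rfl, if_neg hca, sub_zero, subPfaff]
    refine Finset.sum_congr rfl fun σ _ => ?_
    split_ifs with h h'
    · exact absurd (h.symm.trans h') hca
    · have : Function.update σ (σ⁻¹ a) a = σ := by
        rw [Function.update_eq_self_iff]; simp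
      rw [this]
    · rfl
  rw [if_neg hab, zero_sub]
  have hupd : ∀ σ : Equiv.Perm (Fin (2 * n + 1)),
      Function.update (⇑(Equiv.swap a b * σ)) ((Equiv.swap a b * σ)⁻¹ a) b =
        Function.update σ (σ⁻¹ a) b := by
    intro σ
    have e1 : (Equiv.swap a b * σ)⁻¹ a = σ⁻¹ b := by simp [mul_inv_rev]
    rw [e1]
    funext x
    by_cases hx : x = σ⁻¹ a
    · subst hx
      have : σ⁻¹ a ≠ σ⁻¹ b := fun h => hab (σ⁻¹.injective h)
      rw [Function.update_self, Function.update_of_ne this]; simp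
    · rw [Function.update_of_ne hx]
      by_cases hx' : x = σ⁻¹ b
      · subst hx'; simp
      · rw [Function.update_of_ne hx', Equiv.Perm.mul_apply, Equiv.swap_apply_of_ne_of_ne]
        · intro h; exact hx (by rw [← h]; simp)
        · intro h; exact hx' (by rw [← h]; simp)
  have hsign : ∀ σ : Equiv.Perm (Fin (2 * n + 1)),
      ((Equiv.Perm.sign (Equiv.swap a b * σ) : ℤˣ) : ℤ) = -(Equiv.Perm.sign σ : ℤ) := by
    intro σ
    rw [Equiv.Perm.sign_mul, Equiv.Perm.sign_swap hab]; simp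
  by_cases hcb : c = b
  · subst hcb
    rw [if_pos rfl, subPfaff, ← Equiv.sum_comp (Equiv.mulLeft (Equiv.swap a c)),
      ← Finset.sum_neg_distrib]
    refine Finset.sum_congr rfl fun σ _ => ?_
    rw [Equiv.coe_mulLeft, hupd, hsign]
    have e1 : (Equiv.swap a c * σ) 0 = c ↔ σ 0 = a := by
      rw [Equiv.Perm.mul_apply, Equiv.swap_apply_eq_iff, Equiv.swap_apply_right]
    have e2 : (Equiv.swap a c * σ) 0 = a ↔ σ 0 = c := by
      rw [Equiv.Perm.mul_apply, Equiv.swap_apply_eq_iff, Equiv.swap_apply_left]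
    rw [if_congr e1 rfl rfl, if_congr e2 rfl rfl]
    by_cases h : σ 0 = a
    · rw [if_pos h, if_pos h, if_neg (by rw [h]; exact hab)]
      have : pairProd X (Function.update σ (σ⁻¹ a) c) = pairProd X σ := by
        have h0 : σ⁻¹ a = 0 := by rw [← h]; simp
        unfold pairProd
        refine Finset.prod_congr rfl fun i _ => ?_
        rw [h0, Function.update_of_ne, Function.update_of_ne] <;> simp [Fin.ext_iff]
      rw [this, neg_smul]
    · rw [if_neg h, if_neg h, neg_zero]
  · rw [if_neg hcb, neg_zero]
    refine Finset.sum_involution (fun σ _ => Equiv.swap a b * σ) ?_ ?_ ?_ ?_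
    · intro σ _
      rw [hupd, hsign]
      have e1 : (Equiv.swap a b * σ) 0 = c ↔ σ 0 = c := by
        rw [Equiv.Perm.mul_apply, Equiv.swap_apply_eq_iff, Equiv.swap_apply_of_ne_of_ne hca hcb]
      have e2 : (Equiv.swap a b * σ) 0 = a ↔ σ 0 = b := by
        rw [Equiv.Perm.mul_apply, Equiv.swap_apply_eq_iff, Equiv.swap_apply_left]
      rw [if_congr e1 rfl rfl, if_congr e2 rfl rfl]
      by_cases h : σ 0 = c
      · rw [if_pos h, if_pos h, if_neg (by rw [h]; exact hca), if_neg (by rw [h]; exact hcb)]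
        simp
      · rw [if_neg h, if_neg h, add_zero]
    · intro σ _ _
      simpa using hab
    · exact fun _ _ => Finset.mem_univ _
    · intro σ _
      rw [← mul_assoc, Equiv.swap_mul_self, one_mul]

theorem derivation_pfaffSum {D : Derivation k R R} {Y : Matrix (Fin (2 * n)) (Fin (2 * n)) R}
    {a b : Fin (2 * n)}
    (hD : ∀ c d, D (Y c d) = (if c = a then Y b d else 0) + if d = a then Y c b else 0) :
    D (pfaffSum Y) = if a = b then pfaffSum Y else 0 := by
  let X : Matrix (Fin (2 * n + 1)) (Fin (2 * n + 1)) R := fun c d =>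
    Fin.cases 0 (fun c => Fin.cases 0 (fun d => Y c d) d) c
  have hX0 : ∀ d, X 0 d = 0 := fun _ => rfl
  have hX0' : ∀ d, X d 0 = 0 := fun d => by cases d using Fin.cases <;> rfl
  have hXs : ∀ c d, X c.succ d.succ = Y c d := fun _ _ => rfl
  have hq : subPfaff X 0 = pfaffSum Y := by
    rw [subPfaff_eq]
    simp only [Fin.val_zero, pow_zero, one_mul]
    congr 1
  rw [← hq, derivation_subPfaff (a := a.succ) (b := b.succ) (X := X)]
  · simp [(Fin.succ_ne_zero b).symm]
  · intro c d
    cases c using Fin.cases with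
    | zero => simp [hX0, (Fin.succ_ne_zero a).symm]
    | succ c =>
      cases d using Fin.cases with
      | zero => simp [hX0', (Fin.succ_ne_zero a).symm]
      | succ d => simp [hXs, hD]

end PfaffianDerivation

section ConstantRatio

theorem MvPolynomial.coeff_X_mul_pderiv {k σ : Type*} [Field k] (i : σ) (p : MvPolynomial σ k) (α : σ →₀ ℕ) :
    coeff α (X i * pderiv i p) = α i * coeff α p := by
  classical
  induction p using MvPolynomial.induction_on' with
  | monomial b a =>
    rw [X_mul_pderiv_monomial, coeff_smul, coeff_monomial]
    split_ifs with h
    · simp [h]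
    · simp
  | add p q hp hq => rw [map_add, mul_add, coeff_add, coeff_add, hp, hq, mul_add]

variable {k σ : Type*} [Field k] [CharZero k] [Finite σ]

/-- Two polynomials whose ratio has vanishing derivatives are proportional. -/
theorem MvPolynomial.exists_eq_C_mul {u v : MvPolynomial σ k} (hv : v ≠ 0)
    (h : ∀ i, v * pderiv i u = u * pderiv i v) : ∃ c : k, u = C c * v := by
  classical
  let _ : LinearOrder σ := linearOrderOfSTO (WellOrderingRel : σ → σ → Prop)
  let m : MonomialOrder σ := MonomialOrder.lex
  have hv' := m.leadingCoeff_ne_zero_iff.2 hv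
  refine ⟨coeff (m.degree v) u / m.leadingCoeff v, ?_⟩
  by_contra hne
  set c := coeff (m.degree v) u / m.leadingCoeff v
  set w := u - C c * v with hw
  have hw0 : w ≠ 0 := sub_ne_zero.2 hne
  have hwc : coeff (m.degree v) w = 0 := by
    rw [hw, coeff_sub, coeff_C_mul]
    change _ - c * m.leadingCoeff v = 0
    rw [div_mul_cancel₀ _ hv', sub_self]
  have hwd : ∀ i, v * pderiv i w = w * pderiv i v := by
    intro i
    rw [hw, map_sub, pderiv_C_mul]
    linear_combination h i
  have hle : ∀ (i : σ) (p : MvPolynomial σ k),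
      m.toSyn (m.degree (X i * pderiv i p)) ≤ m.toSyn (m.degree p) := by
    intro i p
    rw [m.degree_le_iff]
    intro d hd
    refine m.le_degree ?_
    rw [mem_support_iff, coeff_X_mul_pderiv] at hd
    exact mem_support_iff.2 (right_ne_zero_of_mul hd)
  have heq : m.degree w = m.degree v := by
    ext i
    have h1 := congrArg (coeff (m.degree v + m.degree w)) (congrArg (X i * ·) (hwd i))
    rw [show X i * (v * pderiv i w) = v * (X i * pderiv i w) by ring,
      show X i * (w * pderiv i v) = (X i * pderiv i v) * w by ring,
      m.coeff_mul_of_add_of_degree_le le_rfl (hle i w),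
      m.coeff_mul_of_add_of_degree_le (hle i v) le_rfl, coeff_X_mul_pderiv, coeff_X_mul_pderiv] at h1
    have hw1 := m.leadingCoeff_ne_zero_iff.2 hw0
    unfold MonomialOrder.leadingCoeff at hw1 hv'
    have h2 : (m.degree w i : k) = m.degree v i := by
      have h3 : (m.degree w i - m.degree v i : k) * (coeff (m.degree v) v * coeff (m.degree w) w) = 0 := by
        linear_combination h1
      rcases mul_eq_zero.1 h3 with h4 | h4
      · exact sub_eq_zero.1 h4
      · exact absurd h4 (mul_ne_zero hv' hw1)
    exact_mod_cast h2
  rw [← heq] at hwc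
  exact m.leadingCoeff_ne_zero_iff.2 hw0 hwc

end ConstantRatio

section DualNumberHom

/-- The ring homomorphism to the trivial square-zero extension attached to a derivation. -/
def derivationHom {k A B : Type*} [CommRing k] [CommRing A] [CommRing B] [Algebra k A] [Algebra A B]
    [Algebra k B] [IsScalarTower k A B] (D : Derivation k A B) :
    A →+* TrivSqZeroExt B B where
  toFun x := TrivSqZeroExt.inl (algebraMap A B x) + TrivSqZeroExt.inr (D x)
  map_one' := by ext <;> simp
  map_zero' := by ext <;> simp
  map_add' x y := by ext <;> simp
  map_mul' x y := by
    ext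
    · simp
    · simp only [TrivSqZeroExt.snd_mul, TrivSqZeroExt.snd_add, TrivSqZeroExt.snd_inl,
        TrivSqZeroExt.snd_inr, TrivSqZeroExt.fst_add, TrivSqZeroExt.fst_inl, TrivSqZeroExt.fst_inr,
        zero_add, add_zero, D.leibniz, Algebra.smul_def (R := A) (A := B), smul_eq_mul,
        MulOpposite.smul_eq_mul_unop, MulOpposite.unop_op]
      ring

variable {k R : Type*} [CommRing k] [CommRing R] [Algebra k R] {N : ℕ}

theorem derivation_det {D : Derivation k R R} {Y : Matrix (Fin N) (Fin N) R} {a b : Fin N}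
    (hD : ∀ c d, D (Y c d) = (if c = a then Y b d else 0) + if d = a then Y c b else 0) :
    D Y.det = if a = b then 2 * Y.det else 0 := by
  let i : R →+* TrivSqZeroExt R R := TrivSqZeroExt.inlHom R R
  let ε : TrivSqZeroExt R R := TrivSqZeroExt.inr 1
  have hε : ε * ε = 0 := by simp [ε]
  let u : Fin N → TrivSqZeroExt R R := Pi.single a ε
  let v : Fin N → TrivSqZeroExt R R := Pi.single b 1
  let P : Matrix (Fin N) (Fin N) (TrivSqZeroExt R R) :=
    1 + Matrix.replicateCol Unit u * Matrix.replicateRow Unit v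
  have hP : P.det = 1 + if a = b then ε else 0 := by
    simp only [P, Matrix.det_one_add_replicateCol_mul_replicateRow]
    simp [u, v, Pi.single_apply]
  have hPc : ∀ c e, P c e = (if c = e then 1 else 0) + if c = a ∧ e = b then ε else 0 := by
    intro c e
    simp only [P, Matrix.add_apply, Matrix.one_apply, Matrix.mul_apply, Matrix.replicateCol_apply,
      Matrix.replicateRow_apply, u, v, Pi.single_apply]
    by_cases h1 : c = a <;> by_cases h2 : e = b <;> simp [h1, h2]
  have hY : (derivationHom D).mapMatrix Y = P * i.mapMatrix Y * P.transpose := by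
    ext1 c d
    have h1 : ∀ c d, (P * i.mapMatrix Y) c d = i (Y c d) + if c = a then ε * i (Y b d) else 0 := by
      intro c d
      simp only [Matrix.mul_apply, hPc, add_mul, Finset.sum_add_distrib]
      congr 1
      · simp
      · by_cases h : c = a <;> simp [h]
    have h2 : (P * i.mapMatrix Y * P.transpose) c d = (P * i.mapMatrix Y) c d +
        if d = a then ε * (P * i.mapMatrix Y) c b else 0 := by
      rw [Matrix.mul_apply]
      simp only [Matrix.transpose_apply, hPc, mul_add, Finset.sum_add_distrib]
      congr 1
      · simp
      · by_cases h : d = a <;> simp [h, mul_comm]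
    rw [h2, h1, h1]
    have h3 : (derivationHom D).mapMatrix Y c d = i (Y c d) + TrivSqZeroExt.inr (D (Y c d)) := by
      simp [derivationHom, i]
    have h4 : ∀ r : R, ε * i r = TrivSqZeroExt.inr r := by
      intro r; ext <;> simp [ε, i]
    have h5 : ∀ r : R, ε * TrivSqZeroExt.inr r = 0 := by
      intro r; simp [ε]
    rw [h3, hD]
    split_ifs <;> simp only [mul_add, h4, h5, add_zero, zero_add,
      TrivSqZeroExt.inr_add, TrivSqZeroExt.inr_zero, add_assoc]
  have h := congrArg Matrix.det hY
  rw [Matrix.det_mul, Matrix.det_mul, Matrix.det_transpose, ← RingHom.map_det, ← RingHom.map_det,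
    hP] at h
  have h5 := congrArg TrivSqZeroExt.snd h
  simp only [derivationHom, RingHom.coe_mk, MonoidHom.coe_mk, OneHom.coe_mk, i] at h5
  split_ifs with hab
  · rw [if_pos hab] at h5
    simp [ε] at h5
    rw [h5]; ring
  · rw [if_neg hab] at h5
    simpa using h5

end DualNumberHom

section GenericSkew

/-- The generic skew-symmetric matrix. -/
noncomputable def skewX (k : Type*) [CommRing k] (N : ℕ) :
    Matrix (Fin N) (Fin N) (MvPolynomial {p : Fin N × Fin N // p.1 < p.2} k) :=
  fun a b => if h : a < b then X ⟨(a, b), h⟩ else if h : b < a then -X ⟨(b, a), h⟩ else 0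

/-- The partial derivatives with respect to the entries of the generic skew-symmetric matrix,
extended skew-symmetrically. -/
noncomputable def skewD (k : Type*) [CommRing k] (N : ℕ) (a b : Fin N) :
    Derivation k (MvPolynomial {p : Fin N × Fin N // p.1 < p.2} k)
      (MvPolynomial {p : Fin N × Fin N // p.1 < p.2} k) :=
  if h : a < b then pderiv ⟨(a, b), h⟩ else if h : b < a then -pderiv ⟨(b, a), h⟩ else 0

variable (k : Type*) [CommRing k] {N : ℕ}

theorem skewX_of_lt {a b : Fin N} (h : a < b) : skewX k N a b = X ⟨(a, b), h⟩ := dif_pos h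

theorem skewX_swap (a b : Fin N) : skewX k N b a = -skewX k N a b := by
  unfold skewX
  rcases lt_trichotomy a b with h | h | h
  · simp [h, h.not_gt]
  · simp [h]
  · simp [h, h.not_gt]

theorem skewX_self (a : Fin N) : skewX k N a a = 0 := by
  simp [skewX]

theorem skewD_of_lt {a b : Fin N} (h : a < b) : skewD k N a b = pderiv ⟨(a, b), h⟩ := dif_pos h

theorem skewD_swap (a b : Fin N) : skewD k N b a = -skewD k N a b := by
  unfold skewD
  rcases lt_trichotomy a b with h | h | h
  · simp [h, h.not_gt]
  · simp [h]
  · simp [h, h.not_gt]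

theorem skewD_self (a : Fin N) : skewD k N a a = 0 := by
  simp [skewD]

theorem skewD_skewX (a d e f : Fin N) : skewD k N a d (skewX k N e f) =
    (if a = e ∧ d = f then 1 else 0) - if a = f ∧ d = e then 1 else 0 := by
  have key : ∀ a d e f : Fin N, a < d → e < f → skewD k N a d (skewX k N e f) =
      (if a = e ∧ d = f then 1 else 0) - if a = f ∧ d = e then 1 else 0 := by
    intro a d e f had hef
    rw [skewD_of_lt k had, skewX_of_lt k hef, pderiv_X, Pi.single_apply]
    have h1 : ¬(a = f ∧ d = e) := by rintro ⟨rfl, rfl⟩; exact absurd had hef.not_gt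
    rw [if_neg h1, sub_zero]
    refine if_congr ?_ rfl rfl
    simp [eq_comm]
  rcases lt_trichotomy a d with h | h | h
  · rcases lt_trichotomy e f with h' | h' | h'
    · exact key a d e f h h'
    · subst h'; simp [skewX_self]
    · rw [skewX_swap, map_neg, key a d f e h h']; ring
  · subst h; simp [skewD_self, and_comm]
  · rw [skewD_swap, Derivation.neg_apply]
    rcases lt_trichotomy e f with h' | h' | h'
    · simp only [key d a e f h h', and_comm (a := d = e), and_comm (a := d = f)]; ring
    · subst h'; simp [skewX_self]
    · rw [skewX_swap, map_neg]
      simp only [key d a f e h h', and_comm (a := d = e), and_comm (a := d = f)]; ring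

section Polarization

variable {k} {R : Type*} [CommRing R] [Algebra k R]

/-- The polarization operators attached to a matrix and a family of derivations. -/
noncomputable def polarDer (X : Matrix (Fin N) (Fin N) R) (D : Fin N → Fin N → Derivation k R R) (a b : Fin N) :
    Derivation k R R :=
  ∑ d, X b d • D a d

theorem polarDer_apply (X : Matrix (Fin N) (Fin N) R) (D : Fin N → Fin N → Derivation k R R)
    (a b : Fin N) (u : R) : polarDer X D a b u = ∑ d, X b d * D a d u := by
  rw [polarDer, ← Derivation.coeFnAddMonoidHom_apply, map_sum, Finset.sum_apply]
  rfl

theorem polarDer_entry {X : Matrix (Fin N) (Fin N) R} {D : Fin N → Fin N → Derivation k R R}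
    (hX : ∀ a b, X b a = -X a b)
    (hD : ∀ a d e f, D a d (X e f) =
      (if a = e ∧ d = f then 1 else 0) - if a = f ∧ d = e then 1 else 0) (a b c d : Fin N) :
    polarDer X D a b (X c d) = (if c = a then X b d else 0) + if d = a then X c b else 0 := by
  rw [polarDer_apply]
  simp only [hD, mul_sub, Finset.sum_sub_distrib, mul_ite, mul_one, mul_zero, ite_and]
  rw [hX b c]
  by_cases h1 : c = a <;> by_cases h2 : d = a <;> simp [h1, h2, eq_comm (a := a)]

theorem adjugate_polarDer (X : Matrix (Fin N) (Fin N) R) (D : Fin N → Fin N → Derivation k R R)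
    (u : R) (r : R) (h : ∀ a b, polarDer X D a b u = if a = b then r else 0) (a c : Fin N) :
    X.det * D a c u = X.adjugate c a * r := by
  have h1 : ∑ b, X.adjugate c b * polarDer X D a b u = X.adjugate c a * r := by
    simp [h]
  rw [← h1]
  simp only [polarDer_apply, Finset.mul_sum]
  rw [Finset.sum_comm]
  simp only [← mul_assoc, ← Finset.sum_mul]
  have h2 : ∀ d, ∑ b, X.adjugate c b * X b d = if c = d then X.det else 0 := by
    intro d
    rw [← Matrix.mul_apply, Matrix.adjugate_mul, Matrix.smul_apply, Matrix.one_apply, smul_eq_mul]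
    simp
  simp [h2]

end Polarization

/-- Two polynomials in the entries of the generic skew-symmetric matrix, with nonzero determinant,
on which the polarization operators act by the same scalars are proportional. -/
theorem exists_eq_C_mul_of_polarDer {k : Type*} [Field k] [CharZero k]
    (hdet : (skewX k N).det ≠ 0) {u v : MvPolynomial {p : Fin N × Fin N // p.1 < p.2} k} (c : k)
    (hv : v ≠ 0)
    (hu' : ∀ a b, polarDer (skewX k N) (skewD k N) a b u = if a = b then C c * u else 0)
    (hv' : ∀ a b, polarDer (skewX k N) (skewD k N) a b v = if a = b then C c * v else 0) :
    ∃ κ : k, u = C κ * v := by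
  refine MvPolynomial.exists_eq_C_mul hv fun ⟨⟨a, d⟩, h⟩ => ?_
  have h1 := adjugate_polarDer _ _ u _ hu' a d
  have h2 := adjugate_polarDer _ _ v _ hv' a d
  rw [skewD_of_lt k h] at h1 h2
  refine mul_left_cancel₀ hdet ?_
  linear_combination v * h1 - u * h2

end GenericSkew

section PfaffianNonvanishing

variable (n : ℕ)

/-- The strictly upper triangular part of the standard symplectic matrix. -/
def upperJ : Matrix (Fin (2 * n)) (Fin (2 * n)) ℚ :=
  fun a b => if (a : ℕ) % 2 = 0 ∧ (b : ℕ) = a + 1 then 1 else 0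

variable {n}

theorem sign_eq_one_of_upperJ {σ : Equiv.Perm (Fin (2 * n))}
    (h : ∀ i : Fin n, upperJ n (σ ⟨2 * (i : ℕ), two_mul_lt_two_mul i⟩)
        (σ ⟨2 * (i : ℕ) + 1, two_mul_add_one_lt_two_mul i⟩) ≠ 0) :
    Equiv.Perm.sign σ = 1 := by
  have h1 : ∀ i : Fin n, ((σ ⟨2 * (i : ℕ), two_mul_lt_two_mul i⟩ : Fin _) : ℕ) % 2 = 0 ∧
      ((σ ⟨2 * (i : ℕ) + 1, two_mul_add_one_lt_two_mul i⟩ : Fin _) : ℕ) =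
          (σ ⟨2 * (i : ℕ), two_mul_lt_two_mul i⟩ : Fin _) + 1 := by
    intro i
    by_contra hc
    exact h i (if_neg hc)
  let e : Fin 2 × Fin n ≃ Fin (2 * n) :=
    { toFun := fun x => ⟨2 * x.2 + x.1, by omega⟩
      invFun := fun r => (⟨r % 2, by omega⟩, ⟨r / 2, by omega⟩)
      left_inv := fun x => by ext <;> simp <;> omega
      right_inv := fun r => by ext; simp; omega }
  let π : Fin n → Fin n := fun i => ⟨(σ ⟨2 * (i : ℕ), two_mul_lt_two_mul i⟩ : Fin _) / 2, by omega⟩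
  have hπe : ∀ (r : Fin 2) (i : Fin n), σ (e (r, i)) = e (r, π i) := by
    intro r i
    have h2 := h1 i
    apply Fin.ext
    fin_cases r
    · simp only [e, π, Equiv.coe_fn_mk, Fin.zero_eta, Fin.val_zero, add_zero]
      omega
    · simp only [e, π, Equiv.coe_fn_mk, Fin.mk_one, Fin.val_one]
      omega
  have hπ : Function.Injective π := by
    intro i j hij
    have h2 : σ (e (0, i)) = σ (e (0, j)) := by rw [hπe, hπe, hij]
    exact (Prod.ext_iff.1 (e.injective (σ.injective h2))).2
  let τ : Equiv.Perm (Fin n) := Equiv.ofBijective π (Finite.injective_iff_bijective.1 hπ)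
  have hσ : σ = e.permCongr (Equiv.prodCongrRight fun _ => τ) := by
    ext1 x
    obtain ⟨⟨r, i⟩, rfl⟩ := e.surjective x
    rw [hπe]
    simp [Equiv.permCongr_apply, τ]
  rw [hσ, Equiv.Perm.sign_permCongr, Equiv.Perm.sign_prodCongrRight]
  simp [Int.units_sq]

theorem pfaffSum_symplectic_ne_zero : pfaffSum (upperJ n - (upperJ n).transpose) ≠ 0 := by
  classical
  let S : Finset (Fin n) → ℚ := fun T => ∑ σ : Equiv.Perm (Fin (2 * n)), (Equiv.Perm.sign σ : ℤ) •
    ∏ i : Fin n, (if i ∈ T then upperJ n else upperJ n - (upperJ n).transpose)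
      (σ ⟨2 * (i : ℕ), two_mul_lt_two_mul i⟩) (σ ⟨2 * (i : ℕ) + 1, two_mul_add_one_lt_two_mul i⟩)
  have hstep : ∀ (T : Finset (Fin n)) (i₀ : Fin n), i₀ ∉ T → S T = 2 * S (insert i₀ T) := by
    intro T i₀ hi₀
    let f : Equiv.Perm (Fin (2 * n)) → ℚ := fun σ => ∏ i ∈ Finset.univ.erase i₀,
      (if i ∈ T then upperJ n else upperJ n - (upperJ n).transpose)
      (σ ⟨2 * (i : ℕ), two_mul_lt_two_mul i⟩) (σ ⟨2 * (i : ℕ) + 1, two_mul_add_one_lt_two_mul i⟩)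
    let s : Equiv.Perm (Fin (2 * n)) :=
      Equiv.swap ⟨2 * (i₀ : ℕ), two_mul_lt_two_mul i₀⟩
          ⟨2 * (i₀ : ℕ) + 1, two_mul_add_one_lt_two_mul i₀⟩
    have hfs : ∀ σ, f (σ * s) = f σ := by
      intro σ
      refine Finset.prod_congr rfl fun i hi => ?_
      have hi : (i : ℕ) ≠ i₀ := fun h => Finset.ne_of_mem_erase hi (Fin.ext h)
      rw [Equiv.Perm.mul_apply, Equiv.Perm.mul_apply, Equiv.swap_apply_of_ne_of_ne,
        Equiv.swap_apply_of_ne_of_ne] <;>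
      · intro h
        have := congrArg Fin.val h
        simp only at this
        omega
    have h1 : S T = ∑ σ : Equiv.Perm (Fin (2 * n)), (Equiv.Perm.sign σ : ℤ) •
          (upperJ n (σ ⟨2 * (i₀ : ℕ), two_mul_lt_two_mul i₀⟩)
              (σ ⟨2 * (i₀ : ℕ) + 1, two_mul_add_one_lt_two_mul i₀⟩) * f σ) -
        ∑ σ : Equiv.Perm (Fin (2 * n)), (Equiv.Perm.sign σ : ℤ) •
          (upperJ n (σ ⟨2 * (i₀ : ℕ) + 1, two_mul_add_one_lt_two_mul i₀⟩)
              (σ ⟨2 * (i₀ : ℕ), two_mul_lt_two_mul i₀⟩) * f σ) := by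
      rw [← Finset.sum_sub_distrib]
      refine Finset.sum_congr rfl fun σ _ => ?_
      rw [← Finset.mul_prod_erase _ _ (Finset.mem_univ i₀), if_neg hi₀, ← smul_sub, ← sub_mul]
      rfl
    have h2 : S (insert i₀ T) = ∑ σ : Equiv.Perm (Fin (2 * n)), (Equiv.Perm.sign σ : ℤ) •
          (upperJ n (σ ⟨2 * (i₀ : ℕ), two_mul_lt_two_mul i₀⟩)
              (σ ⟨2 * (i₀ : ℕ) + 1, two_mul_add_one_lt_two_mul i₀⟩) * f σ) := by
      refine Finset.sum_congr rfl fun σ _ => ?_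
      rw [← Finset.mul_prod_erase _ _ (Finset.mem_univ i₀), if_pos (Finset.mem_insert_self _ _)]
      congr 2
      refine Finset.prod_congr rfl fun i hi => ?_
      rw [if_congr (Finset.mem_insert.trans (or_iff_right (Finset.ne_of_mem_erase hi))) rfl rfl]
    have h3 : ∑ σ : Equiv.Perm (Fin (2 * n)), (Equiv.Perm.sign σ : ℤ) •
          (upperJ n (σ ⟨2 * (i₀ : ℕ) + 1, two_mul_add_one_lt_two_mul i₀⟩)
              (σ ⟨2 * (i₀ : ℕ), two_mul_lt_two_mul i₀⟩) * f σ) =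
        -S (insert i₀ T) := by
      rw [h2, ← Equiv.sum_comp (Equiv.mulRight s), ← Finset.sum_neg_distrib]
      refine Finset.sum_congr rfl fun σ _ => ?_
      have hne : (⟨2 * (i₀ : ℕ), two_mul_lt_two_mul i₀⟩ : Fin (2 * n)) ≠
          ⟨2 * (i₀ : ℕ) + 1, two_mul_add_one_lt_two_mul i₀⟩ := by
        simp [Fin.ext_iff]
      rw [Equiv.coe_mulRight, hfs, Equiv.Perm.sign_mul, Equiv.Perm.sign_swap hne,
        Equiv.Perm.mul_apply, Equiv.Perm.mul_apply, Equiv.swap_apply_left, Equiv.swap_apply_right]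
      simp
    rw [h1, h3, ← h2]
    ring
  have hall : ∀ T : Finset (Fin n), S ∅ = 2 ^ T.card * S T := by
    intro T
    induction T using Finset.induction_on with
    | empty => simp
    | insert i T hi ih => rw [ih, hstep T i hi, Finset.card_insert_of_notMem hi]; ring
  have h0 : pfaffSum (upperJ n - (upperJ n).transpose) = S ∅ := by
    simp [pfaffSum, S]
  rw [h0, hall Finset.univ]
  refine mul_ne_zero (by positivity) (ne_of_gt ?_)
  have hnn : ∀ a b, 0 ≤ upperJ n a b := fun a b => by unfold upperJ; split_ifs <;> norm_num
  refine Finset.sum_pos' (fun σ _ => ?_) ⟨1, Finset.mem_univ _, ?_⟩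
  · by_cases h : ∀ i : Fin n,
        upperJ n (σ ⟨2 * (i : ℕ), two_mul_lt_two_mul i⟩)
            (σ ⟨2 * (i : ℕ) + 1, two_mul_add_one_lt_two_mul i⟩) ≠ 0
    · rw [sign_eq_one_of_upperJ h]
      simp only [Units.val_one, one_smul]
      exact Finset.prod_nonneg fun i _ => by simpa using hnn _ _
    · push Not at h
      obtain ⟨i, hi⟩ := h
      rw [Finset.prod_eq_zero (Finset.mem_univ i) (by simpa using hi), smul_zero]
  · simp [upperJ]

theorem symplectic_sq : (upperJ n - (upperJ n).transpose) *
    (upperJ n - (upperJ n).transpose) = -1 := by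
  ext a c
  let π : Fin (2 * n) := if h : (a : ℕ) % 2 = 0 then ⟨a + 1, by omega⟩ else ⟨a - 1, by omega⟩
  have hπ : (π : ℕ) = if (a : ℕ) % 2 = 0 then (a : ℕ) + 1 else a - 1 := by
    simp only [π]; split_ifs <;> rfl
  rw [Matrix.mul_apply, Finset.sum_eq_single π]
  · simp only [Matrix.sub_apply, Matrix.transpose_apply, upperJ, Matrix.neg_apply,
      Matrix.one_apply, Fin.ext_iff]
    rw [hπ]
    rcases Nat.mod_two_eq_zero_or_one a with h | h
    · simp only [h, if_true]
      grind
    · simp only [h]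
      grind
  · intro b _ hb
    have hb : (b : ℕ) ≠ π := fun h => hb (Fin.ext h)
    rw [hπ] at hb
    have : (upperJ n - (upperJ n).transpose) a b = 0 := by
      simp only [Matrix.sub_apply, Matrix.transpose_apply, upperJ]
      rw [if_neg, if_neg, sub_zero] <;> split_ifs at hb <;> omega
    rw [this, zero_mul]
  · simp

theorem det_symplectic_ne_zero : (upperJ n - (upperJ n).transpose).det ≠ 0 := by
  intro h
  have h1 := congrArg Matrix.det (symplectic_sq (n := n))
  rw [Matrix.det_mul, h, mul_zero, Matrix.det_neg, Matrix.det_one, mul_one] at h1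
  exact absurd h1.symm (by simp)

end PfaffianNonvanishing

section Cayley

variable {R : Type*} [CommRing R] [Algebra ℚ R] {N n : ℕ}

/-- Evaluation of polynomials at the entries of a matrix. -/
noncomputable def skewEval (Y : Matrix (Fin N) (Fin N) R) :
    MvPolynomial {p : Fin N × Fin N // p.1 < p.2} ℚ →ₐ[ℚ] R :=
  aeval fun p => Y p.1.1 p.1.2

theorem skewEval_skewX {Y : Matrix (Fin N) (Fin N) R} (hY : ∀ a b, Y b a = -Y a b) (a b : Fin N) :
    skewEval Y (skewX ℚ N a b) = Y a b := by
  unfold skewX skewEval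
  rcases lt_trichotomy a b with h | h | h
  · simp [h]
  · subst h
    have h1 : (2 : ℚ) • Y a a = 0 := by rw [two_smul]; nth_rw 1 [hY a a]; simp
    have h2 : Y a a = 0 := by
      have := congrArg ((2⁻¹ : ℚ) • ·) h1
      simpa [smul_smul] using this
    simp [h2]
  · simp [h, h.not_gt, hY b a]

theorem skewEval_map {Y : Matrix (Fin N) (Fin N) R} (hY : ∀ a b, Y b a = -Y a b) :
    (skewEval Y).toRingHom.mapMatrix (skewX ℚ N) = Y := by
  ext a b
  exact skewEval_skewX hY a b

theorem skewEval_det {Y : Matrix (Fin N) (Fin N) R} (hY : ∀ a b, Y b a = -Y a b) :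
    skewEval Y (skewX ℚ N).det = Y.det := by
  rw [← skewEval_map hY, ← RingHom.map_det, skewEval_map hY]
  rfl

theorem skewEval_pfaffSum {Y : Matrix (Fin (2 * n)) (Fin (2 * n)) R} (hY : ∀ a b, Y b a = -Y a b) :
    skewEval Y (pfaffSum (skewX ℚ (2 * n))) = pfaffSum Y := by
  simp only [pfaffSum, map_sum, map_zsmul, map_prod, skewEval_skewX hY]

theorem symplectic_skew (a b : Fin (2 * n)) :
    (upperJ n - (upperJ n).transpose) b a = -(upperJ n - (upperJ n).transpose) a b := by
  simp

theorem det_skewX_ne_zero : (skewX ℚ (2 * n)).det ≠ 0 := by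
  intro h
  have := skewEval_det (symplectic_skew (n := n))
  rw [h, map_zero] at this
  exact det_symplectic_ne_zero this.symm

theorem pfaffSum_skewX_ne_zero : pfaffSum (skewX ℚ (2 * n)) ≠ 0 := by
  intro h
  have := skewEval_pfaffSum (symplectic_skew (n := n))
  rw [h, map_zero] at this
  exact pfaffSum_symplectic_ne_zero this.symm

theorem polarDer_skewX_pfaffSum (a b : Fin (2 * n)) :
    polarDer (skewX ℚ (2 * n)) (skewD ℚ (2 * n)) a b (pfaffSum (skewX ℚ (2 * n))) =
      if a = b then pfaffSum (skewX ℚ (2 * n)) else 0 :=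
  derivation_pfaffSum (polarDer_entry (skewX_swap ℚ) (skewD_skewX ℚ) a b)

variable (n) in
/-- Cayley's theorem, up to the normalisation of the Pfaffian. -/
theorem exists_pfaffSum_sq : ∃ κ : ℚ, κ ≠ 0 ∧ pfaffSum (skewX ℚ (2 * n)) ^ 2 =
    C κ * (skewX ℚ (2 * n)).det := by
  obtain ⟨κ, hκ⟩ := exists_eq_C_mul_of_polarDer (k := ℚ) (N := 2 * n) det_skewX_ne_zero
    (u := pfaffSum (skewX ℚ (2 * n)) ^ 2) 2 det_skewX_ne_zero
    (fun a b => by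
      rw [Derivation.leibniz_pow, polarDer_skewX_pfaffSum]
      split_ifs
      · simp only [Nat.add_one_sub_one, pow_one, smul_eq_mul, nsmul_eq_mul, map_ofNat]
        push_cast
        ring
      · simp)
    (fun a b => by
      rw [derivation_det (polarDer_entry (skewX_swap ℚ) (skewD_skewX ℚ) a b)]
      rfl)
  refine ⟨κ, ?_, hκ⟩
  rintro rfl
  rw [C_0, zero_mul] at hκ
  exact pfaffSum_skewX_ne_zero (pow_eq_zero_iff two_ne_zero |>.1 hκ)

end Cayley

section UnitPolynomial

variable {V : Type*} [AddCommGroup V] [Module ℚ V]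

theorem aeval_apply_mem (T : Module.End ℚ V) {C : Submodule ℚ V} (hC : ∀ v ∈ C, T v ∈ C)
    (g : Polynomial ℚ) {v : V} (hv : v ∈ C) : Polynomial.aeval T g v ∈ C := by
  have hpow : ∀ (m : ℕ), (T ^ m) v ∈ C := by
    intro m
    induction m with
    | zero => simpa
    | succ m ih => rw [pow_succ', Module.End.mul_apply]; exact hC _ ih
  induction g using Polynomial.induction_on' with
  | add p q hp hq => rw [map_add, LinearMap.add_apply]; exact C.add_mem hp hq
  | monomial m a =>
    rw [Polynomial.aeval_monomial, Module.End.mul_apply, Module.algebraMap_end_apply]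
    exact C.smul_mem _ (hpow m)

theorem aeval_apply_comm {W : Type*} [AddCommGroup W] [Module ℚ W] (φ : V →ₗ[ℚ] W)
    (T : Module.End ℚ V) (S : Module.End ℚ W) (h : ∀ v, φ (T v) = S (φ v)) (g : Polynomial ℚ) (v : V) :
    φ (Polynomial.aeval T g v) = Polynomial.aeval S g (φ v) := by
  have hpow : ∀ (m : ℕ), φ ((T ^ m) v) = (S ^ m) (φ v) := by
    intro m
    induction m with
    | zero => simp
    | succ m ih => rw [pow_succ', pow_succ', Module.End.mul_apply, Module.End.mul_apply, h, ih]
  induction g using Polynomial.induction_on' with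
  | add p q hp hq => simp only [map_add, LinearMap.add_apply, hp, hq]
  | monomial m a =>
    simp only [Polynomial.aeval_monomial, Module.End.mul_apply, Module.algebraMap_end_apply,
      map_smul, hpow]

/-- The vectors which a polynomial in `T` with constant coefficient `1` moves into `C`. -/
def unitTransporter (T : Module.End ℚ V) (C : Submodule ℚ V) (hC : ∀ v ∈ C, T v ∈ C) :
    Submodule ℚ V where
  carrier := {v | ∃ g : Polynomial ℚ, g.eval 0 = 1 ∧ Polynomial.aeval T g v ∈ C}
  zero_mem' := ⟨1, by simp, by simp⟩
  add_mem' := by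
    rintro v w ⟨g, hg, hv⟩ ⟨h, hh, hw⟩
    refine ⟨g * h, by simp [hg, hh], ?_⟩
    rw [map_add]
    refine C.add_mem ?_ ?_
    · rw [mul_comm, map_mul, Module.End.mul_apply]; exact aeval_apply_mem T hC h hv
    · rw [map_mul, Module.End.mul_apply]; exact aeval_apply_mem T hC g hw
  smul_mem' := by
    rintro c v ⟨g, hg, hv⟩
    exact ⟨g, hg, by rw [map_smul]; exact C.smul_mem c hv⟩

theorem mem_unitTransporter {T : Module.End ℚ V} {C : Submodule ℚ V} {hC : ∀ v ∈ C, T v ∈ C}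
    {v : V} : v ∈ unitTransporter T C hC ↔
      ∃ g : Polynomial ℚ, g.eval 0 = 1 ∧ Polynomial.aeval T g v ∈ C := Iff.rfl

/-- Finitely many vectors are moved into `C` by a common polynomial. -/
theorem exists_common_polynomial {ι : Type*} (s : Finset ι) (T : Module.End ℚ V)
    (C : ι → Submodule ℚ V) (hC : ∀ i, ∀ v ∈ C i, T v ∈ C i) (v : ι → V)
    (hv : ∀ i ∈ s, v i ∈ unitTransporter T (C i) (hC i)) :
    ∃ g : Polynomial ℚ, g.eval 0 = 1 ∧ ∀ i ∈ s, Polynomial.aeval T g (v i) ∈ C i := by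
  classical
  induction s using Finset.induction_on with
  | empty => exact ⟨1, by simp, by simp⟩
  | insert i s hi ih =>
    obtain ⟨g, hg, hgs⟩ := ih fun j hj => hv j (Finset.mem_insert_of_mem hj)
    obtain ⟨h, hh, hhi⟩ := mem_unitTransporter.1 (hv i (Finset.mem_insert_self i s))
    refine ⟨g * h, by simp [hg, hh], fun j hj => ?_⟩
    rcases Finset.mem_insert.1 hj with rfl | hj
    · rw [map_mul, Module.End.mul_apply]; exact aeval_apply_mem T (hC j) g hhi
    · rw [mul_comm, map_mul, Module.End.mul_apply]; exact aeval_apply_mem T (hC j) h (hgs j hj)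

end UnitPolynomial

section Apolar

variable {σ : Type*} [Fintype σ]

/-- The apolar inner product on polynomials, for which `X i` is adjoint to `pderiv i`. -/
noncomputable def apolar : MvPolynomial σ ℚ →ₗ[ℚ] MvPolynomial σ ℚ →ₗ[ℚ] ℚ :=
  (basisMonomials σ ℚ).constr ℚ fun α => ((∏ i, (α i).factorial : ℕ) : ℚ) • lcoeff ℚ α

theorem apolar_monomial (α : σ →₀ ℕ) (c : ℚ) (v : MvPolynomial σ ℚ) :
    apolar (monomial α c) v = c * ((∏ i, (α i).factorial : ℕ) : ℚ) * coeff α v := by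
  have h1 : apolar (monomial α 1) = ((∏ i, (α i).factorial : ℕ) : ℚ) • lcoeff ℚ α := by
    have := (basisMonomials σ ℚ).constr_basis ℚ
      (fun α => ((∏ i, (α i).factorial : ℕ) : ℚ) • lcoeff ℚ α) α
    rwa [coe_basisMonomials] at this
  have h2 : monomial α c = c • monomial α (1 : ℚ) := by rw [smul_monomial, smul_eq_mul, mul_one]
  rw [h2, map_smul, h1]
  simp [mul_assoc, lcoeff_apply]

theorem apolar_comm (u v : MvPolynomial σ ℚ) : apolar u v = apolar v u := by
  classical
  induction u using MvPolynomial.induction_on' with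
  | add p q hp hq => rw [map_add, LinearMap.add_apply, hp, hq, map_add]
  | monomial α a =>
    induction v using MvPolynomial.induction_on' with
    | add p q hp hq => rw [map_add, map_add, LinearMap.add_apply, hp, hq]
    | monomial β b =>
      rw [apolar_monomial, apolar_monomial, coeff_monomial, coeff_monomial]
      by_cases h : α = β
      · subst h; simp; ring
      · simp [h, Ne.symm h]

theorem apolar_X_mul (i : σ) (u v : MvPolynomial σ ℚ) :
    apolar (X i * u) v = apolar u (pderiv i v) := by
  classical
  induction u using MvPolynomial.induction_on' with
  | add p q hp hq => rw [mul_add, map_add, map_add, LinearMap.add_apply, LinearMap.add_apply, hp, hq]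
  | monomial α a =>
    rw [X, monomial_mul, one_mul, apolar_monomial, apolar_monomial, coeff_pderiv, add_comm]
    have h : ∏ j, ((α + Finsupp.single i 1 : σ →₀ ℕ) j).factorial =
        (α i + 1) * ∏ j, (α j).factorial := by
      rw [← Finset.mul_prod_erase _ _ (Finset.mem_univ i),
        ← Finset.mul_prod_erase _ (fun j => (α j).factorial) (Finset.mem_univ i), ← mul_assoc]
      congr 1
      · simp [Nat.factorial_succ]
      · refine Finset.prod_congr rfl fun j hj => ?_
        simp [(Finset.ne_of_mem_erase hj).symm]
    rw [h]
    push_cast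
    ring

theorem apolar_self (u : MvPolynomial σ ℚ) :
    apolar u u = ∑ α ∈ u.support, ((∏ i, (α i).factorial : ℕ) : ℚ) * coeff α u ^ 2 := by
  conv_lhs => rw [LinearMap.congr_fun (congrArg apolar u.as_sum) u]
  rw [map_sum, LinearMap.sum_apply]
  refine Finset.sum_congr rfl fun α _ => ?_
  rw [apolar_monomial]
  ring

theorem apolar_self_nonneg (u : MvPolynomial σ ℚ) : 0 ≤ apolar u u := by
  rw [apolar_self]
  exact Finset.sum_nonneg fun α _ => by positivity

theorem eq_zero_of_apolar_self {u : MvPolynomial σ ℚ} (h : apolar u u = 0) : u = 0 := by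
  rw [apolar_self, Finset.sum_eq_zero_iff_of_nonneg fun α _ => by positivity] at h
  by_contra hu
  obtain ⟨α, hα⟩ := Finset.nonempty_of_ne_empty (mt support_eq_empty.1 hu)
  have h1 := h α hα
  have h2 : ((∏ i, (α i).factorial : ℕ) : ℚ) ≠ 0 := by
    exact_mod_cast (Finset.prod_pos fun i _ => Nat.factorial_pos _).ne'
  exact mem_support_iff.1 hα (pow_eq_zero_iff two_ne_zero |>.1 ((mul_eq_zero.1 h1).resolve_left h2))

end Apolar

section Casimir

variable {N : ℕ}

/-- The traceless quadratic Casimir operator of a family of derivations indexed like a basis of `gl_N`. -/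
noncomputable def casimir {R : Type*} [CommRing R] [Algebra ℚ R]
    (E : Fin N → Fin N → Derivation ℚ R R) : Module.End ℚ R :=
  ∑ a, ∑ b, (E a b : Module.End ℚ R) * (E b a : Module.End ℚ R) -
    (N : ℚ)⁻¹ • ((∑ a, (E a a : Module.End ℚ R)) * ∑ a, (E a a : Module.End ℚ R))

theorem casimir_apply {R : Type*} [CommRing R] [Algebra ℚ R]
    (E : Fin N → Fin N → Derivation ℚ R R) (u : R) :
    casimir E u = ∑ a, ∑ b, E a b (E b a u) - (N : ℚ)⁻¹ • ∑ a, E a a (∑ b, E b b u) := by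
  simp only [casimir, LinearMap.sub_apply, LinearMap.sum_apply, LinearMap.smul_apply,
    Module.End.mul_apply, Derivation.coeFn_coe]

local notation "V" => polarDer (skewX ℚ N) (skewD ℚ N)

variable (N) in
/-- The polynomial ring in the entries of the generic skew-symmetric matrix. -/
abbrev SkewPoly : Type := MvPolynomial {p : Fin N × Fin N // p.1 < p.2} ℚ

theorem apolar_skewX_mul (a b : Fin N) (u v : SkewPoly N) :
    apolar (skewX ℚ N a b * u) v = apolar u (skewD ℚ N a b v) := by
  unfold skewX skewD
  rcases lt_trichotomy a b with h | h | h
  · simp [h, apolar_X_mul]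
  · simp [h]
  · simp [h, h.not_gt, apolar_X_mul]

theorem apolar_polarDer (a b : Fin N) (u v : SkewPoly N) :
    apolar (V a b u) v = apolar u (V b a v) := by
  rw [polarDer_apply, polarDer_apply, map_sum, map_sum, LinearMap.sum_apply]
  refine Finset.sum_congr rfl fun d _ => ?_
  rw [apolar_skewX_mul, apolar_comm, ← apolar_skewX_mul, apolar_comm]

theorem apolar_casimir (u v : SkewPoly N) :
    apolar (casimir V u) v = apolar u (casimir V v) := by
  have h : ∀ u v : SkewPoly N, apolar (casimir V u) v = ∑ a, ∑ b, apolar (V b a u) (V b a v) -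
      (N : ℚ)⁻¹ * apolar (∑ b, V b b u) (∑ b, V b b v) := by
    intro u v
    rw [casimir_apply]
    simp only [map_sub, map_smul, map_sum, LinearMap.sub_apply, LinearMap.sum_apply,
      LinearMap.smul_apply, apolar_polarDer, smul_eq_mul]
  rw [h, apolar_comm u, h, apolar_comm (∑ b, V b b u)]
  simp only [apolar_comm (V _ _ u)]

theorem polarDer_eq_of_casimir_eq_zero (hN : N ≠ 0) {u : SkewPoly N} (hu : casimir V u = 0) (a b : Fin N) :
    V a b u = if a = b then (N : ℚ)⁻¹ • ∑ c, V c c u else 0 := by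
  set w : SkewPoly N := (N : ℚ)⁻¹ • ∑ c, V c c u with hw
  have hNQ : (N : ℚ) ≠ 0 := by exact_mod_cast hN
  have hsum : ∑ c, V c c u = (N : ℚ) • w := by rw [hw, smul_smul, mul_inv_cancel₀ hNQ, one_smul]
  have key : ∑ a, ∑ b, apolar (V a b u - if a = b then w else 0) (V a b u - if a = b then w else 0) = 0 := by
    have h1 : apolar (casimir V u) u = 0 := by rw [hu]; simp
    rw [casimir_apply, hsum] at h1
    have h2 : ∑ a, V a a ((N : ℚ) • w) = (N : ℚ) • ∑ a, V a a w := by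
      rw [Finset.smul_sum]; exact Finset.sum_congr rfl fun a _ => (V a a).map_smul _ _
    have h3 : apolar (∑ a, V a a w) u = (N : ℚ) * apolar w w := by
      rw [map_sum, LinearMap.sum_apply]
      simp only [apolar_polarDer]
      rw [← map_sum, hsum, map_smul, smul_eq_mul]
    rw [h2, map_sub, LinearMap.sub_apply, smul_smul, inv_mul_cancel₀ hNQ, one_smul, h3] at h1
    simp only [map_sum, LinearMap.sum_apply, apolar_polarDer] at h1
    have h4 : ∀ a b, apolar (V a b u - if a = b then w else 0) (V a b u - if a = b then w else 0) =
        apolar (V a b u) (V a b u) + if a = b then apolar w w - 2 * apolar (V a a u) w else 0 := by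
      intro a b
      split_ifs with h
      · subst h
        rw [map_sub, map_sub, LinearMap.sub_apply, LinearMap.sub_apply, apolar_comm w (V a a u)]
        ring
      · simp
    simp only [h4, Finset.sum_add_distrib, Finset.sum_ite_eq, Finset.mem_univ, if_true,
      Finset.sum_sub_distrib, ← Finset.mul_sum, ← LinearMap.sum_apply, ← map_sum, hsum]
    rw [Finset.sum_comm] at h1
    simp only [apolar_polarDer, Finset.sum_const, Finset.card_univ, Fintype.card_fin, nsmul_eq_mul,
      map_smul, LinearMap.smul_apply, smul_eq_mul]
    linarith
  have hnn : ∀ a b, 0 ≤ apolar (V a b u - if a = b then w else 0) (V a b u - if a = b then w else 0) :=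
    fun a b => apolar_self_nonneg _
  rw [Finset.sum_eq_zero_iff_of_nonneg fun a _ => Finset.sum_nonneg fun b _ => hnn a b] at key
  have h5 := key a (Finset.mem_univ a)
  rw [Finset.sum_eq_zero_iff_of_nonneg fun b _ => hnn a b] at h5
  exact sub_eq_zero.1 (eq_zero_of_apolar_self (h5 b (Finset.mem_univ b)))

theorem sum_polarDer_of_isHomogeneous {u : SkewPoly N} {d : ℕ} (hu : u.IsHomogeneous d) :
    ∑ c, V c c u = (2 * d : ℚ) • u := by
  have h1 : ∑ c, V c c = (2 : ℚ) • ∑ p : {p : Fin N × Fin N // p.1 < p.2}, (X p : SkewPoly N) • pderiv p := by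
    refine MvPolynomial.derivation_ext fun ⟨⟨e, f⟩, h⟩ => ?_
    rw [Derivation.smul_apply, ← Derivation.coeFnAddMonoidHom_apply,
      ← Derivation.coeFnAddMonoidHom_apply, map_sum, map_sum, Finset.sum_apply, Finset.sum_apply]
    simp only [Derivation.coeFnAddMonoidHom_apply, ← skewX_of_lt ℚ h,
      polarDer_entry (skewX_swap ℚ) (skewD_skewX ℚ)]
    simp only [skewX_of_lt ℚ h, Derivation.smul_apply, pderiv_X, Finset.sum_add_distrib,
      Pi.single_apply]
    simp [two_smul, skewX_of_lt ℚ h]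
  have h2 := congrArg (fun D : Derivation ℚ (SkewPoly N) (SkewPoly N) => D u) h1
  rw [Derivation.smul_apply, ← Derivation.coeFnAddMonoidHom_apply,
      ← Derivation.coeFnAddMonoidHom_apply, map_sum, map_sum, Finset.sum_apply, Finset.sum_apply] at h2
  simp only [Derivation.coeFnAddMonoidHom_apply, Derivation.smul_apply, smul_eq_mul,
    hu.sum_X_mul_pderiv] at h2
  rw [h2, ← Nat.cast_smul_eq_nsmul ℚ, smul_smul]

end Casimir

section PfaffianPowers

variable {n : ℕ}

local notation "V" => polarDer (skewX ℚ (2 * n)) (skewD ℚ (2 * n))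

local notation "Φ" => pfaffSum (skewX ℚ (2 * n))

theorem polarDer_pfaffSum_pow (m : ℕ) (a b : Fin (2 * n)) :
    V a b (Φ ^ m) = if a = b then C (m : ℚ) * Φ ^ m else 0 := by
  rw [Derivation.leibniz_pow, polarDer_skewX_pfaffSum]
  split_ifs
  · cases m with
    | zero => simp
    | succ m =>
      simp only [Nat.add_sub_cancel, smul_eq_mul, nsmul_eq_mul, map_natCast]
      ring
  · simp

theorem casimir_eq_zero_of_mem_adjoin (hn : n ≠ 0) {u : SkewPoly (2 * n)}
    (hu : u ∈ Algebra.adjoin ℚ {Φ}) : casimir V u = 0 := by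
  have hpow : ∀ m : ℕ, casimir V (Φ ^ m) = 0 := by
    intro m
    have h1 : ∀ a b, V a b (Φ ^ m) = if a = b then (m : ℚ) • Φ ^ m else 0 := fun a b => by
      rw [polarDer_pfaffSum_pow, smul_eq_C_mul]
    have h2 : ∀ a b, V a b (V b a (Φ ^ m)) = if a = b then (m : ℚ) • (m : ℚ) • Φ ^ m else 0 := by
      intro a b
      rw [h1]
      split_ifs with h h' h'
      · rw [Derivation.map_smul, h1, if_pos h']
      · exact absurd h.symm h'
      · exact absurd h'.symm h
      · simp
    have h3 : ∀ b, V b b (Φ ^ m) = (m : ℚ) • Φ ^ m := fun b => by rw [h1, if_pos rfl]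
    rw [casimir_apply]
    have hn' : (n : ℚ) ≠ 0 := by exact_mod_cast hn
    simp only [h2, h3, Finset.sum_ite_eq, Finset.mem_univ, if_true, Finset.sum_const,
      Finset.card_univ, Fintype.card_fin, ← Nat.cast_smul_eq_nsmul ℚ, Derivation.map_smul, smul_smul]
    rw [← sub_smul]
    push_cast
    convert zero_smul ℚ _
    field_simp
    ring
  rw [Algebra.adjoin_singleton_eq_range_aeval] at hu
  obtain ⟨p, rfl⟩ := hu
  induction p using Polynomial.induction_on' with
  | add p q hp hq =>
    have h : (Polynomial.aeval Φ).toRingHom (p + q) =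
      (Polynomial.aeval Φ).toRingHom p + (Polynomial.aeval Φ).toRingHom q := map_add _ _ _
    rw [h, map_add]
    exact (congrArg₂ _ hp hq).trans (add_zero 0)
  | monomial m a =>
    have h : (Polynomial.aeval Φ).toRingHom (Polynomial.monomial m a) = a • Φ ^ m := by
      simp [Polynomial.aeval_monomial, Algebra.smul_def]
    rw [h, map_smul, hpow, smul_zero]

theorem mem_adjoin_of_casimir_eq_zero (hn : n ≠ 0) {u : SkewPoly (2 * n)} {d : ℕ}
    (hu : u.IsHomogeneous d) (h0 : casimir V u = 0) : u ∈ Algebra.adjoin ℚ {Φ} := by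
  by_cases hu0 : u = 0
  · rw [hu0]; exact zero_mem _
  have hV := polarDer_eq_of_casimir_eq_zero (by omega) h0
  rw [sum_polarDer_of_isHomogeneous hu, smul_smul] at hV
  set c : ℚ := ((2 * n : ℕ) : ℚ)⁻¹ * (2 * d) with hc
  obtain ⟨α, hα⟩ := Finset.nonempty_of_ne_empty (mt support_eq_empty.1 hu0)
  have hcm : ∃ m : ℕ, c = m := by
    let a : Fin (2 * n) := ⟨0, by omega⟩
    have h1 : ∀ e, ∃ m : ℕ, coeff α (skewX ℚ (2 * n) a e * skewD ℚ (2 * n) a e u) = m * coeff α u := by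
      intro e
      unfold skewX skewD
      rcases lt_trichotomy a e with h | h | h
      · exact ⟨_, by simpa only [h, dif_pos] using MvPolynomial.coeff_X_mul_pderiv _ u α⟩
      · exact ⟨0, by simp [h]⟩
      · exact ⟨_, by simpa [h, h.not_gt] using MvPolynomial.coeff_X_mul_pderiv _ u α⟩
    choose w hw using h1
    refine ⟨∑ e, w e, mul_right_cancel₀ (mem_support_iff.1 hα) ?_⟩
    have h2 := congrArg (coeff α) (hV a a)
    rw [if_pos rfl, polarDer_apply, coeff_sum, coeff_smul, smul_eq_mul] at h2
    simp only [hw, ← Finset.sum_mul] at h2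
    rw [← h2]
    push_cast
    rfl
  obtain ⟨m, hm⟩ := hcm
  obtain ⟨κ, hκ⟩ := exists_eq_C_mul_of_polarDer (k := ℚ) det_skewX_ne_zero (u := u) (v := Φ ^ m) c
    (pow_ne_zero _ pfaffSum_skewX_ne_zero)
    (fun a b => by rw [hV, smul_eq_C_mul]) (fun a b => by rw [polarDer_pfaffSum_pow, hm])
  rw [hκ, ← smul_eq_C_mul]
  exact Subalgebra.smul_mem _ (pow_mem (Algebra.self_mem_adjoin_singleton _ _) m) κ

theorem isHomogeneous_polarDer {u : SkewPoly (2 * n)} {d : ℕ} (hu : u.IsHomogeneous (d + 1))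
    (a b : Fin (2 * n)) : (V a b u).IsHomogeneous (d + 1) := by
  rw [polarDer_apply]
  refine IsHomogeneous.sum _ _ _ fun e _ => ?_
  rw [add_comm d 1]
  refine IsHomogeneous.mul ?_ ?_
  · unfold skewX
    split_ifs
    · exact isHomogeneous_X _ _
    · exact (isHomogeneous_X _ _).neg
    · exact isHomogeneous_zero _ _ _
  · unfold skewD
    split_ifs
    · exact hu.pderiv
    · exact hu.pderiv.neg
    · exact isHomogeneous_zero _ _ _

theorem casimir_eq_zero_of_pow {w : SkewPoly (2 * n)} (e : ℕ)
    (h : (casimir V ^ e) w = 0) : casimir V w = 0 := by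
  induction e with
  | zero => rw [pow_zero, Module.End.one_apply] at h; rw [h, map_zero]
  | succ e ih =>
    cases e with
    | zero => simpa using h
    | succ e =>
      refine ih (eq_zero_of_apolar_self ?_)
      have h1 : casimir V (casimir V ((casimir V ^ e) w)) = 0 := by
        rwa [pow_succ', pow_succ', Module.End.mul_apply, Module.End.mul_apply] at h
      rw [pow_succ', Module.End.mul_apply, apolar_casimir, h1, map_zero]

theorem exists_aeval_casimir_mem_adjoin (hn : n ≠ 0) (u : SkewPoly (2 * n)) :
    ∃ g : Polynomial ℚ, g.eval 0 = 1 ∧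
      Polynomial.aeval (casimir V) g u ∈ Algebra.adjoin ℚ {Φ} := by
  let S : Submodule ℚ (SkewPoly (2 * n)) := unitTransporter (casimir V)
    (Subalgebra.toSubmodule (Algebra.adjoin ℚ {Φ})) fun v hv => by
      rw [casimir_eq_zero_of_mem_adjoin hn hv]; exact zero_mem _
  suffices hhom : ∀ d, ∀ v : SkewPoly (2 * n), v.IsHomogeneous d → v ∈ S by
    have h1 : u ∈ S := by
      rw [← sum_homogeneousComponent u]
      exact S.sum_mem fun d _ => hhom d _ (homogeneousComponent_isHomogeneous d u)
    exact h1
  intro d v hv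
  cases d with
  | zero =>
    rw [← totalDegree_zero_iff_isHomogeneous, totalDegree_eq_zero_iff_eq_C] at hv
    rw [hv]
    refine ⟨1, by simp, ?_⟩
    rw [map_one, Module.End.one_apply]
    exact Subalgebra.algebraMap_mem _ _
  | succ d =>
    have hpres : ∀ w : SkewPoly (2 * n), w ∈ homogeneousSubmodule _ ℚ (d + 1) →
        casimir V w ∈ homogeneousSubmodule _ ℚ (d + 1) := by
      intro w hw
      rw [casimir_apply]
      refine Submodule.sub_mem _ (Submodule.sum_mem _ fun a _ => Submodule.sum_mem _ fun b _ =>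
        isHomogeneous_polarDer (isHomogeneous_polarDer hw _ _) _ _)
        (Submodule.smul_mem _ _ (Submodule.sum_mem _ fun a _ =>
        isHomogeneous_polarDer (IsHomogeneous.sum _ _ _ fun b _ => isHomogeneous_polarDer hw _ _) _ _))
    have hfin : Module.Finite ℚ (homogeneousSubmodule {p : Fin (2 * n) × Fin (2 * n) // p.1 < p.2} ℚ (d + 1)) :=
      Module.Finite.iff_fg.2 (homogeneousSubmodule_fg _ _ _)
    let T : Module.End ℚ (homogeneousSubmodule {p : Fin (2 * n) × Fin (2 * n) // p.1 < p.2} ℚ (d + 1)) :=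
      (casimir V).restrict hpres
    obtain ⟨p, hp0, hp⟩ : ∃ p : Polynomial ℚ, p ≠ 0 ∧ Polynomial.aeval T p = 0 :=
      ⟨minpoly ℚ T, minpoly.ne_zero (Algebra.IsIntegral.isIntegral T), minpoly.aeval ℚ T⟩
    obtain ⟨g, hg, hgX⟩ := Polynomial.exists_eq_pow_rootMultiplicity_mul_and_not_dvd p hp0 0
    have hg0 : g.eval 0 ≠ 0 := fun h => hgX (Polynomial.dvd_iff_isRoot.2 h)
    have hT : ∀ (q : Polynomial ℚ) w, (Polynomial.aeval T q w : SkewPoly (2 * n)) =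
        Polynomial.aeval (casimir V) q (w : SkewPoly (2 * n)) := fun q w =>
      aeval_apply_comm (Submodule.subtype _) T (casimir V) (fun _ => rfl) q w
    have h1 : casimir V (Polynomial.aeval (casimir V) g v) = 0 := by
      refine casimir_eq_zero_of_pow (p.rootMultiplicity 0) ?_
      have h2 := hT p ⟨v, hv⟩
      rw [hp, hg, Polynomial.C_0, sub_zero, map_mul, map_pow, Polynomial.aeval_X, Module.End.mul_apply] at h2
      exact h2.symm
    have h3 : Polynomial.aeval (casimir V) g v ∈ homogeneousSubmodule _ ℚ (d + 1) := by
      rw [← hT g ⟨v, hv⟩]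
      exact Subtype.coe_prop _
    refine ⟨(g.eval 0)⁻¹ • g, by simp [hg0], ?_⟩
    rw [map_smul, LinearMap.smul_apply]
    exact Submodule.smul_mem _ _ (mem_adjoin_of_casimir_eq_zero hn h3 h1)

end PfaffianPowers

section Localization

variable {ι L : Type*} [Field L] [Algebra ℚ L]

/-- The subalgebra of `L` generated by `B` and the inverses of the `q i`, `i ∈ t`. -/
def locAlg (B : Subalgebra ℚ L) (q : ι → L) (t : Finset ι) : Subalgebra ℚ L :=
  Algebra.adjoin ℚ ((B : Set L) ∪ (fun i => (q i)⁻¹) '' (t : Set ι))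

/-- The additive group underlying `locAlg`. -/
def locF (B : Subalgebra ℚ L) (q : ι → L) (t : Finset ι) : AddSubgroup L :=
  (Subalgebra.toSubmodule (locAlg B q t)).toAddSubgroup

theorem le_locAlg (B : Subalgebra ℚ L) (q : ι → L) (t : Finset ι) : B ≤ locAlg B q t :=
  fun _ hx => Algebra.subset_adjoin (Or.inl hx)

theorem inv_mem_locAlg (B : Subalgebra ℚ L) (q : ι → L) {t : Finset ι} {i : ι} (hi : i ∈ t) :
    (q i)⁻¹ ∈ locAlg B q t :=
  Algebra.subset_adjoin (Or.inr ⟨i, hi, rfl⟩)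

theorem locAlg_le {B S : Subalgebra ℚ L} {q : ι → L} {t : Finset ι} (hB : B ≤ S)
    (hq : ∀ i ∈ t, (q i)⁻¹ ∈ S) : locAlg B q t ≤ S := by
  refine Algebra.adjoin_le ?_
  rintro _ (hx | ⟨i, hi, rfl⟩)
  exacts [hB hx, hq i hi]

theorem locAlg_mono {B B' : Subalgebra ℚ L} (hB : B ≤ B') (q : ι → L) {t t' : Finset ι} (ht : t ⊆ t') :
    locAlg B q t ≤ locAlg B' q t' :=
  locAlg_le (hB.trans (le_locAlg _ _ _)) fun _ hi => inv_mem_locAlg _ _ (ht hi)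

theorem locF_mono (B : Subalgebra ℚ L) (q : ι → L) : Monotone (locF B q) :=
  fun _ _ ht => locAlg_mono le_rfl q ht

/-- Clearing the denominators of the elements of `R[x⁻¹]`. -/
theorem exists_pow_mul_mem {R : Subalgebra ℚ L} {x y : L} (hx : x ∈ R) (hx0 : x ≠ 0)
    (hy : y ∈ Algebra.adjoin ℚ ((R : Set L) ∪ {x⁻¹})) : ∃ m₀ : ℕ, ∀ m, m₀ ≤ m → x ^ m * y ∈ R := by
  induction hy using Algebra.adjoin_induction with
  | mem y hy =>
    rcases hy with hy | rfl
    · exact ⟨0, fun m _ => mul_mem (pow_mem hx m) hy⟩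
    · refine ⟨1, fun m hm => ?_⟩
      obtain ⟨k, rfl⟩ : ∃ k, m = k + 1 := ⟨m - 1, by omega⟩
      rw [pow_succ, mul_assoc, mul_inv_cancel₀ hx0, mul_one]
      exact pow_mem hx k
  | algebraMap c => exact ⟨0, fun m _ => mul_mem (pow_mem hx m) (R.algebraMap_mem c)⟩
  | add y z _ _ h1 h2 =>
    obtain ⟨m₁, h1⟩ := h1
    obtain ⟨m₂, h2⟩ := h2
    exact ⟨max m₁ m₂, fun m hm => by
      rw [mul_add]
      exact add_mem (h1 m (le_of_max_le_left hm)) (h2 m (le_of_max_le_right hm))⟩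
  | mul y z _ _ h1 h2 =>
    obtain ⟨m₁, h1⟩ := h1
    obtain ⟨m₂, h2⟩ := h2
    refine ⟨m₁ + m₂, fun m hm => ?_⟩
    obtain ⟨k, rfl⟩ : ∃ k, m = m₁ + (m₂ + k) := ⟨m - m₁ - m₂, by omega⟩
    have : x ^ (m₁ + (m₂ + k)) * (y * z) = x ^ m₁ * y * (x ^ (m₂ + k) * z) := by ring
    rw [this]
    exact mul_mem (h1 _ le_rfl) (h2 _ (by omega))

theorem exists_pow_mul_mem_locAlg [DecidableEq ι] {B : Subalgebra ℚ L} {q : ι → L} {c : ι} {t : Finset ι} {y : L}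
    (hq : q c ∈ B) (hq0 : q c ≠ 0) (hy : y ∈ locAlg B q (insert c t)) :
    ∃ m₀ : ℕ, ∀ m, m₀ ≤ m → q c ^ m * y ∈ locAlg B q t := by
  refine exists_pow_mul_mem (le_locAlg _ _ _ hq) hq0 (locAlg_le ?_ ?_ hy)
  · exact fun z hz => Algebra.subset_adjoin (Or.inl (le_locAlg _ _ _ hz))
  · intro i hi
    rcases Finset.mem_insert.1 hi with rfl | hi
    · exact Algebra.subset_adjoin (Or.inr rfl)
    · exact Algebra.subset_adjoin (Or.inl (inv_mem_locAlg _ _ hi))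

theorem derivation_mem_adjoin (D : Derivation ℚ L L) {s : Set L}
    (h : ∀ x ∈ s, D x ∈ Algebra.adjoin ℚ s) {y : L} (hy : y ∈ Algebra.adjoin ℚ s) :
    D y ∈ Algebra.adjoin ℚ s := by
  induction hy using Algebra.adjoin_induction with
  | mem y hy => exact h y hy
  | algebraMap c => rw [D.map_algebraMap]; exact zero_mem _
  | add y z _ _ h1 h2 => rw [map_add]; exact add_mem h1 h2
  | mul y z hy hz h1 h2 =>
    rw [D.leibniz]
    exact add_mem (mul_mem hy h2) (mul_mem hz h1)

theorem derivation_mem_locAlg (D : Derivation ℚ L L) {B : Subalgebra ℚ L} {q : ι → L}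
    (hq : ∀ i, q i ∈ B) (hB : ∀ x ∈ B, D x ∈ B) {t : Finset ι} {y : L} (hy : y ∈ locAlg B q t) :
    D y ∈ locAlg B q t := by
  refine derivation_mem_adjoin D ?_ hy
  rintro _ (hx | ⟨i, hi, rfl⟩)
  · exact le_locAlg B q t (hB _ hx)
  · rw [D.leibniz_inv]
    exact mul_mem (neg_mem (pow_mem (inv_mem_locAlg B q hi) 2)) (le_locAlg B q t (hB _ (hq i)))

/-- Exactness of a Čech complex transports along an embedding of index sets. -/
theorem CechExact.map_embedding {ι ι' L : Type*} [AddCommGroup L] [DecidableEq ι] [DecidableEq ι']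
    [Fintype ι'] [Nonempty ι'] (e : ι' ↪ ι)
    {F : Finset ι → AddSubgroup L} {j : ℕ}
    (h : CechExact (fun t => F (t.map e)) Finset.univ j) : CechExact F (Finset.univ.map e) j := by
  have hD : ∀ (f : List ι → L) (l : List ι'), cechD (fun l' => f (l'.map e)) l = cechD f (l.map e) := by
    intro f l
    induction l generalizing f with
    | nil => rfl
    | cons k l ih => rw [cechD_cons, List.map_cons, cechD_cons, ← ih fun l' => f (e k :: l')]; rfl
  have hset : ∀ l : List ι', (l.map e).toFinset = l.toFinset.map e := by
    intro l; ext x; simp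
  have hlift : ∀ l : List ι, (∀ x ∈ l, x ∈ Finset.univ.map e) → ∃ l' : List ι', l = l'.map e := by
    intro l hl
    refine ⟨l.map (Function.invFun e), ?_⟩
    rw [List.map_map]
    nth_rw 1 [← List.map_id l]
    refine List.map_congr_left fun x hx => ?_
    obtain ⟨y, _, rfl⟩ := Finset.mem_map.1 (hl x hx)
    simp [Function.leftInverse_invFun e.injective y]
  intro f hf hfc
  have hmem : ∀ l : List ι', ∀ x ∈ l.map e, x ∈ Finset.univ.map e := by
    intro l x hx
    obtain ⟨y, _, rfl⟩ := List.mem_map.1 hx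
    simp
  obtain ⟨g, hg, hg'⟩ := h (fun l => f (l.map e))
    (fun l _ hlen => by simp only [← hset]; exact hf _ (hmem l) (by simpa using hlen))
    (fun l _ hlen => by rw [hD]; exact hfc _ (hmem l) (by simpa using hlen))
  have hinv : ∀ l : List ι', (l.map e).map (Function.invFun e) = l := by
    intro l
    rw [List.map_map, Function.invFun_comp e.injective, List.map_id]
  refine ⟨fun l => g (l.map (Function.invFun e)), fun l hl hlen => ?_, fun l hl hlen => ?_⟩
  · obtain ⟨l', rfl⟩ := hlift l hl
    simp only [hinv, hset]
    exact hg l' (by simp) (by simpa using hlen)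
  · obtain ⟨l', rfl⟩ := hlift l hl
    rw [← hD]
    simp only [hinv]
    exact hg' l' (by simp) (by simpa using hlen)

end Localization

section Schur

variable {L : Type*} [Field L]

theorem det_eq_sq_mul_det_schur {κ : Type*} [Fintype κ] [DecidableEq κ]
    (P : Matrix (Fin 2 ⊕ κ) (Fin 2 ⊕ κ) L) (hP : ∀ a b, P b a = -P a b) (hP0 : ∀ a, P a a = 0)
    (hx : P (.inl 0) (.inl 1) ≠ 0) :
    P.det = P (.inl 0) (.inl 1) ^ 2 * Matrix.det (fun r s : κ => P (.inr r) (.inr s) -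
      (P (.inr r) (.inl 1) * P (.inl 0) (.inr s) - P (.inr r) (.inl 0) * P (.inl 1) (.inr s)) /
        P (.inl 0) (.inl 1)) := by
  set x := P (.inl 0) (.inl 1) with hxdef
  have h10 : P (.inl 1) (.inl 0) = -x := hP _ _
  have hdet : P.toBlocks₁₁.det = x ^ 2 := by
    rw [Matrix.det_fin_two]
    simp only [Matrix.toBlocks₁₁, Matrix.of_apply, hP0, h10, ← hxdef]
    ring
  let Q : Matrix (Fin 2) (Fin 2) L := !![0, -x⁻¹; x⁻¹, 0]
  have hQ : P.toBlocks₁₁ * Q = 1 := by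
    ext i j
    fin_cases i <;> fin_cases j <;>
      simp [Matrix.mul_apply, Fin.sum_univ_two, Q, Matrix.toBlocks₁₁, hP0, h10, ← hxdef, hx]
  let _ : Invertible P.toBlocks₁₁ := ⟨Q, mul_eq_one_comm.1 hQ, hQ⟩
  conv_lhs => rw [← P.fromBlocks_toBlocks, Matrix.det_fromBlocks₁₁, hdet]
  congr 2
  ext r s
  have : ⅟P.toBlocks₁₁ = Q := rfl
  rw [this]
  simp only [Matrix.sub_apply, Matrix.mul_apply, Fin.sum_univ_two, Q, Matrix.toBlocks₂₂,
    Matrix.toBlocks₂₁, Matrix.toBlocks₁₂, Matrix.of_apply, Matrix.cons_val', Matrix.cons_val_zero,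
    Matrix.cons_val_one, Matrix.cons_val_fin_one]
  field_simp
  ring

end Schur

section SkewFrame

variable {L : Type*} [Field L] [Algebra ℚ L] {N : ℕ}

/-- A skew-symmetric matrix `X` over a field `L` whose entries behave like independent
variables over the subalgebra `A`, as witnessed by the derivations `D a b` of `L` which play the
role of the partial derivatives. -/
structure SkewFrame (A : Subalgebra ℚ L) (X : Matrix (Fin N) (Fin N) L)
    (D : Fin N → Fin N → Derivation ℚ L L) : Prop where
  swap : ∀ a b, X b a = -X a b
  entry : ∀ a d e f, D a d (X e f) =
    (if a = e ∧ d = f then 1 else 0) - if a = f ∧ d = e then 1 else 0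
  kill : ∀ a d, ∀ x ∈ A, D a d x = 0

/-- The algebra generated by `A` and the entries of a matrix. -/
def entryAlg (A : Subalgebra ℚ L) (X : Matrix (Fin N) (Fin N) L) : Subalgebra ℚ L :=
  Algebra.adjoin ℚ ((A : Set L) ∪ Set.range fun p : Fin N × Fin N => X p.1 p.2)

variable {A : Subalgebra ℚ L} {X : Matrix (Fin N) (Fin N) L}
  {D : Fin N → Fin N → Derivation ℚ L L}

theorem le_entryAlg : A ≤ entryAlg A X := fun _ hx => Algebra.subset_adjoin (Or.inl hx)

theorem entry_mem_entryAlg (a b : Fin N) : X a b ∈ entryAlg A X :=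
  Algebra.subset_adjoin (Or.inr ⟨(a, b), rfl⟩)

theorem entryAlg_le {S : Subalgebra ℚ L} (hA : A ≤ S) (hX : ∀ a b, X a b ∈ S) :
    entryAlg A X ≤ S := by
  refine Algebra.adjoin_le ?_
  rintro _ (hx | ⟨p, rfl⟩)
  exacts [hA hx, hX _ _]

theorem subPfaff_mem_entryAlg {n : ℕ} {X : Matrix (Fin (2 * n + 1)) (Fin (2 * n + 1)) L}
    (c : Fin (2 * n + 1)) : subPfaff X c ∈ entryAlg A X := by
  refine sum_mem fun σ _ => ?_
  split_ifs
  · exact zsmul_mem (Subalgebra.prod_mem _ fun i _ => entry_mem_entryAlg _ _) _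
  · exact zero_mem _

/-- The Schur complement of the `{a, b}` block of a skew-symmetric matrix, with rows and columns
indexed through `e`. -/
def schurCompl {L : Type*} [Field L] {N N' : ℕ} (X : Matrix (Fin N) (Fin N) L) (e : Fin N' ↪ Fin N) (a b : Fin N) :
    Matrix (Fin N') (Fin N') L :=
  Matrix.of fun i j => X (e i) (e j) - (X (e i) b * X a (e j) - X (e i) a * X b (e j)) / X a b

theorem schurCompl_apply {L : Type*} [Field L] {N N' : ℕ} (X : Matrix (Fin N) (Fin N) L) (e : Fin N' ↪ Fin N)
    (a b : Fin N) (i j : Fin N') : schurCompl X e a b i j =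
      X (e i) (e j) - (X (e i) b * X a (e j) - X (e i) a * X b (e j)) / X a b := rfl

theorem schurCompl_swap {L : Type*} [Field L] {N N' : ℕ} {X : Matrix (Fin N) (Fin N) L}
    (hX : ∀ a b, X b a = -X a b) (e : Fin N' ↪ Fin N)
    (a b : Fin N) (i j : Fin N') : schurCompl X e a b j i = -schurCompl X e a b i j := by
  simp only [schurCompl_apply]
  rw [hX (e i) (e j), hX (e i) b, hX a (e j), hX (e i) a, hX b (e j)]
  ring

/-- The algebra generated by `A`, the entries of two rows of a matrix, and the inverse of their
common entry. -/
def twoRowAlg (A : Subalgebra ℚ L) (X : Matrix (Fin N) (Fin N) L) (a b : Fin N) : Subalgebra ℚ L :=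
  Algebra.adjoin ℚ ((A : Set L) ∪ (Set.range fun c => X a c) ∪ (Set.range fun c => X b c) ∪
    {(X a b)⁻¹})

namespace SkewFrame

theorem diag (h : SkewFrame A X D) (a : Fin N) : X a a = 0 := by
  have := algebraRat.charZero L
  exact self_eq_neg.1 (h.swap a a)

theorem entry_ne_zero (h : SkewFrame A X D) {a b : Fin N} (hab : a ≠ b) : X a b ≠ 0 := by
  intro h0
  have := h.entry a b a b
  rw [h0, map_zero] at this
  simp [hab] at this

theorem derivation_mem (h : SkewFrame A X D) (a b : Fin N) {y : L} (hy : y ∈ entryAlg A X) :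
    D a b y ∈ entryAlg A X := by
  refine derivation_mem_adjoin (D a b) ?_ hy
  rintro _ (hx | ⟨p, rfl⟩)
  · rw [h.kill a b _ hx]; exact zero_mem _
  · rw [h.entry]
    refine sub_mem ?_ ?_ <;> split_ifs <;> first | exact one_mem _ | exact zero_mem _

/-- The frame obtained by eliminating two indices by means of an invertible entry. -/
theorem schur (h : SkewFrame A X D) {N' : ℕ} (e : Fin N' ↪ Fin N) {a b : Fin N}
    (ha : ∀ i, e i ≠ a) (hb : ∀ i, e i ≠ b) :
    SkewFrame (twoRowAlg A X a b) (schurCompl X e a b) (fun i j => D (e i) (e j)) := by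
  have h1 : ∀ i j c, D (e i) (e j) (X a c) = 0 := by
    intro i j c; simp [h.entry, ha]
  have h2 : ∀ i j c, D (e i) (e j) (X b c) = 0 := by
    intro i j c; simp [h.entry, hb]
  have hinv : ∀ i j, D (e i) (e j) (X a b)⁻¹ = 0 := by
    intro i j; rw [Derivation.leibniz_inv, h1, smul_zero]
  refine ⟨schurCompl_swap h.swap e a b, fun i j k l => ?_, fun i j y hy => ?_⟩
  · rw [schurCompl_apply, h.swap b (e k), h.swap a (e k), div_eq_mul_inv]
    simp only [map_sub, Derivation.leibniz, map_neg, h1, h2, hinv, h.entry, smul_zero, neg_zero,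
      add_zero, sub_zero, EmbeddingLike.apply_eq_iff_eq]
  · induction hy using Algebra.adjoin_induction with
    | mem y hy =>
      rcases hy with ((hy | ⟨c, rfl⟩) | ⟨c, rfl⟩) | rfl
      exacts [h.kill _ _ _ hy, h1 _ _ _, h2 _ _ _, hinv _ _]
    | algebraMap c => exact Derivation.map_algebraMap _ c
    | add y z _ _ h1 h2 => rw [map_add, h1, h2, add_zero]
    | mul y z _ _ h1 h2 => rw [Derivation.leibniz, h1, h2, smul_zero, smul_zero, add_zero]

theorem entryAlg_schur (h : SkewFrame A X D) {N' : ℕ} (e : Fin N' ↪ Fin N) {a b : Fin N} (hab : a ≠ b)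
    (he : ∀ c, c ≠ a → c ≠ b → ∃ i, e i = c) :
    entryAlg (twoRowAlg A X a b) (schurCompl X e a b) =
      Algebra.adjoin ℚ ((entryAlg A X : Set L) ∪ {(X a b)⁻¹}) := by
  set R := Algebra.adjoin ℚ ((entryAlg A X : Set L) ∪ {(X a b)⁻¹}) with hR
  have hBR : entryAlg A X ≤ R := fun y hy => Algebra.subset_adjoin (Or.inl hy)
  have hent : ∀ c d, X c d ∈ R := fun c d => hBR (entry_mem_entryAlg c d)
  have hxR : (X a b)⁻¹ ∈ R := Algebra.subset_adjoin (Or.inr rfl)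
  refine le_antisymm (entryAlg_le (Algebra.adjoin_le ?_) fun i j => ?_) (Algebra.adjoin_le ?_)
  · rintro _ (((hy | ⟨c, rfl⟩) | ⟨c, rfl⟩) | rfl)
    exacts [hBR (le_entryAlg hy), hent _ _, hent _ _, hxR]
  · rw [schurCompl_apply, div_eq_mul_inv]
    exact sub_mem (hent _ _) (mul_mem (sub_mem (mul_mem (hent _ _) (hent _ _))
      (mul_mem (hent _ _) (hent _ _))) hxR)
  · set A' := twoRowAlg A X a b with hA'def
    set X' := schurCompl X e a b with hX'
    have hA' : A' ≤ entryAlg A' X' := le_entryAlg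
    have hinv : (X a b)⁻¹ ∈ entryAlg A' X' := hA' (Algebra.subset_adjoin (Or.inr rfl))
    have ha : ∀ c, X a c ∈ entryAlg A' X' := fun c =>
      hA' (Algebra.subset_adjoin (Or.inl (Or.inl (Or.inr ⟨c, rfl⟩))))
    have hb : ∀ c, X b c ∈ entryAlg A' X' := fun c =>
      hA' (Algebra.subset_adjoin (Or.inl (Or.inr ⟨c, rfl⟩)))
    have ha' : ∀ c, X c a ∈ entryAlg A' X' := fun c => by
      rw [h.swap a c]; exact neg_mem (ha c)
    have hb' : ∀ c, X c b ∈ entryAlg A' X' := fun c => by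
      rw [h.swap b c]; exact neg_mem (hb c)
    rintro _ (hy | rfl)
    · refine entryAlg_le (fun y hy => ?_) (fun c d => ?_) hy
      · exact hA' (Algebra.subset_adjoin (Or.inl (Or.inl (Or.inl hy))))
      · rcases eq_or_ne c a with rfl | hca
        · exact ha d
        rcases eq_or_ne c b with rfl | hcb
        · exact hb d
        rcases eq_or_ne d a with rfl | hda
        · exact ha' c
        rcases eq_or_ne d b with rfl | hdb
        · exact hb' c
        obtain ⟨i, rfl⟩ := he c hca hcb
        obtain ⟨j, rfl⟩ := he d hda hdb
        have : X (e i) (e j) = X' i j +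
            (X (e i) b * X a (e j) - X (e i) a * X b (e j)) * (X a b)⁻¹ := by
          rw [hX', schurCompl_apply, div_eq_mul_inv]; ring
        rw [this]
        exact add_mem (entry_mem_entryAlg i j) (mul_mem (sub_mem (mul_mem (hb' _) (ha _))
          (mul_mem (ha' _) (hb _))) hinv)
    · exact hinv

end SkewFrame

end SkewFrame

section SchurPfaffian

theorem exists_subPfaff_sq (L : Type*) [Field L] [Algebra ℚ L] (n : ℕ) : ∃ κ : L, κ ≠ 0 ∧ κ ∈ (⊥ : Subalgebra ℚ L) ∧
    ∀ X : Matrix (Fin (2 * n + 1)) (Fin (2 * n + 1)) L, (∀ a b, X b a = -X a b) →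
      ∀ k, subPfaff X k ^ 2 = κ * (X.submatrix k.succAbove k.succAbove).det := by
  obtain ⟨κ, hκ, h⟩ := exists_pfaffSum_sq n
  refine ⟨algebraMap ℚ L κ, by rwa [ne_eq, FaithfulSMul.algebraMap_eq_zero_iff], Subalgebra.algebraMap_mem _ κ, fun X hX k => ?_⟩
  have hY : ∀ a b, X.submatrix k.succAbove k.succAbove b a =
    -X.submatrix k.succAbove k.succAbove a b := fun a b => hX _ _
  have := congrArg (skewEval (X.submatrix k.succAbove k.succAbove)) h
  rw [map_mul, map_pow, skewEval_pfaffSum hY, skewEval_det hY, ← MvPolynomial.algebraMap_eq,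
    AlgHom.commutes] at this
  rw [subPfaff_eq, mul_pow, this, ← pow_mul, mul_comm _ 2, pow_mul]
  simp

theorem det_submatrix_succAbove {L : Type*} [CommRing L] {N : ℕ} (X : Matrix (Fin (N + 1)) (Fin (N + 1)) L) {κ : Type*}
    [Fintype κ] [DecidableEq κ] (hκ : Fintype.card κ = N) (k : Fin (N + 1)) {g : κ → Fin (N + 1)}
    (hginj : Function.Injective g) (hg : ∀ r, g r ≠ k) :
    (X.submatrix k.succAbove k.succAbove).det = (X.submatrix g g).det := by
  choose σ hσ using fun r => Fin.exists_succAbove_eq (hg r)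
  have hinj : Function.Injective σ := fun r s hrs => hginj (by rw [← hσ r, ← hσ s, hrs])
  have hbij : Function.Bijective σ :=
    (Fintype.bijective_iff_injective_and_card σ).2 ⟨hinj, by simp [hκ]⟩
  rw [← Matrix.det_submatrix_equiv_self (Equiv.ofBijective σ hbij), Matrix.submatrix_submatrix]
  have : k.succAbove ∘ (Equiv.ofBijective σ hbij) = g := funext hσ
  rw [this]

theorem exists_subPfaff_schur_sq (L : Type*) [Field L] [Algebra ℚ L] (m : ℕ) : ∃ κ : L, κ ≠ 0 ∧ κ ∈ (⊥ : Subalgebra ℚ L) ∧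
    κ⁻¹ ∈ (⊥ : Subalgebra ℚ L) ∧
    ∀ (X : Matrix (Fin (2 * (m + 1) + 1)) (Fin (2 * (m + 1) + 1)) L), (∀ a b, X b a = -X a b) →
      ∀ (e : Fin (2 * m + 1) ↪ Fin (2 * (m + 1) + 1)) (a b : Fin (2 * (m + 1) + 1)),
      (∀ i, e i ≠ a) → (∀ i, e i ≠ b) → X a b ≠ 0 → ∀ i,
      subPfaff X (e i) ^ 2 = κ * X a b ^ 2 * subPfaff (schurCompl X e a b) i ^ 2 := by
  obtain ⟨κ₁, h₁, ⟨c₁, hc₁⟩, hs₁⟩ := exists_subPfaff_sq L (m + 1)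
  obtain ⟨κ₂, h₂, ⟨c₂, hc₂⟩, hs₂⟩ := exists_subPfaff_sq L m
  refine ⟨κ₁ / κ₂, div_ne_zero h₁ h₂, ⟨c₁ / c₂, ?_⟩, ⟨(c₁ / c₂)⁻¹, ?_⟩, ?_⟩
  · rw [← hc₁, ← hc₂]; simp
  · rw [← hc₁, ← hc₂]; simp
  intro X hX e a b ha hb hx i
  have := algebraRat.charZero L
  have hX0 : ∀ c, X c c = 0 := fun c => self_eq_neg.1 (hX c c)
  have hab : a ≠ b := fun h => hx (by rw [h]; exact hX0 b)
  rw [hs₁ X hX, hs₂ _ (schurCompl_swap hX e a b)]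
  let g : Fin 2 ⊕ Fin (2 * m) → Fin (2 * (m + 1) + 1) :=
    Sum.elim ![a, b] fun r => e (i.succAbove r)
  have hginj : Function.Injective g := by
    refine Function.Injective.sumElim ?_ ?_ ?_
    · intro r s; fin_cases r <;> fin_cases s <;> simp [hab, hab.symm]
    · exact e.injective.comp Fin.succAbove_right_injective
    · intro r s; fin_cases r
      exacts [(ha _).symm, (hb _).symm]
  rw [det_submatrix_succAbove X (by simp; ring) (e i) hginj (by
    rintro (r | r)
    · fin_cases r
      exacts [(ha _).symm, (hb _).symm]
    · exact fun h => Fin.succAbove_ne i r (e.injective h)),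
    det_eq_sq_mul_det_schur (X.submatrix g g) (fun a b => hX _ _) (fun a => hX0 _) hx]
  have hx' : X.submatrix g g (.inl 0) (.inl 1) = X a b := rfl
  have hS : (fun r s : Fin (2 * m) => X.submatrix g g (.inr r) (.inr s) -
      (X.submatrix g g (.inr r) (.inl 1) * X.submatrix g g (.inl 0) (.inr s) -
        X.submatrix g g (.inr r) (.inl 0) * X.submatrix g g (.inl 1) (.inr s)) /
        X.submatrix g g (.inl 0) (.inl 1)) =
      (schurCompl X e a b).submatrix i.succAbove i.succAbove := rfl
  rw [hS, hx']
  field_simp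

end SchurPfaffian

section Torsion

theorem exists_sum_mul_pow_eq_one {R ι : Type*} [CommRing R] {s : Finset ι} {α q : ι → R}
    (h : ∑ c ∈ s, α c * q c = 1) (m : ℕ) : ∃ β : ι → R, ∑ c ∈ s, β c * q c ^ m = 1 := by
  have h1 : Ideal.span (q '' s) = ⊤ := by
    rw [Ideal.eq_top_iff_one, ← h]
    exact sum_mem fun c hc => Ideal.mul_mem_left _ _ (Ideal.subset_span ⟨c, hc, rfl⟩)
  have h2 := Ideal.span_pow_eq_top _ h1 m
  rw [← Set.image_comp, Ideal.eq_top_iff_one] at h2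
  obtain ⟨β, hβ⟩ := (Submodule.mem_span_image_finset_iff_exists_fun R).1 h2
  classical
  refine ⟨fun c => if hc : c ∈ s then β ⟨c, hc⟩ else 0, ?_⟩
  rw [← Finset.sum_coe_sort]
  simpa using hβ

variable {ι L : Type*} [DecidableEq ι] [Field L] [Algebra ℚ L]

theorem CechExact.locF_union_of_sum [Finite ι] {R : Subalgebra ℚ L} {q : ι → L} (hq : ∀ c, q c ∈ R)
    (hq0 : ∀ c, q c ≠ 0) {s w : Finset ι} {α : ι → L} (hα : ∀ c, α c ∈ locAlg R q w)
    (hsum : ∑ c ∈ s, α c * q c = 1) (j : ℕ) : CechExact (fun t => locF R q (w ∪ t)) s j := by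
  refine CechExact.of_partition q (fun c _ t y hy => ?_) (fun m => ?_) j
  · refine exists_pow_mul_mem_locAlg (hq c) (hq0 c) (c := c) (t := w ∪ t) ?_
    rwa [← Finset.union_insert]
  · obtain ⟨β, hβ⟩ := exists_sum_mul_pow_eq_one (R := locAlg R q w) (s := s)
      (α := fun c => ⟨α c, hα c⟩) (q := fun c => ⟨q c, le_locAlg _ _ _ (hq c)⟩)
      (Subtype.ext (by simpa using hsum)) m
    refine ⟨fun c => β c, by simpa using congrArg Subtype.val hβ, fun c _ t y hy => ?_⟩
    exact (locAlg R q (w ∪ t)).mul_mem (locAlg_mono le_rfl q Finset.subset_union_left (β c).2) hy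

/-- Adding two vertices to the index set of a Čech complex. -/
theorem CechExact.insert_insert {ι L : Type*} [DecidableEq ι] [AddCommGroup L]
    {F : Finset ι → AddSubgroup L} (hF : Monotone F) {s : Finset ι}
    {a b : ι} (hab : a ≠ b) (ha : a ∉ s) (hb : b ∉ s) {j : ℕ}
    (h : CechExact F s j)
    (hw : ∀ w : Finset ι, (a ∈ w ∨ b ∈ w) → ∀ i, CechExact (fun t => F (w ∪ t)) s i) :
    CechExact F (Insert.insert a (Insert.insert b s)) j := by
  have ha' : a ∉ Insert.insert b s := by simp [hab, ha]
  have hins : ∀ k i, CechExact (fun t => F ({k} ∪ t)) s i → CechExact (fun t => F (Insert.insert k t)) s i := by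
    intro k i h; simpa only [Finset.insert_eq] using h
  have hmono : Monotone fun t => F (Insert.insert a t) :=
    fun _ _ ht => hF (Finset.insert_subset_insert _ ht)
  cases j with
  | zero => exact CechExact.zero (Finset.insert_nonempty _ _)
  | succ j =>
    refine CechExact.insert hF ha' (CechExact.insert hF hb h (hins b j (hw _ (by simp) _))) ?_
    cases j with
    | zero => exact CechExact.zero (Finset.insert_nonempty _ _)
    | succ j =>
      refine CechExact.insert hmono hb (hins a _ (hw _ (by simp) _)) ?_
      have := hw {a, b} (by simp) j
      simpa only [Finset.insert_union, Finset.insert_eq, Finset.union_assoc] using this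

theorem exists_pow_mul_mem_cechB [Finite ι] {B R : Subalgebra ℚ L} {q : ι → L} {x : L} (hx : x ∈ B) (hx0 : x ≠ 0)
    (hR : R = Algebra.adjoin ℚ ((B : Set L) ∪ {x⁻¹})) {j : ℕ} {f : List ι → L}
    (hf : f ∈ cechB (locF R q) j) : ∃ m : ℕ, x ^ m • f ∈ cechB (locF B q) j := by
  obtain ⟨g, hg, hgf⟩ := hf
  have hfin : {l : List ι | l.length + 1 = j}.Finite := by
    refine (List.finite_length_eq ι (j - 1)).subset fun l hl => ?_
    have : l.length + 1 = j := hl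
    simp only [Set.mem_ofPred_eq]; omega
  have key : ∀ l : List ι, ∃ m₀, l.length + 1 = j → ∀ m, m₀ ≤ m → x ^ m * g l ∈ locF B q l.toFinset := by
    intro l
    by_cases hl : l.length + 1 = j
    · obtain ⟨m₀, hm₀⟩ := exists_pow_mul_mem (le_locAlg B q l.toFinset hx) hx0 (y := g l) (by
        refine locAlg_le ?_ ?_ (hg l hl)
        · rw [hR]
          refine Algebra.adjoin_mono (Set.union_subset_union_left _ (le_locAlg B q _))
        · exact fun i hi => Algebra.subset_adjoin (Or.inl (inv_mem_locAlg B q hi)))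
      exact ⟨m₀, fun _ => hm₀⟩
    · exact ⟨0, fun h => absurd h hl⟩
  choose m hm using key
  refine ⟨hfin.toFinset.sup m, fun l => x ^ hfin.toFinset.sup m * g l, fun l hl => hm l hl _ ?_,
    fun l hl => ?_⟩
  · exact Finset.le_sup (f := m) (by simpa using hl)
  · rw [cechD_mul, hgf l hl]; rfl

end Torsion

section SchurExact

variable {L : Type*} [Field L] [Algebra ℚ L]

/-- Inverting an element whose square is a unit multiple of the square of another. -/
theorem inv_mem_of_sq_eq {S : Subalgebra ℚ L} {p q u : L} (h : p ^ 2 = u * q ^ 2) (hp : p ≠ 0)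
    (hpS : p ∈ S) (hu : u⁻¹ ∈ S) (hq : q⁻¹ ∈ S) : p⁻¹ ∈ S := by
  have : p⁻¹ = p * (u⁻¹ * q⁻¹ ^ 2) := by
    rw [inv_pow, ← mul_inv, ← h]; field_simp
  rw [this]
  exact mul_mem hpS (mul_mem hu (pow_mem hq 2))

theorem locAlg_schurCompl {m : ℕ} {R : Subalgebra ℚ L}
    {X : Matrix (Fin (2 * (m + 1) + 1)) (Fin (2 * (m + 1) + 1)) L} (hX : ∀ a b, X b a = -X a b)
    (e : Fin (2 * m + 1) ↪ Fin (2 * (m + 1) + 1)) {a b : Fin (2 * (m + 1) + 1)}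
    (ha : ∀ i, e i ≠ a) (hb : ∀ i, e i ≠ b) (hx : X a b ≠ 0) (hx1 : X a b ∈ R) (hx2 : (X a b)⁻¹ ∈ R)
    (hq0 : ∀ c, subPfaff X c ≠ 0) (hq : ∀ c, subPfaff X c ∈ R)
    (hq' : ∀ c, subPfaff (schurCompl X e a b) c ∈ R) (t : Finset (Fin (2 * m + 1))) :
    (∀ c, subPfaff (schurCompl X e a b) c ≠ 0) ∧
    locAlg R (subPfaff X) (t.map e) = locAlg R (subPfaff (schurCompl X e a b)) t := by
  obtain ⟨κ, hκ, hκ1, hκ2, h⟩ := exists_subPfaff_schur_sq L m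
  have h1 := h X hX e a b ha hb hx
  have hq'0 : ∀ c, subPfaff (schurCompl X e a b) c ≠ 0 := by
    intro c h0
    have := h1 c
    rw [h0] at this
    simp [hq0] at this
  have hbot : ∀ S : Subalgebra ℚ L, ∀ y ∈ (⊥ : Subalgebra ℚ L), y ∈ S := fun S y hy =>
    (bot_le : ⊥ ≤ S) hy
  refine ⟨hq'0, le_antisymm ?_ ?_⟩
  · refine locAlg_le (le_locAlg _ _ _) fun c hc => ?_
    obtain ⟨i, hi, rfl⟩ := Finset.mem_map.1 hc
    refine inv_mem_of_sq_eq (h1 i) (hq0 _) (le_locAlg _ _ _ (hq _)) ?_ (inv_mem_locAlg _ _ hi)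
    rw [mul_inv, ← inv_pow]
    exact mul_mem (hbot _ _ hκ2) (pow_mem (le_locAlg _ _ _ hx2) 2)
  · refine locAlg_le (le_locAlg _ _ _) fun i hi => ?_
    refine inv_mem_of_sq_eq (p := subPfaff (schurCompl X e a b) i) (q := subPfaff X (e i))
      (u := κ⁻¹ * (X a b)⁻¹ ^ 2) ?_ (hq'0 _) (le_locAlg _ _ _ (hq' _)) ?_
      (inv_mem_locAlg _ _ (Finset.mem_map_of_mem e hi))
    · rw [h1 i]; field_simp
    · rw [mul_inv, inv_inv, ← inv_pow, inv_inv]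
      exact mul_mem (hbot _ _ hκ1) (pow_mem (le_locAlg _ _ _ hx1) 2)

/-- The exactness statement for the Čech complex on the sub-maximal Pfaffians, for all frames of
size `2n + 1` in `L`. -/
def FrameExact (L : Type*) [Field L] [Algebra ℚ L] (n j : ℕ) : Prop :=
  ∀ (A : Subalgebra ℚ L) (X : Matrix (Fin (2 * n + 1)) (Fin (2 * n + 1)) L)
    (D : Fin (2 * n + 1) → Fin (2 * n + 1) → Derivation ℚ L L), SkewFrame A X D →
    (∀ c, subPfaff X c ≠ 0) → CechExact (locF (entryAlg A X) (subPfaff X)) Finset.univ j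

theorem frameExact_zero (j : ℕ) : FrameExact L 0 j := by
  intro A X D h hq0
  have h1 : ∀ c, subPfaff X c = 1 := by
    intro c
    obtain rfl : c = 0 := (Fin.subsingleton_one).elim c 0
    rw [subPfaff_eq]
    simp [pfaffSum]
  have := CechExact.locF_union_of_sum (R := entryAlg A X) (q := subPfaff X) (s := Finset.univ)
    (w := ∅) (α := 1) (fun c => subPfaff_mem_entryAlg c) hq0 (fun c => one_mem _)
    (by simp [h1]) j
  simpa only [Finset.empty_union] using this

theorem SkewFrame.exists_pow_mul_mem_cechB {m j : ℕ} (ih : FrameExact L m j) {A : Subalgebra ℚ L}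
    {X : Matrix (Fin (2 * (m + 1) + 1)) (Fin (2 * (m + 1) + 1)) L}
    {D : Fin (2 * (m + 1) + 1) → Fin (2 * (m + 1) + 1) → Derivation ℚ L L}
    (h : SkewFrame A X D) (hq0 : ∀ c, subPfaff X c ≠ 0) {a b : Fin (2 * (m + 1) + 1)} (hab : a ≠ b)
    {f : List (Fin (2 * (m + 1) + 1)) → L} (hf : f ∈ cechZ (locF (entryAlg A X) (subPfaff X)) j) :
    ∃ M : ℕ, X a b ^ M • f ∈ cechB (locF (entryAlg A X) (subPfaff X)) j := by
  set q := subPfaff X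
  have hx := h.entry_ne_zero hab
  set R := Algebra.adjoin ℚ ((entryAlg A X : Set L) ∪ {(X a b)⁻¹}) with hR
  have hBR : entryAlg A X ≤ R := fun y hy => Algebra.subset_adjoin (Or.inl hy)
  have hx2 : (X a b)⁻¹ ∈ R := Algebra.subset_adjoin (Or.inr rfl)
  refine _root_.exists_pow_mul_mem_cechB (entry_mem_entryAlg a b) hx hR ?_
  refine cechExact_univ_iff.1 ?_ (show f ∈ cechZ (locF R q) j from
    ⟨fun l hl => locAlg_mono hBR q le_rfl (hf.1 l hl), hf.2⟩)
  have hcard : (({a, b} : Finset (Fin (2 * (m + 1) + 1)))ᶜ).card = 2 * m + 1 := by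
    rw [Finset.card_compl, Finset.card_pair hab, Fintype.card_fin]; omega
  let e : Fin (2 * m + 1) ↪ Fin (2 * (m + 1) + 1) := (Finset.orderEmbOfFin _ hcard).toEmbedding
  have hmem : ∀ i, e i ∈ ({a, b} : Finset _)ᶜ := Finset.orderEmbOfFin_mem _ hcard
  have ha : ∀ i, e i ≠ a := fun i h => by simpa [h] using hmem i
  have hb : ∀ i, e i ≠ b := fun i h => by simpa [h] using hmem i
  have hmap : Finset.univ.map e = {a, b}ᶜ := Finset.map_orderEmbOfFin_univ _ hcard
  have he : ∀ c, c ≠ a → c ≠ b → ∃ i, e i = c := by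
    intro c hca hcb
    have : c ∈ Finset.univ.map e := by rw [hmap]; simp [hca, hcb]
    simpa using this
  have hR' : entryAlg (twoRowAlg A X a b) (schurCompl X e a b) = R := h.entryAlg_schur e hab he
  have hqR : ∀ c, q c ∈ R := fun c => hBR (subPfaff_mem_entryAlg c)
  have hloc := locAlg_schurCompl h.swap e ha hb hx (hBR (entry_mem_entryAlg a b)) hx2 hq0 hqR
    (fun c => hR' ▸ subPfaff_mem_entryAlg c)
  have h1 : CechExact (locF R q) (Finset.univ.map e) j := by
    refine CechExact.map_embedding e ?_
    have := ih _ _ _ (h.schur e ha hb) (hloc ∅).1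
    rw [hR'] at this
    refine (congrArg (CechExact · Finset.univ j) (funext fun t => ?_)).mpr this
    unfold locF
    rw [(hloc t).2]
  have hrel : ∀ u v, X u v ≠ 0 → ({u, v} : Finset (Fin (2 * (m + 1) + 1))) = {a, b} →
      ∑ c ∈ Finset.univ.map e, -X u c * (X u v)⁻¹ * (q v)⁻¹ * q c = 1 := by
    intro u v huv heq
    have hne : u ≠ v := fun h' => huv (h' ▸ h.diag _)
    have h0 := sum_mul_subPfaff h.swap h.diag u
    rw [hmap, ← heq]
    rw [← Finset.sum_add_sum_compl {u, v}, Finset.sum_pair hne, h.diag, zero_mul, zero_add] at h0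
    have h2 : ∀ c, -X u c * (X u v)⁻¹ * (q v)⁻¹ * q c = -((X u v)⁻¹ * (q v)⁻¹) * (X u c * q c) :=
      fun c => by ring
    rw [Finset.sum_congr rfl fun c _ => h2 c, ← Finset.mul_sum,
      show ∑ c ∈ {u, v}ᶜ, X u c * q c = -(X u v * q v) by linear_combination h0]
    have := hq0 v
    field_simp
  have huniv : (Finset.univ : Finset (Fin (2 * (m + 1) + 1))) =
      insert a (insert b (Finset.univ.map e)) := by
    rw [hmap]; ext c; by_cases hca : c = a <;> by_cases hcb : c = b <;> simp [hca, hcb]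
  rw [huniv]
  refine CechExact.insert_insert (locF_mono R q) hab (by simp [ha]) (by simp [hb])
    h1 fun w hw i => ?_
  rcases hw with hw | hw
  · refine CechExact.locF_union_of_sum hqR hq0 (fun c => ?_) (hrel b a ?_ (Finset.pair_comm _ _)) i
    · rw [h.swap a b, inv_neg]
      exact mul_mem (mul_mem (neg_mem (le_locAlg _ _ _ (hBR (entry_mem_entryAlg _ _))))
        (neg_mem (le_locAlg _ _ _ hx2))) (inv_mem_locAlg _ _ hw)
    · rw [h.swap a b]; simpa using hx
  · refine CechExact.locF_union_of_sum hqR hq0 (fun c => ?_) (hrel a b hx rfl) i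
    exact mul_mem (mul_mem (neg_mem (le_locAlg _ _ _ (hBR (entry_mem_entryAlg _ _))))
        (le_locAlg _ _ _ hx2)) (inv_mem_locAlg _ _ hw)

end SchurExact

section EigenMod

variable {ι L : Type*} [DecidableEq ι] [AddCommGroup L] [Module ℚ L]

/-- The endomorphism `P` of `L` preserves the coefficient groups `F t`, and acts on the class of the
cochain `f` modulo coboundaries as multiplication by `c`. -/
def EigenMod (F : Finset ι → Submodule ℚ L) (j : ℕ) (f : List ι → L) (P : Module.End ℚ L)
    (c : ℚ) : Prop :=
  (∀ t, ∀ y ∈ F t, P y ∈ F t) ∧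
    (fun l => P (f l) - c • f l) ∈ cechB (fun t => (F t).toAddSubgroup) j

variable {F : Finset ι → Submodule ℚ L} {j : ℕ} {f : List ι → L} {P Q : Module.End ℚ L} {c d : ℚ}

theorem cechB_map {P : Module.End ℚ L} (hP : ∀ t, ∀ y ∈ F t, P y ∈ F t)
    {f : List ι → L} (hf : f ∈ cechB (fun t => (F t).toAddSubgroup) j) :
    (fun l => P (f l)) ∈ cechB (fun t => (F t).toAddSubgroup) j :=
  map_mem_cechB (φ := P.toAddMonoidHom) hP hf

namespace EigenMod

theorem scalar (c : ℚ) : EigenMod F j f (algebraMap ℚ _ c) c := by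
  refine ⟨fun t y hy => (F t).smul_mem c hy, ?_⟩
  simp only [Module.algebraMap_end_apply, sub_self]
  exact zero_mem _

theorem one : EigenMod F j f 1 1 := by
  have := scalar (F := F) (j := j) (f := f) 1
  rwa [map_one] at this

theorem add (h₁ : EigenMod F j f P c) (h₂ : EigenMod F j f Q d) : EigenMod F j f (P + Q) (c + d) := by
  refine ⟨fun t y hy => add_mem (h₁.1 t y hy) (h₂.1 t y hy), ?_⟩
  convert add_mem h₁.2 h₂.2 using 1
  funext l
  simp only [LinearMap.add_apply, Pi.add_apply, add_smul]
  abel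

theorem mul (h₁ : EigenMod F j f P c) (h₂ : EigenMod F j f Q d) : EigenMod F j f (P * Q) (c * d) := by
  refine ⟨fun t y hy => h₁.1 t _ (h₂.1 t y hy), ?_⟩
  convert add_mem (cechB_map h₁.1 h₂.2) (cechB_map (fun t y => (F t).smul_mem d) h₁.2
    (P := algebraMap ℚ _ d)) using 1
  funext l
  simp only [Module.End.mul_apply, Pi.add_apply, map_sub, map_smul, Module.algebraMap_end_apply,
    smul_smul, mul_comm c d]
  abel

theorem smul (r : ℚ) (h : EigenMod F j f P c) : EigenMod F j f (r • P) (r * c) := by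
  have := (scalar r).mul h
  rwa [← Algebra.smul_def] at this

theorem sub (h₁ : EigenMod F j f P c) (h₂ : EigenMod F j f Q d) : EigenMod F j f (P - Q) (c - d) := by
  have := h₁.add (h₂.smul (-1))
  rwa [neg_one_smul, neg_one_mul, ← sub_eq_add_neg, ← sub_eq_add_neg] at this

theorem sum {κ : Type*} (s : Finset κ) {P : κ → Module.End ℚ L} {c : κ → ℚ}
    (h : ∀ i ∈ s, EigenMod F j f (P i) (c i)) : EigenMod F j f (∑ i ∈ s, P i) (∑ i ∈ s, c i) := by
  classical
  induction s using Finset.induction_on with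
  | empty => simpa using scalar (F := F) (j := j) (f := f) 0
  | insert i s hi ih =>
    rw [Finset.sum_insert hi, Finset.sum_insert hi]
    exact (h i (by simp)).add (ih fun k hk => h k (by simp [hk]))

theorem list_prod {κ : Type*} (s : List κ) {P : κ → Module.End ℚ L} {c : κ → ℚ}
    (h : ∀ i ∈ s, EigenMod F j f (P i) (c i)) :
    EigenMod F j f (s.map P).prod (s.map c).prod := by
  induction s with
  | nil => exact one
  | cons i s ih =>
    rw [List.map_cons, List.map_cons, List.prod_cons, List.prod_cons]
    exact (h i (by simp)).mul (ih fun k hk => h k (by simp [hk]))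

theorem aeval (h : EigenMod F j f P c) (g : Polynomial ℚ) :
    EigenMod F j f (Polynomial.aeval P g) (g.eval c) := by
  induction g using Polynomial.induction_on with
  | C a => simpa using scalar a
  | add p q hp hq => simpa using hp.add hq
  | monomial n a ih =>
    have := ih.mul h
    rw [pow_succ, ← mul_assoc, map_mul, Polynomial.aeval_X, Polynomial.eval_mul_X]
    exact this

theorem mem_cechB (h : EigenMod F j f P c) (hc : c ≠ 0) (h0 : ∀ l, l.length = j → P (f l) = 0) :
    f ∈ cechB (fun t => (F t).toAddSubgroup) j := by
  have := cechB_map (P := algebraMap ℚ (Module.End ℚ L) (-c⁻¹))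
    (fun t y => (F t).smul_mem (-c⁻¹)) h.2
  obtain ⟨g, hg, hgf⟩ := this
  refine ⟨g, hg, fun l hl => ?_⟩
  rw [hgf l hl]
  simp [h0 l hl, smul_smul, hc]

end EigenMod

end EigenMod

section ListProd

variable {L κ : Type*} [AddCommGroup L] [Module ℚ L]

theorem list_prod_apply_eigen (s : List κ) {P : κ → Module.End ℚ L} {c : κ → ℚ} {y : L}
    (h : ∀ i ∈ s, P i y = c i • y) : (s.map P).prod y = (s.map c).prod • y := by
  induction s with
  | nil => simp
  | cons i s ih =>
    rw [List.map_cons, List.map_cons, List.prod_cons, List.prod_cons, Module.End.mul_apply,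
      ih fun k hk => h k (by simp [hk]), map_smul, h i (by simp), smul_smul, mul_comm]

end ListProd

section Weights

variable {L ι : Type*} [Field L] [Algebra ℚ L] [Fintype ι] [DecidableEq ι]

/-- The algebra generated by `A` and the elements `q c`. -/
def baseAlg (A : Subalgebra ℚ L) (q : ι → L) : Subalgebra ℚ L :=
  Algebra.adjoin ℚ ((A : Set L) ∪ Set.range q)

/-- The product of the operators `H a - i` for `i < M`. -/
noncomputable def weightProd (H : ι → Derivation ℚ L L) (M : ℕ) : Module.End ℚ L :=
  ((Finset.univ ×ˢ Finset.range M).toList.map fun p : ι × ℕ =>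
    (H p.1 : Module.End ℚ L) - algebraMap ℚ _ (p.2 : ℚ)).prod

theorem weightProd_apply_eq_zero {A : Subalgebra ℚ L} {q : ι → L} {H : ι → Derivation ℚ L L}
    (hA : ∀ a, ∀ x ∈ A, H a x = 0) (hq : ∀ a c, H a (q c) = if c = a then q c else 0)
    (hq0 : ∀ c, q c ≠ 0)
    {t : Finset ι} (ht : t ≠ Finset.univ) {y : L} (hy : y ∈ locAlg (baseAlg A q) q t) :
    ∃ M₀ : ℕ, ∀ M, M₀ ≤ M → weightProd H M y = 0 := by
  set s : Set L := ((A : Set L) ∪ Set.range q) ∪ (fun i => (q i)⁻¹) '' t with hs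
  have hys : y ∈ Submodule.span ℚ (Submonoid.closure s : Set L) := by
    rw [← Algebra.adjoin_eq_span]
    refine (locAlg_le (Algebra.adjoin_mono Set.subset_union_left) fun i hi => ?_ :
      locAlg (baseAlg A q) q t ≤ _) hy
    exact Algebra.subset_adjoin (Or.inr ⟨i, hi, rfl⟩)
  have heig : ∀ z ∈ Submonoid.closure s, ∃ e : ι → ℤ, (∀ a, H a z = (e a : ℚ) • z) ∧
      ∀ a, a ∉ t → 0 ≤ e a := by
    intro z hz
    induction hz using Submonoid.closure_induction with
    | mem z hz =>
      rcases hz with (hz | ⟨c, rfl⟩) | ⟨c, hc, rfl⟩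
      · exact ⟨0, fun a => by simp [hA a z hz], fun _ _ => le_rfl⟩
      · refine ⟨fun a => if c = a then 1 else 0, fun a => ?_, fun a _ => ?_⟩
        · by_cases hca : c = a <;> simp [hq, hca]
        · show (0 : ℤ) ≤ if c = a then 1 else 0
          split_ifs <;> simp
      · refine ⟨fun a => if c = a then -1 else 0, fun a => ?_, fun a ha => ?_⟩
        · have := hq0 c
          simp only [Derivation.leibniz_inv, hq]
          by_cases hca : c = a
          · simp only [if_pos hca, smul_eq_mul, Int.cast_neg, Int.cast_one, neg_smul, one_smul]
            field_simp
          · simp [if_neg hca]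
        · have : c ≠ a := fun h => ha (h ▸ hc)
          simp [this]
    | one => exact ⟨0, fun a => by simp, fun _ _ => le_rfl⟩
    | mul z w _ _ h1 h2 =>
      obtain ⟨e₁, h1, h1'⟩ := h1
      obtain ⟨e₂, h2, h2'⟩ := h2
      refine ⟨e₁ + e₂, fun a => ?_, fun a ha => add_nonneg (h1' a ha) (h2' a ha)⟩
      rw [Derivation.leibniz, h1, h2, Pi.add_apply, Int.cast_add, add_smul]
      simp only [smul_eq_mul]
      simp only [Algebra.smul_def]
      ring
  obtain ⟨a, ha⟩ : ∃ a, a ∉ t := by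
    by_contra! h
    exact ht (Finset.eq_univ_iff_forall.2 h)
  clear hy
  induction hys using Submodule.span_induction with
  | mem z hz =>
    obtain ⟨e, he, he0⟩ := heig z hz
    refine ⟨(e a).toNat + 1, fun M hM => ?_⟩
    rw [weightProd, list_prod_apply_eigen (c := fun p : ι × ℕ => (e p.1 : ℚ) - p.2)]
    · rw [List.prod_eq_zero, zero_smul]
      refine List.mem_map.2 ⟨(a, (e a).toNat), by simpa using hM, ?_⟩
      have : ((e a).toNat : ℤ) = e a := Int.toNat_of_nonneg (he0 a ha)
      rw [sub_eq_zero]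
      exact_mod_cast this.symm
    · intro p _
      rw [LinearMap.sub_apply, Module.algebraMap_end_apply, sub_smul, ← he]
      rfl
  | zero => exact ⟨0, fun _ _ => map_zero _⟩
  | add z w _ _ h1 h2 =>
    obtain ⟨m₁, h1⟩ := h1
    obtain ⟨m₂, h2⟩ := h2
    exact ⟨max m₁ m₂, fun M hM => by
      rw [map_add, h1 M (le_of_max_le_left hM), h2 M (le_of_max_le_right hM), add_zero]⟩
  | smul c z _ h1 =>
    obtain ⟨m₁, h1⟩ := h1
    exact ⟨m₁, fun M hM => by simp [h1 M hM]⟩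

end Weights

section OddCasimir

variable {L : Type*} [CommRing L] [Algebra ℚ L] {n : ℕ}

/-- The variant of the Casimir operator, for matrices of odd size `2n + 1`, which vanishes on the
algebra generated by the sub-maximal Pfaffians. -/
noncomputable def oddCasimir (E : Fin (2 * n + 1) → Fin (2 * n + 1) → Derivation ℚ L L) :
    Module.End ℚ L :=
  ∑ a, ∑ b, (E a b : Module.End ℚ L) * (E b a : Module.End ℚ L) -
    ∑ a, (E a a : Module.End ℚ L) -
    ((2 * n : ℕ) : ℚ)⁻¹ • ((∑ a, (E a a : Module.End ℚ L)) * ∑ a, (E a a : Module.End ℚ L))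

variable (E : Fin (2 * n + 1) → Fin (2 * n + 1) → Derivation ℚ L L)

theorem oddCasimir_apply (u : L) :
    oddCasimir E u = ∑ a, ∑ b, E a b (E b a u) - ∑ a, E a a u -
      ((2 * n : ℕ) : ℚ)⁻¹ • ∑ a, E a a (∑ b, E b b u) := by
  simp only [oddCasimir, LinearMap.sub_apply, LinearMap.sum_apply, LinearMap.smul_apply,
    Module.End.mul_apply, Derivation.coeFn_coe]

theorem oddCasimir_mul (u v : L) :
    oddCasimir E (u * v) = u * oddCasimir E v + v * oddCasimir E u +
      2 * (∑ a, ∑ b, E a b u * E b a v -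
        ((2 * n : ℕ) : ℚ)⁻¹ • ((∑ a, E a a u) * ∑ a, E a a v)) := by
  have h1 : ∑ a, ∑ b, E a b (E b a (u * v)) = u * ∑ a, ∑ b, E a b (E b a v) +
      v * ∑ a, ∑ b, E a b (E b a u) + 2 * ∑ a, ∑ b, E a b u * E b a v := by
    have : ∑ a, ∑ b, E a b v * E b a u = ∑ a, ∑ b, E a b u * E b a v := by
      rw [Finset.sum_comm]
      simp only [mul_comm]
    rw [two_mul (∑ a, ∑ b, E a b u * E b a v)]
    nth_rw 2 [← this]
    simp only [Finset.mul_sum, ← Finset.sum_add_distrib, Derivation.leibniz, map_add, smul_eq_mul]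
    refine Finset.sum_congr rfl fun a _ => Finset.sum_congr rfl fun b _ => ?_
    ring
  have hT : ∀ u v : L, ∑ a, E a a (u * v) = u * ∑ a, E a a v + v * ∑ a, E a a u := by
    intro u v
    simp only [Finset.mul_sum, ← Finset.sum_add_distrib, Derivation.leibniz, smul_eq_mul]
  have h2 : ∑ a, E a a (∑ b, E b b (u * v)) = u * ∑ a, E a a (∑ b, E b b v) +
      v * ∑ a, E a a (∑ b, E b b u) + 2 * ((∑ a, E a a u) * ∑ a, E a a v) := by
    have hadd : ∀ u v : L, ∑ a, E a a (u + v) = ∑ a, E a a u + ∑ a, E a a v := by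
      intro u v
      simp only [map_add, ← Finset.sum_add_distrib]
    rw [hT, hadd, hT, hT]
    ring
  rw [oddCasimir_apply, oddCasimir_apply, oddCasimir_apply, h1, h2, hT]
  simp only [Algebra.smul_def]
  ring

variable {E}

theorem oddCasimir_one : oddCasimir E 1 = 0 := by
  simp [oddCasimir_apply]

/-- The elements multiplication by which commutes with the operator `oddCasimir`. -/
noncomputable def oddCasimirConst (E : Fin (2 * n + 1) → Fin (2 * n + 1) → Derivation ℚ L L) : Subalgebra ℚ L where
  carrier := {c | ∀ v, oddCasimir E (c * v) = c * oddCasimir E v}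
  mul_mem' := by
    intro c d hc hd v
    rw [mul_assoc, hc, hd, mul_assoc]
  add_mem' := by
    intro c d hc hd v
    rw [add_mul, map_add, hc, hd, add_mul]
  algebraMap_mem' := by
    intro r v
    rw [← Algebra.smul_def, map_smul, Algebra.smul_def]

theorem oddCasimir_eq_zero {c : L} (hc : c ∈ oddCasimirConst E) : oddCasimir E c = 0 := by
  have := hc 1
  rwa [mul_one, oddCasimir_one, mul_zero] at this

theorem inv_mem_oddCasimirConst {L : Type*} [Field L] [Algebra ℚ L]
    {E : Fin (2 * n + 1) → Fin (2 * n + 1) → Derivation ℚ L L} {c : L}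
    (hc : c ∈ oddCasimirConst E) : c⁻¹ ∈ oddCasimirConst E := by
  rcases eq_or_ne c 0 with rfl | h0
  · simp
  · intro v
    have := hc (c⁻¹ * v)
    rw [mul_inv_cancel_left₀ h0] at this
    rw [this, inv_mul_cancel_left₀ h0]

theorem mem_oddCasimirConst_of_kill {c : L} (hc : ∀ a b, E a b c = 0) : c ∈ oddCasimirConst E := by
  intro v
  have : oddCasimir E c = 0 := by simp [oddCasimir_apply, hc]
  rw [oddCasimir_mul, this]
  simp [hc]

theorem mem_oddCasimirConst_of_pfaffian (hn : n ≠ 0) {q : Fin (2 * n + 1) → L}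
    (hq : ∀ a b c, E a b (q c) = (if a = b then q c else 0) - if c = b then q a else 0)
    (hE : ∀ c v, ∑ a, q a * E c a v = 0) (c : Fin (2 * n + 1)) : q c ∈ oddCasimirConst E := by
  have hn' : ((2 * n : ℕ) : ℚ) ≠ 0 := by exact_mod_cast (by omega : 2 * n ≠ 0)
  have hT : ∀ c, ∑ a, E a a (q c) = ((2 * n : ℕ) : ℚ) • q c := by
    intro c
    rw [Nat.cast_smul_eq_nsmul, nsmul_eq_mul]
    simp [hq]
    ring
  have h0 : oddCasimir E (q c) = 0 := by
    have h1 : ∑ a, ∑ b, E a b (E b a (q c)) = (((2 * n : ℕ) : ℚ) + ((2 * n : ℕ) : ℚ)) • q c := by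
      have : ∀ a b, E a b (E b a (q c)) = (if b = a then E a b (q c) else 0) -
          if c = a then E a b (q b) else 0 := by
        intro a b
        rw [hq b a c, map_sub]
        split_ifs <;> simp
      simp only [this, Finset.sum_sub_distrib, Finset.sum_ite_eq', Finset.mem_univ, if_true, hT]
      rw [Finset.sum_comm, ← Nat.cast_add, Nat.cast_smul_eq_nsmul, Nat.cast_smul_eq_nsmul,
        nsmul_eq_mul, nsmul_eq_mul]
      simp [hq]
      ring
    rw [oddCasimir_apply, h1, hT, add_smul]
    have h2 : ∑ a, E a a (((2 * n : ℕ) : ℚ) • q c) = ((2 * n : ℕ) : ℚ) • ((2 * n : ℕ) : ℚ) • q c := by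
      simp only [Derivation.map_smul, ← Finset.smul_sum, hT]
    rw [h2, inv_smul_smul₀ hn']
    abel
  intro v
  have h3 : ∑ a, ∑ b, E a b (q c) * E b a v = q c * ∑ a, E a a v := by
    simp only [hq, sub_mul, Finset.sum_sub_distrib, ite_mul, zero_mul, Finset.sum_ite_eq,
      Finset.mem_univ, if_true, hE, sub_zero, Finset.mul_sum]
  rw [oddCasimir_mul, h0, h3, hT, smul_mul_assoc, inv_smul_smul₀ hn']
  simp

end OddCasimir

section Transport

theorem derivation_algHom {σ L : Type*} [CommRing L] [Algebra ℚ L]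
    (φ : MvPolynomial σ ℚ →ₐ[ℚ] L) (D : Derivation ℚ L L)
    (V : Derivation ℚ (MvPolynomial σ ℚ) (MvPolynomial σ ℚ))
    (h : ∀ i, D (φ (X i)) = φ (V (X i))) (u : MvPolynomial σ ℚ) : D (φ u) = φ (V u) := by
  induction u using MvPolynomial.induction_on with
  | C c =>
    rw [← algebraMap_eq, AlgHom.commutes, Derivation.map_algebraMap, Derivation.map_algebraMap,
      map_zero]
  | add p q hp hq => rw [map_add, map_add, hp, hq, map_add, map_add]
  | mul_X p i hp =>
    simp only [map_mul, Derivation.leibniz, hp, h, map_add, smul_eq_mul]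

end Transport

namespace SkewFrame

section Eval

variable {L : Type*} [Field L] [Algebra ℚ L] {N M : ℕ} {A : Subalgebra ℚ L}
  {X : Matrix (Fin N) (Fin N) L} {D : Fin N → Fin N → Derivation ℚ L L}

theorem derivation_skewEval (h : SkewFrame A X D) (s : Fin M ↪ Fin N) (a d : Fin M) (u : SkewPoly M) :
    D (s a) (s d) (skewEval (X.submatrix s s) u) =
      skewEval (X.submatrix s s) (skewD ℚ M a d u) := by
  refine derivation_algHom _ _ _ (fun ⟨⟨e, f⟩, hef⟩ => ?_) u
  have hY : ∀ a b, X.submatrix s s b a = -X.submatrix s s a b := fun a b => h.swap _ _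
  rw [← skewX_of_lt ℚ hef, skewEval_skewX hY, Matrix.submatrix_apply, h.entry, skewD_skewX, map_sub]
  simp only [EmbeddingLike.apply_eq_iff_eq]
  congr 1 <;> split_ifs <;> simp

theorem derivation_skewEval_eq_zero (h : SkewFrame A X D) (s : Fin M ↪ Fin N) {a d : Fin N}
    (had : (∀ i, s i ≠ a) ∨ ∀ i, s i ≠ d) (u : SkewPoly M) :
    D a d (skewEval (X.submatrix s s) u) = 0 := by
  have := derivation_algHom (skewEval (X.submatrix s s)) (D a d) 0 (fun ⟨⟨e, f⟩, hef⟩ => ?_) u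
  · rw [this, Derivation.zero_apply, map_zero]
  · have hY : ∀ a b, X.submatrix s s b a = -X.submatrix s s a b := fun a b => h.swap _ _
    rw [← skewX_of_lt ℚ hef, skewEval_skewX hY, Matrix.submatrix_apply, h.entry, Derivation.zero_apply,
      map_zero]
    rcases had with had | had <;> simp [had, eq_comm (a := a), eq_comm (a := d)]

end Eval

section Odd

variable {L : Type*} [Field L] [Algebra ℚ L] {n : ℕ} {A : Subalgebra ℚ L}
  {X : Matrix (Fin (2 * n + 1)) (Fin (2 * n + 1)) L}
  {D : Fin (2 * n + 1) → Fin (2 * n + 1) → Derivation ℚ L L}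

theorem polarDer_subPfaff (h : SkewFrame A X D) (a b c : Fin (2 * n + 1)) :
    polarDer X D a b (subPfaff X c) =
      (if a = b then subPfaff X c else 0) - if c = b then subPfaff X a else 0 :=
  derivation_subPfaff (polarDer_entry h.swap h.entry a b) c

theorem sum_subPfaff_mul_polarDer (h : SkewFrame A X D) (c : Fin (2 * n + 1)) (v : L) :
    ∑ a, subPfaff X a * polarDer X D c a v = 0 := by
  simp only [polarDer_apply, Finset.mul_sum]
  rw [Finset.sum_comm]
  refine Finset.sum_eq_zero fun d _ => ?_
  have h1 : ∑ a, subPfaff X a * X a d = -∑ a, X d a * subPfaff X a := by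
    rw [← Finset.sum_neg_distrib]
    refine Finset.sum_congr rfl fun a _ => ?_
    rw [h.swap d a, mul_neg, mul_comm]
  simp only [← mul_assoc, ← Finset.sum_mul]
  rw [h1, sum_mul_subPfaff h.swap h.diag d, neg_zero, zero_mul]

theorem polarDer_eq_zero (h : SkewFrame A X D) (a b : Fin (2 * n + 1)) {x : L} (hx : x ∈ A) :
    polarDer X D a b x = 0 := by
  simp [polarDer_apply, h.kill _ _ x hx]

theorem polarDer_mem (h : SkewFrame A X D) (a b : Fin (2 * n + 1)) {t : Finset (Fin (2 * n + 1))}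
    {y : L} (hy : y ∈ locAlg (entryAlg A X) (subPfaff X) t) :
    polarDer X D a b y ∈ locAlg (entryAlg A X) (subPfaff X) t := by
  refine derivation_mem_locAlg _ subPfaff_mem_entryAlg (fun x hx => ?_) hy
  rw [polarDer_apply]
  exact sum_mem fun d _ => mul_mem (entry_mem_entryAlg _ _) (h.derivation_mem _ _ hx)

theorem locAlg_le_oddCasimirConst (h : SkewFrame A X D) (hn : n ≠ 0) (t : Finset (Fin (2 * n + 1))) :
    locAlg (baseAlg A (subPfaff X)) (subPfaff X) t ≤ oddCasimirConst (polarDer X D) := by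
  have hq : ∀ c, subPfaff X c ∈ oddCasimirConst (polarDer X D) :=
    mem_oddCasimirConst_of_pfaffian hn h.polarDer_subPfaff h.sum_subPfaff_mul_polarDer
  refine locAlg_le (Algebra.adjoin_le ?_) fun c _ => inv_mem_oddCasimirConst (hq c)
  rintro _ (hx | ⟨c, rfl⟩)
  exacts [mem_oddCasimirConst_of_kill fun a b => h.polarDer_eq_zero a b hx, hq c]

theorem oddCasimir_skewEval (h : SkewFrame A X D) (k : Fin (2 * n + 1)) (u : SkewPoly (2 * n)) :
    oddCasimir (polarDer X D) (skewEval (X.submatrix k.succAbove k.succAbove) u) =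
      skewEval (X.submatrix k.succAbove k.succAbove)
        (casimir (polarDer (skewX ℚ (2 * n)) (skewD ℚ (2 * n))) u) := by
  set φ := skewEval (X.submatrix k.succAbove k.succAbove) with hφ
  have hY : ∀ a b, X.submatrix k.succAbove k.succAbove b a =
    -X.submatrix k.succAbove k.succAbove a b := fun a b => h.swap _ _
  have hφX : ∀ a b, φ (skewX ℚ (2 * n) a b) = X (k.succAbove a) (k.succAbove b) :=
    skewEval_skewX hY
  have hD : ∀ a d u, D (k.succAbove a) (k.succAbove d) (φ u) = φ (skewD ℚ (2 * n) a d u) :=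
    h.derivation_skewEval (Fin.succAboveEmb k)
  have hDl : ∀ d u, D k d (φ u) = 0 := fun d u =>
    h.derivation_skewEval_eq_zero (Fin.succAboveEmb k)
      (Or.inl fun i => Fin.succAbove_ne k i) u
  have hDr : ∀ d u, D d k (φ u) = 0 := fun d u =>
    h.derivation_skewEval_eq_zero (Fin.succAboveEmb k)
      (Or.inr fun i => Fin.succAbove_ne k i) u
  have hE : ∀ a b u, polarDer X D (k.succAbove a) (k.succAbove b) (φ u) =
      φ (polarDer (skewX ℚ (2 * n)) (skewD ℚ (2 * n)) a b u) := by
    intro a b u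
    rw [polarDer_apply, polarDer_apply, Fin.sum_univ_succAbove _ k, hDr, mul_zero, zero_add, map_sum]
    simp only [hD, map_mul, hφX]
  have hEl : ∀ b u, polarDer X D k b (φ u) = 0 := by
    intro b u
    simp [polarDer_apply, hDl]
  have hEE : ∀ b u, polarDer X D k (k.succAbove b) (polarDer X D (k.succAbove b) k (φ u)) =
      φ (polarDer (skewX ℚ (2 * n)) (skewD ℚ (2 * n)) b b u) := by
    intro b u
    rw [polarDer_apply X D (k.succAbove b) k, Fin.sum_univ_succAbove _ k, hDr, mul_zero, zero_add,
      map_sum, polarDer_apply (skewX ℚ _), map_sum]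
    refine Finset.sum_congr rfl fun d _ => ?_
    rw [Derivation.leibniz, hD, hEl, smul_zero, zero_add, polarDer_entry h.swap h.entry, if_pos rfl,
      if_neg (Fin.succAbove_ne k d), add_zero, map_mul, hφX, smul_eq_mul, mul_comm]
  have hTr : ∀ u, ∑ a, polarDer X D a a (φ u) =
      φ (∑ a, polarDer (skewX ℚ (2 * n)) (skewD ℚ (2 * n)) a a u) := by
    intro u
    rw [Fin.sum_univ_succAbove _ k, hEl, zero_add, map_sum]
    simp only [hE]
  rw [oddCasimir_apply, casimir_apply, hTr, hTr, Fin.sum_univ_succAbove _ k,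
    Fin.sum_univ_succAbove _ k, hEl, map_zero, zero_add]
  simp only [Fin.sum_univ_succAbove _ k, hE, hEE, hEl, map_zero, zero_add, map_sub, map_smul, map_sum]
  abel

end Odd

end SkewFrame

namespace SkewFrame

section Transporter

variable {L : Type*} [Field L] [Algebra ℚ L] {n : ℕ} {A : Subalgebra ℚ L}
  {X : Matrix (Fin (2 * n + 1)) (Fin (2 * n + 1)) L}
  {D : Fin (2 * n + 1) → Fin (2 * n + 1) → Derivation ℚ L L}

theorem locAlg_entryAlg_le (h : SkewFrame A X D) {k : Fin (2 * n + 1)} (hk0 : subPfaff X k ≠ 0)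
    {t : Finset (Fin (2 * n + 1))} (hk : k ∈ t) :
    locAlg (entryAlg A X) (subPfaff X) t ≤ locAlg (baseAlg A (subPfaff X)) (subPfaff X) t ⊔
      (skewEval (X.submatrix k.succAbove k.succAbove)).range := by
  set S := locAlg (baseAlg A (subPfaff X)) (subPfaff X) t ⊔
      (skewEval (X.submatrix k.succAbove k.succAbove)).range with hS
  have hCS : locAlg (baseAlg A (subPfaff X)) (subPfaff X) t ≤ S := le_sup_left
  have hq : ∀ c, subPfaff X c ∈ S := fun c =>
    hCS (le_locAlg _ _ _ (Algebra.subset_adjoin (Or.inr ⟨c, rfl⟩)))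
  have hYS : ∀ a b, X (k.succAbove a) (k.succAbove b) ∈ S := fun a b =>
    (le_sup_right : _ ≤ S) ⟨skewX ℚ (2 * n) a b,
      skewEval_skewX (Y := X.submatrix k.succAbove k.succAbove) (fun a b => h.swap _ _) a b⟩
  have hrow : ∀ a, X (k.succAbove a) k ∈ S := by
    intro a
    have h1 := sum_mul_subPfaff h.swap h.diag (k.succAbove a)
    rw [Fin.sum_univ_succAbove _ k] at h1
    have h2 : X (k.succAbove a) k = -((subPfaff X k)⁻¹ *
        ∑ i, X (k.succAbove a) (k.succAbove i) * subPfaff X (k.succAbove i)) := by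
      rw [← eq_neg_iff_add_eq_zero] at h1
      rw [← mul_neg, ← h1, mul_comm (X _ _), inv_mul_cancel_left₀ hk0]
    rw [h2]
    exact neg_mem (mul_mem (hCS (inv_mem_locAlg _ _ hk)) (sum_mem fun i _ => mul_mem (hYS a i) (hq _)))
  refine locAlg_le (entryAlg_le (fun x hx => hCS (le_locAlg _ _ _ (Algebra.subset_adjoin (Or.inl hx))))
    fun a b => ?_) fun i hi => hCS (inv_mem_locAlg _ _ hi)
  cases a using Fin.succAboveCases k with
  | x =>
    cases b using Fin.succAboveCases k with
    | x => rw [h.diag]; exact zero_mem _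
    | p b => rw [h.swap]; exact neg_mem (hrow b)
  | p a =>
    cases b using Fin.succAboveCases k with
    | x => exact hrow a
    | p b => exact hYS a b

theorem oddCasimir_mem (h : SkewFrame A X D) (hn : n ≠ 0) (t : Finset (Fin (2 * n + 1))) :
    ∀ v ∈ Subalgebra.toSubmodule (locAlg (baseAlg A (subPfaff X)) (subPfaff X) t),
      oddCasimir (polarDer X D) v ∈
        Subalgebra.toSubmodule (locAlg (baseAlg A (subPfaff X)) (subPfaff X) t) := fun v hv => by
  rw [oddCasimir_eq_zero (h.locAlg_le_oddCasimirConst hn t hv)]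
  exact zero_mem _

theorem mem_unitTransporter_oddCasimir (h : SkewFrame A X D) (hn : n ≠ 0) (hq0 : ∀ c, subPfaff X c ≠ 0)
    {t : Finset (Fin (2 * n + 1))} (ht : t.Nonempty) {y : L}
    (hy : y ∈ locAlg (entryAlg A X) (subPfaff X) t) :
    y ∈ unitTransporter (oddCasimir (polarDer X D))
      (Subalgebra.toSubmodule (locAlg (baseAlg A (subPfaff X)) (subPfaff X) t))
      (h.oddCasimir_mem hn t) := by
  obtain ⟨k, hk⟩ := ht
  replace hy := h.locAlg_entryAlg_le (hq0 k) hk hy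
  rw [← Subalgebra.mem_toSubmodule, ← Subalgebra.mul_toSubmodule] at hy
  induction hy using Submodule.mul_induction_on' with
  | add x _ y _ hx hy => exact add_mem hx hy
  | mem_mul_mem c hc y hy =>
    obtain ⟨u, rfl⟩ := hy
    obtain ⟨g, hg, hgu⟩ := exists_aeval_casimir_mem_adjoin hn u
    refine ⟨g, hg, ?_⟩
    have h1 := aeval_apply_comm (LinearMap.mulLeft ℚ c) (oddCasimir (polarDer X D))
      (oddCasimir (polarDer X D))
      (fun v => (h.locAlg_le_oddCasimirConst hn t hc v).symm) g
      (skewEval (X.submatrix k.succAbove k.succAbove) u)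
    have h2 := aeval_apply_comm (skewEval (X.submatrix k.succAbove k.succAbove)).toLinearMap _
      (oddCasimir (polarDer X D)) (fun v => (h.oddCasimir_skewEval k v).symm) g u
    rw [LinearMap.mulLeft_apply, LinearMap.mulLeft_apply] at h1
    refine (congrArg (· ∈ locAlg (baseAlg A (subPfaff X)) (subPfaff X) t) h1).mp ?_
    refine mul_mem hc ?_
    refine (congrArg (· ∈ locAlg (baseAlg A (subPfaff X)) (subPfaff X) t) h2).mp ?_
    have h3 : Algebra.adjoin ℚ {pfaffSum (skewX ℚ (2 * n))} ≤
          (locAlg (baseAlg A (subPfaff X)) (subPfaff X) t).comap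
            (skewEval (X.submatrix k.succAbove k.succAbove)) := by
        refine Algebra.adjoin_le ?_
        rintro _ rfl
        show skewEval _ _ ∈ locAlg (baseAlg A (subPfaff X)) (subPfaff X) t
        rw [skewEval_pfaffSum (Y := X.submatrix k.succAbove k.succAbove) fun a b => h.swap _ _]
        have h4 := subPfaff_eq X k
        have h5 : pfaffSum (X.submatrix k.succAbove k.succAbove) = (-1) ^ (k : ℕ) * subPfaff X k := by
          rw [h4, ← mul_assoc, ← mul_pow]; simp
        rw [h5]
        exact mul_mem (pow_mem (neg_mem (one_mem _)) _)
          (le_locAlg _ _ _ (Algebra.subset_adjoin (Or.inr ⟨k, rfl⟩)))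
    exact h3 hgu

end Transporter

section EigenMod

variable {L : Type*} [Field L] [Algebra ℚ L] {n j : ℕ} {A : Subalgebra ℚ L}
  {X : Matrix (Fin (2 * n + 1)) (Fin (2 * n + 1)) L}
  {D : Fin (2 * n + 1) → Fin (2 * n + 1) → Derivation ℚ L L}
  {f : List (Fin (2 * n + 1)) → L}

theorem eigenMod_polarDer (h : SkewFrame A X D)
    (hsoc : ∀ a b, a ≠ b → X a b • f ∈ cechB (locF (entryAlg A X) (subPfaff X)) j)
    (a b : Fin (2 * n + 1)) :
    EigenMod (fun t => Subalgebra.toSubmodule (locAlg (entryAlg A X) (subPfaff X) t)) j f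
      (polarDer X D a b : Module.End ℚ L) (if a = b then -((2 * n : ℕ) : ℚ) else 0) := by
  refine ⟨fun t y hy => h.polarDer_mem a b hy, ?_⟩
  have hD : ∀ d, (fun l => D a d ((X b d • f) l)) ∈ cechB (locF (entryAlg A X) (subPfaff X)) j := by
    intro d
    rcases eq_or_ne b d with rfl | hbd
    · simp only [h.diag, zero_smul, Pi.zero_apply, map_zero]
      exact zero_mem _
    · exact map_mem_cechB (φ := (D a d : L →ₗ[ℚ] L).toAddMonoidHom)
        (fun t y hy => derivation_mem_locAlg _ subPfaff_mem_entryAlg (fun x hx => h.derivation_mem _ _ hx) hy)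
        (hsoc b d hbd)
  have := sum_mem fun d (_ : d ∈ Finset.univ) => hD d
  show _ ∈ cechB (locF (entryAlg A X) (subPfaff X)) j
  convert this using 1
  funext l
  rw [Finset.sum_apply]
  simp only [Pi.smul_apply, smul_eq_mul, Derivation.leibniz, Finset.sum_add_distrib, h.entry]
  rw [Derivation.coeFn_coe, polarDer_apply, sub_eq_add_neg]
  congr 1
  rw [← Finset.mul_sum, Finset.sum_sub_distrib]
  by_cases hab : a = b
  · subst hab
    have h1 : ∑ d : Fin (2 * n + 1), (if a = d ∧ d = a then (1 : L) else 0) = 1 := by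
      rw [Finset.sum_eq_single a] <;> simp +contextual [eq_comm]
    rw [h1, if_pos rfl, neg_smul, neg_neg, Nat.cast_smul_eq_nsmul, nsmul_eq_mul]
    simp
    ring
  · simp [hab, ite_and]

end EigenMod

end SkewFrame

section WeightDer

variable {L : Type*} [CommRing L] [Algebra ℚ L] {n : ℕ}

/-- The derivation which measures the degree in the sub-maximal Pfaffian of index `a`. -/
noncomputable def weightDer (E : Fin (2 * n + 1) → Fin (2 * n + 1) → Derivation ℚ L L)
    (a : Fin (2 * n + 1)) : Derivation ℚ L L :=
  ((2 * n : ℕ) : ℚ)⁻¹ • ∑ b, E b b - E a a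

theorem weightDer_apply (E : Fin (2 * n + 1) → Fin (2 * n + 1) → Derivation ℚ L L)
    (a : Fin (2 * n + 1)) (u : L) :
    weightDer E a u = ((2 * n : ℕ) : ℚ)⁻¹ • ∑ b, E b b u - E a a u := by
  have : (∑ b, E b b) u = ∑ b, E b b u := by
    rw [← Derivation.coeFnAddMonoidHom_apply, map_sum, Finset.sum_apply]
    rfl
  rw [weightDer, Derivation.sub_apply, Derivation.smul_apply, this]

theorem coe_weightDer (E : Fin (2 * n + 1) → Fin (2 * n + 1) → Derivation ℚ L L)
    (a : Fin (2 * n + 1)) : (weightDer E a : Module.End ℚ L) =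
      ((2 * n : ℕ) : ℚ)⁻¹ • ∑ b, (E b b : Module.End ℚ L) - (E a a : Module.End ℚ L) := by
  ext u
  rw [Derivation.coeFn_coe, weightDer_apply, LinearMap.sub_apply, LinearMap.smul_apply,
    LinearMap.sum_apply]
  rfl

theorem weightDer_pfaffian (hn : n ≠ 0) {E : Fin (2 * n + 1) → Fin (2 * n + 1) → Derivation ℚ L L}
    {q : Fin (2 * n + 1) → L}
    (hq : ∀ a b c, E a b (q c) = (if a = b then q c else 0) - if c = b then q a else 0)
    (a c : Fin (2 * n + 1)) : weightDer E a (q c) = if c = a then q c else 0 := by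
  have hn' : ((2 * n : ℕ) : ℚ) ≠ 0 := by exact_mod_cast (by omega : 2 * n ≠ 0)
  have h1 : ∑ b, E b b (q c) = ((2 * n : ℕ) : ℚ) • q c := by
    rw [Nat.cast_smul_eq_nsmul, nsmul_eq_mul]
    simp [hq]
    ring
  rw [weightDer_apply, h1, inv_smul_smul₀ hn', hq, if_pos rfl, sub_sub_cancel]
  split_ifs with hca
  · rw [hca]
  · rfl

end WeightDer

namespace SkewFrame

variable {L : Type*} [Field L] [Algebra ℚ L] {n j : ℕ} {A : Subalgebra ℚ L}
  {X : Matrix (Fin (2 * n + 1)) (Fin (2 * n + 1)) L}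
  {D : Fin (2 * n + 1) → Fin (2 * n + 1) → Derivation ℚ L L}
  {f : List (Fin (2 * n + 1)) → L}

theorem eigenMod_trace (h : SkewFrame A X D)
    (hsoc : ∀ a b, a ≠ b → X a b • f ∈ cechB (locF (entryAlg A X) (subPfaff X)) j) :
    EigenMod (fun t => Subalgebra.toSubmodule (locAlg (entryAlg A X) (subPfaff X) t)) j f
      (∑ a, (polarDer X D a a : Module.End ℚ L)) (-(((2 * n + 1 : ℕ) : ℚ) * (2 * n : ℕ))) := by
  convert EigenMod.sum Finset.univ fun a _ => h.eigenMod_polarDer hsoc a a using 1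
  simp

theorem eigenMod_oddCasimir (h : SkewFrame A X D) (hn : n ≠ 0)
    (hsoc : ∀ a b, a ≠ b → X a b • f ∈ cechB (locF (entryAlg A X) (subPfaff X)) j) :
    EigenMod (fun t => Subalgebra.toSubmodule (locAlg (entryAlg A X) (subPfaff X) t)) j f
      (oddCasimir (polarDer X D)) 0 := by
  have hn' : (n : ℚ) ≠ 0 := by exact_mod_cast hn
  have h1 := EigenMod.sum Finset.univ fun a _ => EigenMod.sum Finset.univ fun b _ =>
    (h.eigenMod_polarDer hsoc a b).mul (h.eigenMod_polarDer hsoc b a)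
  have hT := h.eigenMod_trace hsoc
  convert (h1.sub hT).sub ((hT.mul hT).smul (((2 * n : ℕ) : ℚ)⁻¹)) using 1
  · rfl
  · simp only [mul_ite, mul_zero, ite_mul, zero_mul, Finset.sum_ite_eq',
      Finset.mem_univ, if_true, Finset.sum_const, Finset.card_univ, Fintype.card_fin, nsmul_eq_mul]
    push_cast
    field_simp
    ring

theorem eigenMod_weightDer (h : SkewFrame A X D) (hn : n ≠ 0)
    (hsoc : ∀ a b, a ≠ b → X a b • f ∈ cechB (locF (entryAlg A X) (subPfaff X)) j) (a : Fin (2 * n + 1)) :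
    EigenMod (fun t => Subalgebra.toSubmodule (locAlg (entryAlg A X) (subPfaff X) t)) j f
      (weightDer (polarDer X D) a : Module.End ℚ L) (-1) := by
  have hn' : (n : ℚ) ≠ 0 := by exact_mod_cast hn
  rw [coe_weightDer]
  convert ((h.eigenMod_trace hsoc).smul (((2 * n : ℕ) : ℚ)⁻¹)).sub (h.eigenMod_polarDer hsoc a a) using 1
  rw [if_pos rfl]
  push_cast
  field_simp
  ring

theorem weightDer_subPfaff (h : SkewFrame A X D) (hn : n ≠ 0) (a c : Fin (2 * n + 1)) :
    weightDer (polarDer X D) a (subPfaff X c) = if c = a then subPfaff X c else 0 :=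
  weightDer_pfaffian hn h.polarDer_subPfaff a c

theorem eigenMod_weightProd {ι : Type*} [DecidableEq ι] [Fintype ι] {F : Finset ι → Submodule ℚ L}
    {j : ℕ} {f : List ι → L} {H : ι → Derivation ℚ L L}
    (hH : ∀ a, EigenMod F j f (H a : Module.End ℚ L) (-1)) (M : ℕ) :
    ∃ c : ℚ, c ≠ 0 ∧ EigenMod F j f (weightProd H M) c := by
  refine ⟨_, ?_, EigenMod.list_prod _ fun p _ => (hH p.1).sub (EigenMod.scalar (p.2 : ℚ))⟩
  refine List.prod_ne_zero fun h0 => ?_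
  obtain ⟨p, _, hp⟩ := List.mem_map.1 h0
  have : (0 : ℚ) ≤ p.2 := Nat.cast_nonneg _
  linarith

/-- A class in the socle of the Čech cohomology of the sub-maximal Pfaffians vanishes below the
top degree. -/
theorem mem_cechB_of_socle (h : SkewFrame A X D) (hn : n ≠ 0) (hq0 : ∀ c, subPfaff X c ≠ 0)
    (hj0 : j ≠ 0) (hj : j ≤ 2 * n)
    (hf : f ∈ cechZ (locF (entryAlg A X) (subPfaff X)) j)
    (hsoc : ∀ a b, a ≠ b → X a b • f ∈ cechB (locF (entryAlg A X) (subPfaff X)) j) :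
    f ∈ cechB (locF (entryAlg A X) (subPfaff X)) j := by
  have hfin : {l : List (Fin (2 * n + 1)) | l.length = j}.Finite := List.finite_length_eq _ j
  have hmem : ∀ l, l ∈ hfin.toFinset ↔ l.length = j := fun l => by simp
  obtain ⟨g, hg, hgf⟩ := exists_common_polynomial hfin.toFinset (oddCasimir (polarDer X D))
    (fun l => Subalgebra.toSubmodule (locAlg (baseAlg A (subPfaff X)) (subPfaff X) l.toFinset))
    (fun l => h.oddCasimir_mem hn l.toFinset) f (fun l hl => by
      have hl := (hmem l).1 hl
      refine h.mem_unitTransporter_oddCasimir hn hq0 ?_ (hf.1 l hl)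
      rw [List.toFinset_nonempty_iff]
      rintro rfl
      exact hj0 hl.symm)
  have hW : ∀ l, ∃ M₀ : ℕ, l.length = j → ∀ M, M₀ ≤ M →
      weightProd (weightDer (polarDer X D)) M
        (Polynomial.aeval (oddCasimir (polarDer X D)) g (f l)) = 0 := by
    intro l
    by_cases hl : l.length = j
    · obtain ⟨M₀, hM₀⟩ := weightProd_apply_eq_zero (H := weightDer (polarDer X D))
        (fun a x hx => by simp [weightDer_apply, h.polarDer_eq_zero _ _ hx])
        (fun a c => h.weightDer_subPfaff hn a c) hq0 (t := l.toFinset) (fun hu => by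
          have h1 := List.toFinset_card_le l
          rw [hu, Finset.card_univ, Fintype.card_fin] at h1
          omega) (hgf l ((hmem l).2 hl))
      exact ⟨M₀, fun _ => hM₀⟩
    · exact ⟨0, fun h => absurd h hl⟩
  choose M₀ hM₀ using hW
  obtain ⟨c, hc, hP⟩ := eigenMod_weightProd (h.eigenMod_weightDer hn hsoc) (hfin.toFinset.sup M₀)
  have hg' := (h.eigenMod_oddCasimir hn hsoc).aeval g
  rw [hg] at hg'
  refine (hP.mul hg').mem_cechB (by simpa using hc) fun l hl => ?_
  rw [Module.End.mul_apply]
  exact hM₀ l hl _ (Finset.le_sup (f := M₀) ((hmem l).2 hl))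

end SkewFrame

theorem frameExact (L : Type*) [Field L] [Algebra ℚ L] (n : ℕ) : ∀ j,
    (¬∃ s, 1 ≤ s ∧ s ≤ n ∧ j = 2 * s + 1) → FrameExact L n j := by
  induction n with
  | zero => exact fun j _ => frameExact_zero j
  | succ m ih =>
    intro j hj A X D h hq0
    have ihj : FrameExact L m j := ih j fun ⟨s, h1, h2, h3⟩ => hj ⟨s, h1, by omega, h3⟩
    rcases Nat.eq_zero_or_pos j with rfl | hj0
    · exact CechExact.zero Finset.univ_nonempty
    rcases lt_or_ge (2 * (m + 1) + 1) j with hjn | hjn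
    · exact CechExact.of_card_lt _ _ (locF_mono _ _) (by simpa using hjn)
    have hjn' : j ≤ 2 * (m + 1) := by
      by_contra hlt
      exact hj ⟨m + 1, by omega, le_rfl, by omega⟩
    rw [cechExact_univ_iff]
    have hentry : ∀ a b, ∀ t, ∀ y ∈ locF (entryAlg A X) (subPfaff X) t,
        X a b * y ∈ locF (entryAlg A X) (subPfaff X) t := fun a b t y hy =>
      (locAlg _ _ t).mul_mem (le_locAlg _ _ _ (entry_mem_entryAlg a b)) hy
    refine le_of_torsion_of_socle (κ := {p : Fin (2 * (m + 1) + 1) × Fin (2 * (m + 1) + 1) // p.1 ≠ p.2})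
      (fun p => X p.1.1 p.1.2) _ _ ?_ ?_ ?_ ?_
    · exact fun p z hz => map_mem_cechZ (φ := AddMonoidHom.mulLeft (X p.1.1 p.1.2)) (hentry _ _) hz
    · exact fun p z hz => map_mem_cechB (φ := AddMonoidHom.mulLeft (X p.1.1 p.1.2)) (hentry _ _) hz
    · exact fun p z hz => SkewFrame.exists_pow_mul_mem_cechB ihj h hq0 p.2 hz
    · exact fun z hz hsoc => h.mem_cechB_of_socle (Nat.succ_ne_zero m) hq0 hj0.ne' hjn' hz
        fun a b hab => hsoc ⟨(a, b), hab⟩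

section DerivedExt

open CategoryTheory Opposite

universe u

variable {R : Type u} [CommRing R]

theorem exists_cocycle_of_ext {M Y : ModuleCat.{u} R} (P : ProjectiveResolution M) (n : ℕ)
    (x : ((Ext R (ModuleCat.{u} R) n).obj (op M)).obj Y) :
    ∃ f : P.complex.X n ⟶ Y, P.complex.d (n + 1) n ≫ f = 0 ∧
      ∀ {M' : ModuleCat.{u} R} (P' : ProjectiveResolution M') (g : M' ⟶ M)
        (φ : ProjectiveResolution.Hom P' P g),
        (∃ p, ∃ h : P'.complex.X p ⟶ Y, P'.complex.d n p ≫ h = φ.hom.f n ≫ f) →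
        (((Ext R (ModuleCat.{u} R) n).map g.op).app Y).hom x = 0 := by
  let F : ModuleCat.{u} R ⥤ (ModuleCat.{u} R)ᵒᵖ := ((linearYoneda R (ModuleCat.{u} R)).obj Y).rightOp
  let K := (F.mapHomologicalComplex (ComplexShape.down ℕ)).obj P.complex
  let e := P.isoLeftDerivedObj F n
  let y : (K.homology n).unop := e.inv.unop.hom x
  obtain ⟨z, hz⟩ := (ModuleCat.epi_iff_surjective (K.homologyι n).unop).1 inferInstance y
  let f : P.complex.X n ⟶ Y := (K.pOpcycles n).unop.hom z
  refine ⟨f, ?_, ?_⟩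
  · have h1 : K.d (n + 1) n ≫ K.pOpcycles n = 0 := K.d_pOpcycles _ _
    have h2 := congrArg (fun u => u.unop.hom z) h1
    exact h2
  · intro M' P' g φ ⟨p, h, hh⟩
    let K' := (F.mapHomologicalComplex (ComplexShape.down ℕ)).obj P'.complex
    let ψ : K' ⟶ K := (F.mapHomologicalComplex (ComplexShape.down ℕ)).map φ.hom
    have hn := ProjectiveResolution.isoLeftDerivedObj_inv_naturality g P' P φ.hom
      φ.hom_f_zero_comp_π_f_zero F n
    have h1 := congrArg (fun u => u.unop.hom x) hn
    have h2 := congrArg (fun u => u.unop.hom z) (HomologicalComplex.homologyι_naturality ψ n)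
    have h3 := congrArg (fun u => u.unop.hom z) (HomologicalComplex.p_opcyclesMap ψ n)
    have h4 := congrArg (fun u => u.unop.hom h) (K'.p_fromOpcycles n p)
    have h5 := congrArg (fun u => u.unop.hom h) (K'.homologyι_comp_fromOpcycles n p)
    have h6 : (HomologicalComplex.opcyclesMap ψ n).unop.hom z = (K'.fromOpcycles n p).unop.hom h := by
      refine (ModuleCat.mono_iff_injective (K'.pOpcycles n).unop).1 inferInstance ?_
      exact h3.trans (hh.symm.trans h4.symm)
    have h7 : (HomologicalComplex.homologyMap ψ n).unop.hom y = 0 := by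
      rw [← hz]
      refine h2.trans ?_
      exact (congrArg (K'.homologyι n).unop.hom h6).trans h5
    refine (ModuleCat.mono_iff_injective (P'.isoLeftDerivedObj F n).inv.unop).1 inferInstance ?_
    exact (h1.trans h7).trans (map_zero (P'.isoLeftDerivedObj F n).inv.unop.hom).symm

end DerivedExt

section LocalCohomologyVanishing

open CategoryTheory Opposite Limits

universe u

variable {R : Type u} [CommRing R]

/-- The projection `R ⧸ J ^ t' → R ⧸ J ^ t` for `t ≤ t'`. -/
noncomputable def quotPow (J : Ideal R) {t t' : ℕ} (h : t ≤ t') :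
    ModuleCat.of R (R ⧸ J ^ t') ⟶ ModuleCat.of R (R ⧸ J ^ t) :=
  ModuleCat.ofHom (Submodule.mapQ _ _ LinearMap.id (Ideal.pow_le_pow_right h))

theorem subsingleton_localCohomology (J : Ideal R) (j : ℕ) (Y : ModuleCat.{u} R)
    (H : ∀ (t : ℕ) (x : ((Ext R (ModuleCat.{u} R) j).obj (op (ModuleCat.of R (R ⧸ J ^ t)))).obj Y),
      ∃ t', ∃ h : t ≤ t', (((Ext R (ModuleCat.{u} R) j).map (quotPow J h).op).app Y).hom x = 0) :
    Subsingleton ((localCohomology J j).obj Y) := by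
  let F := localCohomology.diagram (localCohomology.idealPowersDiagram J) j
  have hF : HasColimit F :=
    localCohomology.hasColimitDiagram.{u, 0} (localCohomology.idealPowersDiagram J) j
  suffices hz : IsZero ((colimit F).obj Y) from ModuleCat.isZero_iff_subsingleton.1 hz
  rw [IsZero.iff_id_eq_zero]
  refine (isColimitOfPreserves ((evaluation _ _).obj Y) (colimit.isColimit F)).hom_ext fun t => ?_
  refine ((Category.comp_id ((colimit.ι F t).app Y)).trans ?_).trans comp_zero.symm
  ext x
  obtain ⟨t', ht, hx⟩ := H t.unop.unop x
  let w : t ⟶ op (op t') := (homOfLE ht).op.op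
  have h1 : (F.map w ≫ colimit.ι F (op (op t'))).app Y = (colimit.ι F t).app Y := by
    rw [colimit.w]
  have h2 := congrArg (fun f => f.hom x) h1
  exact h2.symm.trans ((congrArg ((colimit.ι F (op (op t'))).app Y).hom hx).trans (map_zero _))

end LocalCohomologyVanishing

section ExtDies

open CategoryTheory Opposite Limits

universe u

variable {R : Type u} [CommRing R]

/-- The direct limit of `Ext^i(R ⧸ J ^ t, M)` vanishes. -/
def ExtDies (J : Ideal R) (i : ℕ) (M : ModuleCat.{u} R) : Prop :=
  ∀ (t : ℕ) (x : Abelian.Ext.{u} (ModuleCat.of R (R ⧸ J ^ t)) M i),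
    ∃ t', ∃ h : t ≤ t', (Abelian.Ext.mk₀ (quotPow J h)).comp x (zero_add i) = 0

theorem ExtDies.subsingleton_localCohomology {J : Ideal R} {i : ℕ} {M : ModuleCat.{u} R}
    (h : ExtDies J (i + 1) M) : Subsingleton ((localCohomology J (i + 1)).obj M) := by
  refine _root_.subsingleton_localCohomology J (i + 1) M fun t x => ?_
  let P := projectiveResolution (ModuleCat.of R (R ⧸ J ^ t))
  obtain ⟨f, hf, hx⟩ := exists_cocycle_of_ext P (i + 1) x
  obtain ⟨t', ht, h0⟩ := h t (P.extMk f _ rfl hf)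
  let P' := projectiveResolution (ModuleCat.of R (R ⧸ J ^ t'))
  let φ : ProjectiveResolution.Hom P' P (quotPow J ht) :=
    ⟨ProjectiveResolution.lift _ P' P, ProjectiveResolution.lift_commutes_zero _ P' P⟩
  rw [ProjectiveResolution.mk₀_comp_extMk f _ rfl hf φ,
    ProjectiveResolution.extMk_eq_zero_iff _ _ _ rfl _ i rfl] at h0
  exact ⟨t', ht, hx P' _ φ ⟨i, h0⟩⟩

theorem subsingleton_localCohomology_zero {J : Ideal R} {M : ModuleCat.{u} R}
    (h : ∀ t (f : ModuleCat.of R (R ⧸ J ^ t) ⟶ M), f = 0) :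
    Subsingleton ((localCohomology J 0).obj M) := by
  refine _root_.subsingleton_localCohomology J 0 M fun t x => ⟨t, le_rfl, ?_⟩
  let P := projectiveResolution (ModuleCat.of R (R ⧸ J ^ t))
  obtain ⟨f, hf, hx⟩ := exists_cocycle_of_ext P 0 x
  let φ : ProjectiveResolution.Hom P P (quotPow J le_rfl) :=
    ⟨ProjectiveResolution.lift _ P P, ProjectiveResolution.lift_commutes_zero _ P P⟩
  have h0 : f = 0 := by
    have h1 := P.exact₀.g_desc f hf
    exact h1.symm.trans ((congrArg (P.π.f 0 ≫ ·) (h t (P.exact₀.desc f hf))).trans comp_zero)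
  exact hx P _ φ ⟨0, 0, by rw [h0, comp_zero, comp_zero]⟩

/-- Dimension shifting for the vanishing of the direct limit of `Ext`. -/
theorem ExtDies.of_shortExact {J : Ideal R} {i : ℕ} {T : ShortComplex (ModuleCat.{u} R)}
    (hT : T.ShortExact) (h₃ : ExtDies J i T.X₃) (h₂ : ExtDies J (i + 1) T.X₂) :
    ExtDies J (i + 1) T.X₁ := by
  intro t x
  obtain ⟨t', ht, h0⟩ := h₂ t (x.comp (Abelian.Ext.mk₀ T.f) (add_zero _))
  rw [← Abelian.Ext.comp_assoc_of_third_deg_zero] at h0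
  obtain ⟨y, hy⟩ := Abelian.Ext.covariant_sequence_exact₁ _ hT _ h0 rfl
  obtain ⟨t'', ht', h1⟩ := h₃ t' y
  refine ⟨t'', ht.trans ht', ?_⟩
  have h2 : quotPow J (ht.trans ht') = quotPow J ht' ≫ quotPow J ht := by
    refine ModuleCat.hom_ext (LinearMap.ext fun z => ?_)
    obtain ⟨z, rfl⟩ := Ideal.Quotient.mk_surjective z
    rfl
  rw [h2, ← Abelian.Ext.mk₀_comp_mk₀_assoc, ← hy, ← Abelian.Ext.comp_assoc, h1]
  all_goals simp

end ExtDies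

section PowTorsion

open CategoryTheory Opposite Limits

universe u

variable {R : Type u} [CommRing R]

/-- The submodule of elements killed by a power of the ideal `J`. -/
def powTorsion (J : Ideal R) (E : Type*) [AddCommGroup E] [Module R E] : Submodule R E where
  carrier := {e | ∃ k : ℕ, ∀ a ∈ J ^ k, a • e = 0}
  zero_mem' := ⟨0, fun _ _ => smul_zero _⟩
  add_mem' := by
    rintro x y ⟨k, hk⟩ ⟨l, hl⟩
    exact ⟨max k l, fun a ha => by
      rw [smul_add, hk a (Ideal.pow_le_pow_right (le_max_left _ _) ha),
        hl a (Ideal.pow_le_pow_right (le_max_right _ _) ha), add_zero]⟩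
  smul_mem' := by
    rintro c x ⟨k, hk⟩
    exact ⟨k, fun a ha => by rw [smul_comm, hk a ha, smul_zero]⟩

theorem mem_powTorsion {J : Ideal R} {E : Type*} [AddCommGroup E] [Module R E] {e : E} :
    e ∈ powTorsion J E ↔ ∃ k : ℕ, ∀ a ∈ J ^ k, a • e = 0 := Iff.rfl

theorem exists_pow_smul_eq_zero_of_fg {J : Ideal R} {M E : Type*} [AddCommGroup M] [Module R M]
    [Module.Finite R M] [AddCommGroup E] [Module R E] (g : M →ₗ[R] powTorsion J E) :
    ∃ k : ℕ, ∀ a ∈ J ^ k, ∀ m, a • g m = 0 := by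
  obtain ⟨s, hs⟩ := Module.Finite.fg_top (R := R) (M := M)
  choose k hk using fun m => (g m).2
  refine ⟨s.sup k, fun a ha m => ?_⟩
  have hm : m ∈ Submodule.span R (s : Set M) := hs ▸ Submodule.mem_top
  induction hm using Submodule.span_induction with
  | mem x hx => exact Subtype.ext (hk x a (Ideal.pow_le_pow_right (Finset.le_sup hx) ha))
  | zero => rw [map_zero, smul_zero]
  | add x y _ _ hx hy => rw [map_add, smul_add, hx, hy, add_zero]
  | smul c x _ hx => rw [map_smul, smul_comm, hx, smul_zero]

theorem injective_powTorsion [IsNoetherianRing R] (J : Ideal R) (E : Type u) [AddCommGroup E] [Module R E]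
    [Module.Injective R E] : Module.Injective R (powTorsion J E) := by
  refine Module.Baer.injective fun I g => ?_
  obtain ⟨s, hs⟩ := exists_pow_smul_eq_zero_of_fg g
  obtain ⟨k, hk⟩ := J.exists_pow_inf_eq_pow_smul (M := R) I
  have hg : ∀ x : I, (x : R) ∈ J ^ (s + k) → g x = 0 := by
    intro x hx
    have h1 : (x : R) ∈ J ^ (s + k) • (⊤ : Submodule R R) ⊓ I := ⟨by simpa using hx, x.2⟩
    rw [hk _ (Nat.le_add_left k s), Nat.add_sub_cancel] at h1
    have h2 : (x : R) ∈ J ^ s • I := Submodule.smul_mono le_rfl inf_le_right h1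
    have h3 : x ∈ J ^ s • (⊤ : Submodule R I) := (Submodule.mem_smul_top_iff _ _ _).2 h2
    refine Submodule.smul_induction_on h3 (fun a ha y _ => ?_) fun y z hy hz => ?_
    · rw [map_smul, hs a ha]
    · rw [map_add, hy, hz, add_zero]
  let i : (I ⧸ LinearMap.ker ((Submodule.mkQ (J ^ (s + k))).comp I.subtype)) →ₗ[R] R ⧸ J ^ (s + k) :=
    Submodule.liftQ _ ((Submodule.mkQ (J ^ (s + k))).comp I.subtype) le_rfl
  have hi : Function.Injective i := by
    rw [← LinearMap.ker_eq_bot]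
    exact Submodule.ker_liftQ_eq_bot _ _ _ le_rfl
  obtain ⟨h, hh⟩ := Module.Injective.out i hi
    (Submodule.liftQ _ ((powTorsion J E).subtype.comp g) fun x hx => by
      have : (x : R) ∈ J ^ (s + k) := (Submodule.Quotient.mk_eq_zero _).1 hx
      rw [LinearMap.mem_ker, LinearMap.comp_apply, hg x this, map_zero])
  have hmem : ∀ x : R, h (Submodule.mkQ _ x) ∈ powTorsion J E := fun x => ⟨s + k, fun a ha => by
    rw [← map_smul, ← map_smul, smul_eq_mul]
    have : Submodule.mkQ (J ^ (s + k)) (a * x) = 0 :=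
      (Submodule.Quotient.mk_eq_zero _).2 (Ideal.mul_mem_right _ _ ha)
    rw [this, map_zero]⟩
  refine ⟨LinearMap.codRestrict _ (h.comp (Submodule.mkQ _)) hmem, fun x hx => Subtype.ext ?_⟩
  exact hh (Submodule.Quotient.mk ⟨x, hx⟩)

theorem ExtDies.of_exact {J : Ideal R} {i : ℕ} {A B C : Type u} [AddCommGroup A] [Module R A]
    [AddCommGroup B] [Module R B] [AddCommGroup C] [Module R C] (f : A →ₗ[R] B) (g : B →ₗ[R] C)
    (hf : Function.Injective f) (hfg : Function.Exact f g) (hg : Function.Surjective g)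
    (h₃ : ExtDies J i (ModuleCat.of R C)) (h₂ : ExtDies J (i + 1) (ModuleCat.of R B)) :
    ExtDies J (i + 1) (ModuleCat.of R A) :=
  ExtDies.of_shortExact (ModuleCat.shortComplex_shortExact
    (ShortComplex.moduleCatMk f g hfg.linearMap_comp_eq_zero) hfg hf hg) h₃ h₂

theorem extDies_succ_of_injective (J : Ideal R) (i : ℕ) (E : ModuleCat.{u} R) [Injective E] :
    ExtDies J (i + 1) E := fun t x =>
  ⟨t, le_rfl, by rw [Abelian.Ext.eq_zero_of_injective x, Abelian.Ext.comp_zero]⟩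

theorem extDies_zero {J : Ideal R} {M : ModuleCat.{u} R}
    (h : ∀ t (f : ModuleCat.of R (R ⧸ J ^ t) ⟶ M), f = 0) : ExtDies J 0 M := fun t x => by
  obtain ⟨f, rfl⟩ := (Abelian.Ext.mk₀_bijective _ _).2 x
  exact ⟨t, le_rfl, by rw [h t f, Abelian.Ext.mk₀_zero, Abelian.Ext.comp_zero]⟩

theorem ExtDies.one_of_shortExact {J : Ideal R} {T : ShortComplex (ModuleCat.{u} R)}
    (hT : T.ShortExact) [Injective T.X₂] (h : ∀ γ : T.X₂, ∃ k, ∀ a ∈ J ^ k, a • γ = 0) :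
    ExtDies J 1 T.X₁ := by
  intro t x
  obtain ⟨y, rfl⟩ := Abelian.Ext.covariant_sequence_exact₁ _ hT x
    (Abelian.Ext.eq_zero_of_injective (I := T.X₂) _) (zero_add 1)
  obtain ⟨φ, rfl⟩ := (Abelian.Ext.mk₀_bijective _ _).2 y
  have hg : Function.Surjective T.g.hom := (ModuleCat.epi_iff_surjective _).1 hT.epi_g
  obtain ⟨γ, hγ⟩ := hg (φ.hom (Submodule.Quotient.mk 1))
  obtain ⟨k, hk⟩ := h γ
  let φ' : ModuleCat.of R (R ⧸ J ^ (max k t)) ⟶ T.X₂ :=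
    ModuleCat.ofHom (Submodule.liftQ _ (LinearMap.toSpanSingleton R _ γ) fun a ha =>
      hk a (Ideal.pow_le_pow_right (le_max_left _ _) ha))
  refine ⟨max k t, le_max_right _ _, ?_⟩
  have hh : quotPow J (le_max_right k t) ≫ φ = φ' ≫ T.g := by
    refine ModuleCat.hom_ext (LinearMap.ext fun z => ?_)
    obtain ⟨z, rfl⟩ := Ideal.Quotient.mk_surjective z
    change φ.hom (Submodule.Quotient.mk z) = T.g.hom (z • γ)
    refine Eq.trans ?_ ((T.g.hom.map_smul z γ).trans
      ((congrArg (z • ·) hγ).trans (φ.hom.map_smul z _).symm)).symm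
    refine congrArg φ.hom ?_
    change _ = Submodule.Quotient.mk (z • 1)
    rw [smul_eq_mul, mul_one]
  rw [Abelian.Ext.mk₀_comp_mk₀_assoc, hh, ← Abelian.Ext.mk₀_comp_mk₀_assoc, hT.comp_extClass,
    Abelian.Ext.comp_zero]

/-- A power-torsion module embeds into a power-torsion injective module. -/
theorem exists_injective_powTorsion [IsNoetherianRing R] (J : Ideal R) (N : Type u) [AddCommGroup N]
    [Module R N] (hN : powTorsion J N = ⊤) : ∃ (E : ModuleCat.{u} R) (f : N →ₗ[R] E),
      Injective E ∧ powTorsion J E = ⊤ ∧ Function.Injective f := by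
  let E := Injective.under (ModuleCat.of R N)
  have hE : Module.Injective R E :=
    Module.injective_module_of_injective_object R E (inj := inferInstanceAs (Injective E))
  let ι : N →ₗ[R] E := (Injective.ι (ModuleCat.of R N)).hom
  have hι : Function.Injective ι := (ModuleCat.mono_iff_injective _).1 inferInstance
  have hmem : ∀ x, ι x ∈ powTorsion J E := fun x => by
    obtain ⟨k, hk⟩ := mem_powTorsion.1 (hN ▸ Submodule.mem_top : x ∈ powTorsion J N)
    exact ⟨k, fun a ha => by rw [← map_smul, hk a ha, map_zero]⟩
  have := injective_powTorsion J E
  refine ⟨ModuleCat.of R (powTorsion J E), ι.codRestrict _ hmem,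
    Module.injective_object_of_injective_module R _, ?_,
    fun x y hxy => hι (congrArg Subtype.val hxy)⟩
  refine eq_top_iff.2 fun x _ => ?_
  obtain ⟨k, hk⟩ := x.2
  exact ⟨k, fun a ha => Subtype.ext (hk a ha)⟩

/-- The higher local cohomology of a torsion module vanishes. -/
theorem extDies_of_powTorsion [IsNoetherianRing R] (J : Ideal R) (i : ℕ) (N : Type u) [AddCommGroup N]
    [Module R N] (hN : powTorsion J N = ⊤) : ExtDies J (i + 1) (ModuleCat.of R N) := by
  induction i generalizing N with
  | zero =>
    obtain ⟨E, f, hE, htop, hf⟩ := exists_injective_powTorsion J N hN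
    have hfg := f.exact_map_mkQ_range
    let T := ShortComplex.moduleCatMk f (Submodule.mkQ (LinearMap.range f))
      hfg.linearMap_comp_eq_zero
    have : Injective T.X₂ := hE
    exact ExtDies.one_of_shortExact (T := T)
      (ModuleCat.shortComplex_shortExact T hfg hf (Submodule.mkQ_surjective _)) fun (γ : E) =>
      mem_powTorsion.1 (htop ▸ Submodule.mem_top : γ ∈ powTorsion J E)
  | succ i ih =>
    obtain ⟨E, f, hE, htop, hf⟩ := exists_injective_powTorsion J N hN
    refine ExtDies.of_exact f (Submodule.mkQ (LinearMap.range f)) hf f.exact_map_mkQ_range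
      (Submodule.mkQ_surjective _) (ih _ ?_) (extDies_succ_of_injective J _ E)
    refine eq_top_iff.2 fun x _ => ?_
    obtain ⟨γ, rfl⟩ := Submodule.mkQ_surjective _ x
    obtain ⟨k, hk⟩ := mem_powTorsion.1 (htop ▸ Submodule.mem_top : γ ∈ powTorsion J E)
    exact ⟨k, fun a ha => by rw [← map_smul, hk a ha, map_zero]⟩

end PowTorsion

section ExtDiesSum

open CategoryTheory Opposite Limits

universe u

variable {R : Type u} [CommRing R]

/-- If multiplication by elements of every power of `J` suffices to write the identity of `M`,
then all `Ext^i(R ⧸ J ^ t, M)` vanish. -/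
theorem extDies_of_sum_smul {ι : Type*} [Fintype ι] {J : Ideal R} (i : ℕ) {M : Type u}
    [AddCommGroup M] [Module R M]
    (h : ∀ t : ℕ, ∃ (a : ι → R) (ψ : ι → M →ₗ[R] M), (∀ c, a c ∈ J ^ t) ∧
      ∀ m, ∑ c, a c • ψ c m = m) : ExtDies J i (ModuleCat.of R M) := by
  intro t x
  obtain ⟨a, ψ, ha, hψ⟩ := h t
  have h1 : (𝟙 (ModuleCat.of R M)) = ∑ c, a c • ModuleCat.ofHom (ψ c) := by
    refine ModuleCat.hom_ext (LinearMap.ext fun m => ?_)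
    rw [ModuleCat.hom_sum]
    simp [hψ]
  have h0 : ∀ c, a c • x = 0 := fun c => by
    have h2 : a c • 𝟙 (ModuleCat.of R (R ⧸ J ^ t)) = 0 := by
      refine ModuleCat.hom_ext (LinearMap.ext fun z => ?_)
      obtain ⟨z, rfl⟩ := Ideal.Quotient.mk_surjective z
      exact Ideal.Quotient.eq_zero_iff_mem.2 (Ideal.mul_mem_right z _ (ha c))
    rw [← Abelian.Ext.mk₀_id_comp x, ← Abelian.Ext.smul_comp, ← Abelian.Ext.mk₀_smul, h2,
      Abelian.Ext.mk₀_zero, Abelian.Ext.zero_comp]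
  refine ⟨t, le_rfl, ?_⟩
  have : x = 0 := by
    rw [← Abelian.Ext.comp_mk₀_id x, h1, Abelian.Ext.mk₀_sum, Abelian.Ext.comp_sum]
    refine Finset.sum_eq_zero fun c _ => ?_
    rw [Abelian.Ext.mk₀_smul, Abelian.Ext.comp_smul, ← Abelian.Ext.smul_comp, h0]
    simp
  rw [this, Abelian.Ext.comp_zero]

theorem extDies_of_subsingleton (J : Ideal R) (i : ℕ) (M : Type u) [AddCommGroup M] [Module R M]
    [Subsingleton M] : ExtDies J i (ModuleCat.of R M) :=
  extDies_of_sum_smul (ι := Empty) i fun _ =>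
    ⟨fun _ => 0, fun _ => 0, fun c => c.elim, fun _ => Subsingleton.elim _ _⟩

theorem ExtDies.of_linearEquiv {J : Ideal R} {i : ℕ} {M N : Type u} [AddCommGroup M] [Module R M]
    [AddCommGroup N] [Module R N] (e : M ≃ₗ[R] N) (h : ExtDies J (i + 1) (ModuleCat.of R N)) :
    ExtDies J (i + 1) (ModuleCat.of R M) :=
  ExtDies.of_exact e.toLinearMap (0 : N →ₗ[R] PUnit.{u + 1}) e.injective
    (fun y => ⟨fun _ => e.surjective y, fun _ => rfl⟩) (fun _ => ⟨0, Subsingleton.elim _ _⟩)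
    (extDies_of_subsingleton J i _) h

theorem hom_eq_zero_of_smul_injective {J : Ideal R} {M : ModuleCat.{u} R} {a : R} (ha : a ∈ J)
    (h : ∀ m : M, a • m = 0 → m = 0) (t : ℕ) (f : ModuleCat.of R (R ⧸ J ^ t) ⟶ M) : f = 0 := by
  have hpow : ∀ (k : ℕ) (m : M), a ^ k • m = 0 → m = 0 := fun k => by
    induction k with
    | zero => exact fun m hm => by simpa using hm
    | succ k ih => exact fun m hm => ih m (h _ (by rwa [smul_smul, ← pow_succ']))
  refine ModuleCat.hom_ext (LinearMap.ext fun z => hpow t _ ?_)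
  obtain ⟨z, rfl⟩ := Ideal.Quotient.mk_surjective z
  refine (f.hom.map_smul _ _).symm.trans ?_
  have h0 : a ^ t • (Ideal.Quotient.mk (J ^ t) z) = 0 :=
    Ideal.Quotient.eq_zero_iff_mem.2 (Ideal.mul_mem_right z _ (Ideal.pow_mem_pow ha t))
  exact (congrArg f.hom h0).trans (map_zero _)

theorem powTorsion_eq_top_of_forall {ι : Type*} [Finite ι] (q : ι → R) {M : Type*} [AddCommGroup M]
    [Module R M] (h : ∀ (x : M) c, ∃ k : ℕ, q c ^ k • x = 0) :
    powTorsion (Ideal.span (Set.range q)) M = ⊤ := by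
  refine eq_top_iff.2 fun x _ => ?_
  have hle : Ideal.span (Set.range q) ≤
      Ideal.radical (LinearMap.ker (LinearMap.toSpanSingleton R M x)) := by
    rw [Ideal.span_le]
    rintro _ ⟨c, rfl⟩
    exact h x c
  exact Ideal.exists_pow_le_of_le_radical_of_fg hle
    (Submodule.fg_span (Set.finite_range q))

end ExtDiesSum

section CechComplex

variable {R L ι : Type*} [CommRing R] [Field L] [Algebra R L]

variable (R L ι) in
/-- The Čech differential on cochains of degree `b`. -/
def cechLin (b : ℕ) : (List ι → L) →ₗ[R] (List ι → L) where
  toFun f l := if l.length = b + 1 then cechD f l else 0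
  map_add' f g := by
    funext l
    rw [Pi.add_apply]
    split_ifs <;> simp [cechD_add]
  map_smul' c f := by
    funext l
    rw [Pi.smul_apply]
    split_ifs
    · exact map_cechD (DistribSMul.toAddMonoidHom L c) f l
    · simp

theorem cechLin_apply {b : ℕ} {f : List ι → L} {l : List ι} (hl : l.length = b + 1) :
    cechLin R L ι b f l = cechD f l := if_pos hl

theorem cechLin_apply_of_ne {b : ℕ} {f : List ι → L} {l : List ι} (hl : l.length ≠ b + 1) :
    cechLin R L ι b f l = 0 := if_neg hl

theorem cechLin_cechLin (b : ℕ) (f : List ι → L) :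
    cechLin R L ι (b + 1) (cechLin R L ι b f) = 0 := by
  funext l
  by_cases hl : l.length = b + 1 + 1
  · rw [cechLin_apply hl]
    refine Eq.trans (cechD_congr fun l' _ hl' => cechLin_apply ?_) (cechD_cechD f l)
    omega
  · exact cechLin_apply_of_ne hl

variable [DecidableEq ι]

/-- The Čech cochains of degree `b` with coefficients in `F`. -/
def cechCochain (F : Finset ι → Submodule R L) (b : ℕ) : Submodule R (List ι → L) where
  carrier := {f | (∀ l, l.length = b → f l ∈ F l.toFinset) ∧ ∀ l, l.length ≠ b → f l = 0}
  zero_mem' := ⟨fun _ _ => zero_mem _, fun _ _ => rfl⟩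
  add_mem' := by
    rintro f g ⟨hf, hf'⟩ ⟨hg, hg'⟩
    exact ⟨fun l hl => add_mem (hf l hl) (hg l hl), fun l hl => by
      rw [Pi.add_apply, hf' l hl, hg' l hl, add_zero]⟩
  smul_mem' := by
    rintro c f ⟨hf, hf'⟩
    exact ⟨fun l hl => Submodule.smul_mem _ c (hf l hl), fun l hl => by
      rw [Pi.smul_apply, hf' l hl, smul_zero]⟩

variable {F : Finset ι → Submodule R L}

theorem cechLin_mem (hF : Monotone F) {b : ℕ} {f : List ι → L} (hf : f ∈ cechCochain F b) :
    cechLin R L ι b f ∈ cechCochain F (b + 1) := by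
  refine ⟨fun l hl => ?_, fun l hl => cechLin_apply_of_ne hl⟩
  rw [cechLin_apply hl]
  refine cechD_mem fun l' hl' hlen => hF (fun x hx => ?_) (hf.1 l' (by omega))
  rw [List.mem_toFinset] at hx ⊢
  exact hl' hx

variable (F) in
/-- The Čech cocycles of degree `b`. -/
def cechCocycle (b : ℕ) : Submodule R (List ι → L) :=
  cechCochain F b ⊓ LinearMap.ker (cechLin R L ι b)

variable (F) in
/-- The Čech coboundaries of degree `b + 1`. -/
def cechCobound (b : ℕ) : Submodule R (List ι → L) :=
  (cechCochain F b).map (cechLin R L ι b)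

theorem cechCobound_le (hF : Monotone F) (b : ℕ) : cechCobound F b ≤ cechCocycle F (b + 1) := by
  rintro _ ⟨f, hf, rfl⟩
  exact ⟨cechLin_mem hF hf, cechLin_cechLin b f⟩

theorem cechCocycle_le_cechCobound [Fintype ι] {b : ℕ}
    (h : CechExact (fun t => (F t).toAddSubgroup) (Finset.univ : Finset ι) (b + 1)) :
    cechCocycle F (b + 1) ≤ cechCobound F b := by
  rintro f ⟨hf, hfc⟩
  obtain ⟨g, hg, hgf⟩ := h f (fun l _ => hf.1 l) fun l _ hl =>
    (cechLin_apply hl).symm.trans (congrFun hfc l)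
  refine ⟨fun l => if l.length = b then g l else 0, ⟨fun l hl => ?_, fun l hl => if_neg hl⟩,
    funext fun l => ?_⟩
  · beta_reduce
    rw [if_pos hl]
    exact hg l (fun _ _ => Finset.mem_univ _) (by omega)
  · by_cases hl : l.length = b + 1
    · rw [cechLin_apply hl, ← hgf l (fun _ _ => Finset.mem_univ _) hl]
      exact cechD_congr fun l' _ hl' => if_pos (by omega)
    · rw [cechLin_apply_of_ne hl, hf.2 l hl]

theorem exists_pow_smul_mem_cechCobound [Finite ι] (q : ι → R)
    (hq : ∀ c t y, y ∈ F (insert c t) → ∃ k : ℕ, q c ^ k • y ∈ F t) {b : ℕ} {f : List ι → L}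
    (hf : f ∈ cechCocycle F (b + 1)) (c : ι) : ∃ k : ℕ, q c ^ k • f ∈ cechCobound F b := by
  have h1 : ∀ l : List ι, ∃ k : ℕ, l.length = b → q c ^ k • f (c :: l) ∈ F l.toFinset := fun l => by
    by_cases hl : l.length = b
    · obtain ⟨k, hk⟩ := hq c l.toFinset (f (c :: l)) (by
        rw [← List.toFinset_cons]
        exact hf.1.1 _ (by rw [List.length_cons, hl]))
      exact ⟨k, fun _ => hk⟩
    · exact ⟨0, fun h => absurd h hl⟩
  choose k hk using h1
  let m := (List.finite_length_eq ι b).toFinset.sup k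
  refine ⟨m, fun l => if l.length = b then q c ^ m • f (c :: l) else 0,
    ⟨fun l hl => ?_, fun l hl => if_neg hl⟩, funext fun l => ?_⟩
  · have hle : k l ≤ m := Finset.le_sup (f := k) ((Set.Finite.mem_toFinset _).2 hl)
    beta_reduce
    rw [if_pos hl, ← Nat.sub_add_cancel hle, pow_add, mul_smul]
    exact Submodule.smul_mem _ _ (hk l hl)
  · by_cases hl : l.length = b + 1
    · rw [cechLin_apply hl]
      have h2 : f l - cechD (fun l' => f (c :: l')) l = 0 := by
        rw [← cechD_cons, ← cechLin_apply (R := R) (b := b + 1) (by rw [List.length_cons, hl])]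
        exact congrFun hf.2 _
      refine (cechD_congr (g := fun l' => q c ^ m • f (c :: l')) fun l' _ hl' =>
        if_pos (by omega)).trans ?_
      refine (map_cechD (DistribSMul.toAddMonoidHom L (q c ^ m)) (fun l' => f (c :: l')) l).trans ?_
      rw [← sub_eq_zero.1 h2]
      rfl
    · rw [cechLin_apply_of_ne hl, Pi.smul_apply, hf.1.2 l hl, smul_zero]

end CechComplex

section CechExt

universe u

variable {R L ι : Type u} [CommRing R] [Field L] [Algebra R L]

theorem extDies_quotient {J : Ideal R} {i : ℕ} {M : Type u} [AddCommGroup M] [Module R M]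
    {P Q : Submodule R M} (hPQ : P ≤ Q)
    (h₃ : ExtDies J i (ModuleCat.of R (Q ⧸ P.submoduleOf Q)))
    (h₂ : ExtDies J (i + 1) (ModuleCat.of R Q)) : ExtDies J (i + 1) (ModuleCat.of R P) := by
  refine ExtDies.of_exact (Submodule.inclusion hPQ) (Submodule.mkQ (P.submoduleOf Q))
    (Submodule.inclusion_injective hPQ) (fun x => ?_) (Submodule.mkQ_surjective _) h₃ h₂
  rw [← LinearMap.mem_ker, Submodule.ker_mkQ, ← LinearMap.coe_range, Submodule.range_inclusion]
  rfl

theorem smul_injective_of_algebraMap_ne_zero {a : R} (ha : algebraMap R L a ≠ 0)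
    (P : Submodule R (List ι → L)) (m : P) (h : a • m = 0) : m = 0 := by
  refine Subtype.ext (funext fun l => ?_)
  have h1 : a • (m : List ι → L) l = 0 := congrFun (congrArg Subtype.val h) l
  rw [Algebra.smul_def] at h1
  exact (mul_eq_zero.1 h1).resolve_left ha

variable [DecidableEq ι] {F : Finset ι → Submodule R L}

theorem extDies_cechCochain [Fintype ι] {q : ι → R} (hq : ∀ c, algebraMap R L (q c) ≠ 0)
    (hF : ∀ t, ∀ c ∈ t, ∀ y ∈ F t, (algebraMap R L (q c))⁻¹ * y ∈ F t) (i b : ℕ) :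
    ExtDies (Ideal.span (Set.range q)) i (ModuleCat.of R (cechCochain F (b + 1))) := by
  refine extDies_of_sum_smul (ι := ι) i fun t => ?_
  have hF' : ∀ (k : ℕ) (s), ∀ c ∈ s, ∀ y ∈ F s,
      ((algebraMap R L (q c))⁻¹) ^ k * y ∈ F s := by
    intro k
    induction k with
    | zero => simp
    | succ k ih =>
      intro s c hc y hy
      rw [pow_succ', mul_assoc]; exact hF s c hc _ (ih s c hc y hy)
  let ψ (c : ι) : (List ι → L) →ₗ[R] (List ι → L) :=
    { toFun := fun f l => if l.head? = some c then ((algebraMap R L (q c))⁻¹) ^ t * f l else 0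
      map_add' := fun f g => funext fun l => by
        by_cases h : l.head? = some c <;> simp [h, mul_add]
      map_smul' := fun r f => funext fun l => by
        simp only [Pi.smul_apply, smul_ite, smul_zero, mul_smul_comm, RingHom.id_apply] }
  have hψ : ∀ c, ∀ f ∈ cechCochain F (b + 1), ψ c f ∈ cechCochain F (b + 1) := fun c f hf => by
    refine ⟨fun l hl => ?_, fun l hl => ?_⟩
    · change ite _ _ _ ∈ _
      split_ifs with h
      · exact hF' t _ c (List.mem_toFinset.2 (List.mem_of_mem_head? h)) _ (hf.1 l hl)
      · exact zero_mem _
    · change ite _ _ _ = _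
      rw [hf.2 l hl, mul_zero, ite_self]
  refine ⟨fun c => q c ^ t, fun c => (ψ c).restrict (hψ c), fun c =>
    Ideal.pow_mem_pow (Ideal.subset_span (Set.mem_range_self c)) t, fun f => Subtype.ext (funext fun l => ?_)⟩
  have h1 : (((∑ c, q c ^ t • (ψ c).restrict (hψ c) f : cechCochain F (b + 1)) : List ι → L)) l =
      ∑ c, q c ^ t • ψ c f l := by
    rw [Submodule.coe_sum, Finset.sum_apply]
    rfl
  rw [h1]
  rcases l with _ | ⟨c, l⟩
  · rw [f.2.2 [] (by simp)]
    exact Finset.sum_eq_zero fun c _ => by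
      rw [(hψ c f f.2).2 [] (by simp), smul_zero]
  · refine (Finset.sum_eq_single c (fun d _ hd => ?_) (by simp)).trans ?_
    · change q d ^ t • ite _ _ _ = _
      rw [if_neg (by simpa using hd.symm), smul_zero]
    · change q c ^ t • ite _ _ _ = _
      rw [if_pos (by simp), Algebra.smul_def, ← mul_assoc, map_pow, ← mul_pow,
        mul_inv_cancel₀ (hq c), one_pow, one_mul]

theorem extDies_cechCobound [IsNoetherianRing R] [Fintype ι] [Nonempty ι] {q : ι → R}
    (hq : ∀ c, algebraMap R L (q c) ≠ 0) (hmono : Monotone F)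
    (hinv : ∀ t, ∀ c ∈ t, ∀ y ∈ F t, (algebraMap R L (q c))⁻¹ * y ∈ F t)
    (hclear : ∀ c t y, y ∈ F (insert c t) → ∃ k : ℕ, q c ^ k • y ∈ F t) {i b : ℕ}
    (h : CechExact (fun t => (F t).toAddSubgroup) (Finset.univ : Finset ι) (i + b + 1)) :
    ExtDies (Ideal.span (Set.range q)) (i + 1) (ModuleCat.of R (cechCobound F b)) := by
  have key : ∀ i b, ExtDies (Ideal.span (Set.range q)) i
        (ModuleCat.of R (cechCocycle F (b + 1) ⧸
          (cechCobound F b).submoduleOf (cechCocycle F (b + 1)))) →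
      ExtDies (Ideal.span (Set.range q)) i (ModuleCat.of R (cechCobound F (b + 1))) →
      ExtDies (Ideal.span (Set.range q)) (i + 1) (ModuleCat.of R (cechCobound F b)) := by
    intro i b h₁ h₂
    refine extDies_quotient (cechCobound_le hmono b) h₁ ?_
    have hg : ∀ f ∈ cechCochain F (b + 1), cechLin R L ι (b + 1) f ∈ cechCobound F (b + 1) :=
      fun f hf => ⟨f, hf, rfl⟩
    refine ExtDies.of_exact (Submodule.inclusion inf_le_left) ((cechLin R L ι (b + 1)).restrict hg)
      (Submodule.inclusion_injective _) (fun f => ⟨fun hf => ?_, ?_⟩) ?_ h₂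
      (extDies_cechCochain hq hinv _ _)
    · exact ⟨⟨f, f.2, congrArg Subtype.val hf⟩, rfl⟩
    · rintro ⟨f, rfl⟩
      exact Subtype.ext f.2.2
    · rintro ⟨_, f, hf, rfl⟩
      exact ⟨⟨f, hf⟩, rfl⟩
  induction i generalizing b with
  | zero =>
    refine key 0 b ?_ (extDies_zero ?_)
    · have := Submodule.Quotient.subsingleton_iff.2 (Submodule.submoduleOf_eq_top.2
        (cechCocycle_le_cechCobound (F := F) (b := b) (by simpa using h)))
      exact extDies_of_subsingleton _ _ _
    · exact hom_eq_zero_of_smul_injective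
        (Ideal.subset_span ⟨Classical.arbitrary ι, rfl⟩)
        (smul_injective_of_algebraMap_ne_zero (hq _) _)
  | succ i ih =>
    refine key (i + 1) b (extDies_of_powTorsion _ _ _ (powTorsion_eq_top_of_forall q fun x c => ?_))
      (ih (by rwa [show i + (b + 1) + 1 = i + 1 + b + 1 by omega]))
    obtain ⟨f, rfl⟩ := Submodule.mkQ_surjective _ x
    obtain ⟨k, hk⟩ := exists_pow_smul_mem_cechCobound q hclear f.2 c
    exact ⟨k, (map_smul _ _ _).symm.trans ((Submodule.Quotient.mk_eq_zero _).2 hk)⟩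

/-- Local cohomology vanishes when the Čech complex is exact. -/
theorem subsingleton_localCohomology_of_cechExact [IsNoetherianRing R] [FaithfulSMul R L]
    [Fintype ι] [Nonempty ι] {q : ι → R} (hq : ∀ c, q c ≠ 0) (hmono : Monotone F)
    (hbot : F ∅ = LinearMap.range (Algebra.linearMap R L))
    (hinv : ∀ t, ∀ c ∈ t, ∀ y ∈ F t, (algebraMap R L (q c))⁻¹ * y ∈ F t)
    (hclear : ∀ c t y, y ∈ F (insert c t) → ∃ k : ℕ, q c ^ k • y ∈ F t) {j : ℕ}
    (h : CechExact (fun t => (F t).toAddSubgroup) (Finset.univ : Finset ι) j) :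
    Subsingleton ((localCohomology (Ideal.span (Set.range q)) j).obj (ModuleCat.of R R)) := by
  have hinj := FaithfulSMul.algebraMap_injective R L
  have hq' : ∀ c, algebraMap R L (q c) ≠ 0 := fun c =>
    (map_ne_zero_iff _ hinj).2 (hq c)
  rcases j with _ | j
  · refine subsingleton_localCohomology_zero (hom_eq_zero_of_smul_injective
      (Ideal.subset_span ⟨Classical.arbitrary ι, rfl⟩) fun m hm => hinj ?_)
    have h1 : algebraMap R L (q (Classical.arbitrary ι) * m) = 0 :=
      (congrArg (algebraMap R L) hm).trans (map_zero _)
    rw [map_mul] at h1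
    rw [(mul_eq_zero.1 h1).resolve_left (hq' _), map_zero]
  · refine ExtDies.subsingleton_localCohomology (ExtDies.of_linearEquiv
      (N := cechCobound F 0) ?_ (extDies_cechCobound hq' hmono hinv hclear (by simpa using h)))
    let s : R →ₗ[R] (List ι → L) :=
      (LinearMap.single R (fun _ : List ι => L) []).comp (Algebra.linearMap R L)
    have hs : ∀ r, s r ∈ cechCochain F 0 := fun r => by
      refine ⟨fun l hl => ?_, fun l hl => ?_⟩
      · rw [List.length_eq_zero_iff] at hl
        subst hl
        rw [List.toFinset_nil, hbot]
        exact ⟨r, (Pi.single_eq_same (M := fun _ : List ι => L) [] (algebraMap R L r)).symm⟩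
      · exact Pi.single_eq_of_ne (M := fun _ : List ι => L) (by rintro rfl; exact hl rfl) _
    refine LinearEquiv.ofBijective
      (((cechLin R L ι 0).comp s).codRestrict (cechCobound F 0) fun r => ⟨s r, hs r, rfl⟩) ⟨?_, ?_⟩
    · rw [injective_iff_map_eq_zero]
      intro r hr
      have h1 := congrFun (congrArg Subtype.val hr) [Classical.arbitrary ι]
      replace h1 : cechLin R L ι 0 (s r) [Classical.arbitrary ι] = 0 := h1
      rw [cechLin_apply rfl, cechD_cons, cechD_nil, sub_zero] at h1
      refine hinj ?_
      rw [map_zero, ← h1]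
      exact (Pi.single_eq_same (M := fun _ : List ι => L) [] (algebraMap R L r)).symm
    · rintro ⟨_, f, hf, rfl⟩
      obtain ⟨r, hr⟩ : f [] ∈ LinearMap.range (Algebra.linearMap R L) := hbot ▸ hf.1 [] rfl
      refine ⟨r, Subtype.ext (congrArg (cechLin R L ι 0) (funext fun l => ?_))⟩
      by_cases hl : l = []
      · subst hl
        exact (Pi.single_eq_same (M := fun _ : List ι => L) [] (algebraMap R L r)).trans hr
      · rw [hf.2 l fun h => hl (List.length_eq_zero_iff.1 h)]
        exact Pi.single_eq_of_ne (M := fun _ : List ι => L) hl _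

end CechExt

section GenericFrame

theorem exists_derivation_extend {k S L : Type*} [CommRing k] [CommRing S] [Field L] [Algebra k S]
    [Algebra S L] [IsFractionRing S L] [Algebra k L] [IsScalarTower k S L] [Algebra ℚ L]
    (D : Derivation k S S) :
    ∃ D' : Derivation ℚ L L, ∀ s, D' (algebraMap S L s) = algebraMap S L (D s) := by
  let D₀ : Derivation k S L := (Algebra.linearMap S L).compDer D
  have hu : ∀ y : nonZeroDivisors S, IsUnit (derivationHom D₀ y) := fun y => by
    rw [TrivSqZeroExt.isUnit_iff_isUnit_fst]
    have h1 : (derivationHom D₀ (y : S)).fst = algebraMap S L y := by simp [derivationHom]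
    rw [h1]
    exact IsLocalization.map_units L y
  let φ : L →+* TrivSqZeroExt L L := IsLocalization.lift hu
  have hφ : ∀ s, φ (algebraMap S L s) = derivationHom D₀ s := fun s => IsLocalization.lift_eq hu s
  have hfst : ∀ x, (φ x).fst = x := fun x => by
    have h1 : (TrivSqZeroExt.fstHom L L L).toRingHom.comp φ = RingHom.id L :=
      IsLocalization.ringHom_ext (nonZeroDivisors S) (RingHom.ext fun s => by
        simp [hφ, derivationHom])
    exact congrArg (fun ψ : L →+* L => ψ x) h1
  let δ : L →+ L := (TrivSqZeroExt.sndHom L L).toAddMonoidHom.comp φ.toAddMonoidHom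
  refine ⟨Derivation.mk' δ.toRatLinearMap fun x y => ?_, fun s => ?_⟩
  · change (φ (x * y)).snd = x • (φ y).snd + y • (φ x).snd
    rw [map_mul, TrivSqZeroExt.snd_mul, hfst, hfst]
    simp [mul_comm]
  · change (φ (algebraMap S L s)).snd = _
    rw [hφ]
    change (TrivSqZeroExt.inl (algebraMap S L s) +
      TrivSqZeroExt.inr (algebraMap S L (D s)) : TrivSqZeroExt L L).snd = _
    rw [TrivSqZeroExt.snd_add, TrivSqZeroExt.snd_inl, TrivSqZeroExt.snd_inr, zero_add]

variable {K : Type*} [Field K] [Algebra ℚ K]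

theorem map_subPfaff {R R' : Type*} [CommRing R] [CommRing R'] (φ : R →+* R') {n : ℕ}
    (X : Matrix (Fin (2 * n + 1)) (Fin (2 * n + 1)) R) (c : Fin (2 * n + 1)) :
    φ (subPfaff X c) = subPfaff (X.map φ) c := by
  simp only [subPfaff, map_sum, pairProd, apply_ite φ, map_zsmul, map_prod, map_zero, Matrix.map_apply]

theorem subPfaff_skewX_ne_zero {n : ℕ} (c : Fin (2 * n + 1)) :
    subPfaff (skewX K (2 * n + 1)) c ≠ 0 := by
  rw [subPfaff_eq]
  refine mul_ne_zero (pow_ne_zero _ (neg_ne_zero.2 one_ne_zero)) ?_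
  have hsw : ∀ a b, (skewX K (2 * n + 1)).submatrix c.succAbove c.succAbove b a =
      -(skewX K (2 * n + 1)).submatrix c.succAbove c.succAbove a b := fun a b => skewX_swap K _ _
  rw [← skewEval_pfaffSum hsw]
  let f : {p : Fin (2 * n) × Fin (2 * n) // p.1 < p.2} →
      {p : Fin (2 * n + 1) × Fin (2 * n + 1) // p.1 < p.2} :=
    fun p => ⟨(c.succAbove p.1.1, c.succAbove p.1.2), Fin.strictMono_succAbove c p.2⟩
  have hf : Function.Injective f := fun p p' h => by
    have h1 := congrArg Subtype.val h
    exact Subtype.ext (Prod.ext (Fin.succAbove_right_injective (congrArg Prod.fst h1))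
      (Fin.succAbove_right_injective (congrArg Prod.snd h1)))
  have hev : ∀ p, skewEval ((skewX K (2 * n + 1)).submatrix c.succAbove c.succAbove) p =
      rename f (map (algebraMap ℚ K) p) := fun p => by
    induction p using MvPolynomial.induction_on with
    | C a => simp [skewEval, MvPolynomial.algebraMap_eq, IsScalarTower.algebraMap_apply ℚ K (MvPolynomial _ K)]
    | add p p' h h' => rw [map_add, h, h', map_add, map_add]
    | mul_X p i h =>
      rw [map_mul, h, map_mul, map_mul, map_X, rename_X]
      congr 1
      rw [skewEval, aeval_X]
      exact skewX_of_lt K (Fin.strictMono_succAbove c i.2)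
  rw [hev]
  intro h
  exact pfaffSum_skewX_ne_zero (map_injective _ (algebraMap ℚ K).injective
    (rename_injective f hf (h.trans (map_zero _).symm) |>.trans (map_zero _).symm))

variable {L : Type*} {N : ℕ} [Field L] [Algebra ℚ L] [Algebra K L] [IsScalarTower ℚ K L]
  [Algebra (MvPolynomial {p : Fin N × Fin N // p.1 < p.2} K) L]
  [IsScalarTower K (MvPolynomial {p : Fin N × Fin N // p.1 < p.2} K) L]

theorem exists_skewFrame_skewX [IsFractionRing (MvPolynomial {p : Fin N × Fin N // p.1 < p.2} K) L] :
    ∃ D, SkewFrame (IsScalarTower.toAlgHom ℚ K L).range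
      ((skewX K N).map (algebraMap (MvPolynomial {p : Fin N × Fin N // p.1 < p.2} K) L)) D := by
  choose D hD using fun a b => exists_derivation_extend (L := L) (skewD K N a b)
  refine ⟨D, fun a b => ?_, fun a d e f => ?_, ?_⟩
  · rw [Matrix.map_apply, skewX_swap, map_neg]
    rfl
  · rw [Matrix.map_apply, hD, skewD_skewX]
    split_ifs <;> simp
  · rintro a d _ ⟨x, rfl⟩
    change D a d (algebraMap K L x) = 0
    rw [IsScalarTower.algebraMap_apply K (MvPolynomial {p : Fin N × Fin N // p.1 < p.2} K) L, hD,
      Derivation.map_algebraMap, map_zero]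

theorem mem_entryAlg_skewX {y : L} : y ∈ entryAlg (IsScalarTower.toAlgHom ℚ K L).range
      ((skewX K N).map (algebraMap (MvPolynomial {p : Fin N × Fin N // p.1 < p.2} K) L)) ↔
    ∃ s, algebraMap (MvPolynomial {p : Fin N × Fin N // p.1 < p.2} K) L s = y := by
  constructor
  · intro hy
    have hle : entryAlg (IsScalarTower.toAlgHom ℚ K L).range
        ((skewX K N).map (algebraMap (MvPolynomial {p : Fin N × Fin N // p.1 < p.2} K) L)) ≤
        ((IsScalarTower.toAlgHom K (MvPolynomial {p : Fin N × Fin N // p.1 < p.2} K)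
          L).restrictScalars ℚ).range := by
      refine Algebra.adjoin_le ?_
      rintro _ (⟨x, rfl⟩ | ⟨p, rfl⟩)
      · exact ⟨C x, (IsScalarTower.algebraMap_apply K
          (MvPolynomial {p : Fin N × Fin N // p.1 < p.2} K) L x).symm⟩
      · exact ⟨_, rfl⟩
    exact hle hy
  · rintro ⟨s, rfl⟩
    induction s using MvPolynomial.induction_on with
    | C a => exact Algebra.subset_adjoin (Or.inl ⟨a, IsScalarTower.algebraMap_apply K
          (MvPolynomial {p : Fin N × Fin N // p.1 < p.2} K) L a⟩)
    | add p p' h h' => rw [map_add]; exact add_mem h h'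
    | mul_X p i h =>
      rw [map_mul]
      refine mul_mem h (Algebra.subset_adjoin (Or.inr ⟨i.1,
        congrArg (algebraMap _ L) (skewX_of_lt K i.2)⟩))

end GenericFrame

section LocSubmodule

variable {R L ι : Type*} [CommRing R] [Field L] [Algebra ℚ L] [Algebra R L]

/-- `locAlg B q t` as a submodule over a ring mapping into `B`. -/
def locSubmodule {B : Subalgebra ℚ L} (hB : ∀ r, algebraMap R L r ∈ B) (q : ι → L)
    (t : Finset ι) : Submodule R L where
  carrier := locAlg B q t
  zero_mem' := zero_mem _
  add_mem' := add_mem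
  smul_mem' r y hy := by
    rw [Algebra.smul_def]
    exact mul_mem (le_locAlg B q t (hB r)) hy

end LocSubmodule

/-- The local cohomology modules of the polynomial ring `S` in the entries of the generic
`(2n+1) × (2n+1)` skew-symmetric matrix, with support in the ideal of sub-maximal Pfaffians,
vanish in cohomological degrees not of the form `2s + 1` for `1 ≤ s ≤ n`. -/
theorem local_cohomology_submaximal_pfaffians_vanishing
    (K : Type) [Field K] [CharZero K] (n : ℕ) (hn : 1 ≤ n)
    (X : Matrix (Fin (2 * n + 1)) (Fin (2 * n + 1))
      (MvPolynomial {p : Fin (2 * n + 1) × Fin (2 * n + 1) // p.1 < p.2} K))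
    (hXlt : ∀ (i j : Fin (2 * n + 1)) (h : i < j), X i j = MvPolynomial.X ⟨(i, j), h⟩)
    (hXgt : ∀ (i j : Fin (2 * n + 1)) (h : j < i), X i j = -MvPolynomial.X ⟨(j, i), h⟩)
    (hXdiag : ∀ i, X i i = 0)
    (pf : Matrix (Fin (2 * n)) (Fin (2 * n))
        (MvPolynomial {p : Fin (2 * n + 1) × Fin (2 * n + 1) // p.1 < p.2} K) →
      MvPolynomial {p : Fin (2 * n + 1) × Fin (2 * n + 1) // p.1 < p.2} K)
    (hpf : ∀ A, pf A = (((2 ^ n * Nat.factorial n : ℕ) : K)⁻¹) •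
      ∑ σ : Equiv.Perm (Fin (2 * n)), (Equiv.Perm.sign σ : ℤ) •
        ∏ i : Fin n, A (σ ⟨2 * (i : ℕ), by omega⟩) (σ ⟨2 * (i : ℕ) + 1, by omega⟩))
    (I : Ideal (MvPolynomial {p : Fin (2 * n + 1) × Fin (2 * n + 1) // p.1 < p.2} K))
    (hI : I = Ideal.span (Set.range fun k : Fin (2 * n + 1) =>
      pf (X.submatrix (Fin.succAbove k) (Fin.succAbove k))))
    (j : ℕ) (hj : ¬ ∃ s : ℕ, 1 ≤ s ∧ s ≤ n ∧ j = 2 * s + 1) :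
    Subsingleton ((localCohomology I j).obj
      (ModuleCat.of (MvPolynomial {p : Fin (2 * n + 1) × Fin (2 * n + 1) // p.1 < p.2} K)
        (MvPolynomial {p : Fin (2 * n + 1) × Fin (2 * n + 1) // p.1 < p.2} K))) := by
  classical
  let σ := {p : Fin (2 * n + 1) × Fin (2 * n + 1) // p.1 < p.2}
  let L := FractionRing (MvPolynomial σ K)
  have hX : X = skewX K (2 * n + 1) := by
    ext1 a b
    rcases lt_trichotomy a b with h | rfl | h
    · rw [hXlt a b h, skewX_of_lt K h]
    · rw [hXdiag, skewX_self]
    · rw [hXgt a b h, skewX_swap, skewX_of_lt K h]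
  subst hX
  let q : Fin (2 * n + 1) → MvPolynomial σ K := subPfaff (skewX K (2 * n + 1))
  have hu : ((2 ^ n * Nat.factorial n : ℕ) : K) ≠ 0 :=
    Nat.cast_ne_zero.2 (mul_ne_zero (pow_ne_zero _ two_ne_zero) (Nat.factorial_ne_zero n))
  have hs : ∀ k : ℕ, ((-1 : MvPolynomial σ K) ^ k) * (-1) ^ k = 1 := fun k => by
    rw [← mul_pow, neg_one_mul, neg_neg, one_pow]
  have hpfq : ∀ k : Fin (2 * n + 1),
      pf ((skewX K (2 * n + 1)).submatrix k.succAbove k.succAbove) =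
        C ((2 ^ n * Nat.factorial n : ℕ) : K)⁻¹ * (-1) ^ (k : ℕ) * q k := fun k => by
    rw [hpf, MvPolynomial.smul_eq_C_mul, mul_assoc]
    refine congrArg _ ?_
    rw [show q k = _ from subPfaff_eq _ k, ← mul_assoc, hs, one_mul]
    rfl
  have hIq : I = Ideal.span (Set.range q) := by
    rw [hI]
    refine le_antisymm (Ideal.span_le.2 ?_) (Ideal.span_le.2 ?_)
    · rintro _ ⟨k, rfl⟩
      refine Set.mem_of_eq_of_mem (hpfq k) ?_
      exact Ideal.mul_mem_left _ _ (Ideal.subset_span ⟨k, rfl⟩)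
    · rintro _ ⟨k, rfl⟩
      have h2 : q k = C ((2 ^ n * Nat.factorial n : ℕ) : K) * (-1) ^ (k : ℕ) *
          pf ((skewX K (2 * n + 1)).submatrix k.succAbove k.succAbove) := by
        have h3 : (C ((2 ^ n * Nat.factorial n : ℕ) : K) : MvPolynomial σ K) *
            C ((2 ^ n * Nat.factorial n : ℕ) : K)⁻¹ = 1 := by
          rw [← C_mul, mul_inv_cancel₀ hu, C_1]
        rw [hpfq]
        linear_combination (-(q k) * (-1) ^ (k : ℕ) * (-1) ^ (k : ℕ)) * h3 - q k * hs k
      exact h2.symm ▸ Ideal.mul_mem_left _ _ (Ideal.subset_span ⟨k, rfl⟩)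
  rw [hIq]
  obtain ⟨D, hD⟩ := exists_skewFrame_skewX (K := K) (N := 2 * n + 1) (L := L)
  have hinj : Function.Injective (algebraMap (MvPolynomial σ K) L) := IsFractionRing.injective _ _
  have hqL : ∀ c, subPfaff ((skewX K (2 * n + 1)).map (algebraMap (MvPolynomial σ K) L)) c =
      algebraMap (MvPolynomial σ K) L (q c) := fun c => (map_subPfaff _ _ c).symm
  have hB : ∀ s : MvPolynomial σ K, algebraMap (MvPolynomial σ K) L s ∈
      entryAlg (IsScalarTower.toAlgHom ℚ K L).range
        ((skewX K (2 * n + 1)).map (algebraMap (MvPolynomial σ K) L)) :=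
    fun s => mem_entryAlg_skewX.2 ⟨s, rfl⟩
  have hq0 : ∀ c, subPfaff ((skewX K (2 * n + 1)).map (algebraMap (MvPolynomial σ K) L)) c ≠ 0 :=
    fun c => hqL c ▸ (map_ne_zero_iff _ hinj).2 (subPfaff_skewX_ne_zero c)
  refine subsingleton_localCohomology_of_cechExact
    (F := locSubmodule hB (subPfaff ((skewX K (2 * n + 1)).map (algebraMap (MvPolynomial σ K) L))))
    subPfaff_skewX_ne_zero (fun _ _ ht => locF_mono _ _ ht) ?_ (fun t c hc y hy => ?_)
    (fun c t y hy => ?_) (frameExact L n j hj _ _ D hD hq0)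
  · ext y
    rw [LinearMap.mem_range]
    refine Iff.trans ⟨fun hy => ?_, fun hy => le_locAlg _ _ _ hy⟩ mem_entryAlg_skewX
    exact locAlg_le le_rfl (by simp) hy
  · change _ ∈ locAlg _ _ t at hy ⊢
    exact mul_mem (hqL c ▸ inv_mem_locAlg _ _ hc) hy
  · obtain ⟨m, hm⟩ := exists_pow_mul_mem_locAlg (hqL c ▸ hB (q c)) (hq0 c) hy
    refine ⟨m, ?_⟩
    rw [Algebra.smul_def, map_pow]
    exact hqL c ▸ hm m le_rfl
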